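/- arXiv:0811.1374 — 2 statements merged into one kernel-verified Lean document; each statement's English description precedes it below -/
import Mathlib

section
/- Let q ≥ 1, S ≥ q be integers and let h : [0,∞) → ℝ be nonincreasing, with h(x) = 1 for x ∈ [0,1/2], h(x) = 0 for x > 1, and h an S-times iterated integral of a function of bounded variation. Then there exists a constant c > 0 depending only on q, S, and h such that for all integers n ≥ 1 and all x, ξ ∈ S^q with ξ ≠ x: |Φ_n(h; x·ξ)| ≤ c n^q (n√(1−x·ξ))^{1/2−q/2−S} whenever 0 ≤ x·ξ < 1, and |Φ_n(h; x·ξ)| ≤ c n^{q−S} whenever −1 ≤ x·ξ < 0. -/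
noncomputable section

open MeasureTheory Finset

namespace SD

/-- Euclidean space `ℝ^(q+1)`. -/
abbrev Euc (q : ℕ) := EuclideanSpace ℝ (Fin (q + 1))

/-- The unit sphere `S^q ⊂ ℝ^(q+1)`, as a type. -/
abbrev Sph (q : ℕ) : Type := Metric.sphere (0 : Euc q) 1

/-- Dot product of two points of the sphere. -/
def dot {q : ℕ} (x y : Sph q) : ℝ := ∑ i, (x : Euc q) i * (y : Euc q) i

/-- Geodesic distance `arccos (x ⬝ y)` on the sphere. -/
def gdist {q : ℕ} (x y : Sph q) : ℝ := Real.arccos (dot x y)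

/-- The mesh norm `δ_C(S^q)` of a finite set of points. -/
def meshNorm {q : ℕ} (C : Finset (Sph q)) : ℝ :=
  ⨆ x : Sph q, sInf ((fun ξ => gdist x ξ) '' (C : Set (Sph q)))

/-- `f : S^q → ℝ` belongs to `Π_n^q` : it is the restriction to the sphere of an algebraic
polynomial in `q+1` variables of total degree at most `n`. -/
def InPi (q n : ℕ) (f : Sph q → ℝ) : Prop :=
  ∃ P : MvPolynomial (Fin (q + 1)) ℝ, P.totalDegree ≤ n ∧
    ∀ x : Sph q, f x = MvPolynomial.eval (fun i => (x : Euc q) i) P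

/-- `f` is a spherical harmonic of degree `ℓ` : the restriction to the sphere of a
homogeneous harmonic polynomial of degree `ℓ`. -/
def IsSphHarm (q ℓ : ℕ) (f : Sph q → ℝ) : Prop :=
  ∃ P : MvPolynomial (Fin (q + 1)) ℝ, P.IsHomogeneous ℓ ∧
    (∑ i : Fin (q + 1), MvPolynomial.pderiv i (MvPolynomial.pderiv i P)) = 0 ∧
    ∀ x : Sph q, f x = MvPolynomial.eval (fun i => (x : Euc q) i) P

/-- Rotation of a point of the sphere by a linear isometry of the ambient space. -/
def rotate {q : ℕ} (R : Euc q ≃ₗᵢ[ℝ] Euc q) (x : Sph q) : Sph q :=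
  ⟨R x, by
    have hx : ‖(x : Euc q)‖ = 1 := mem_sphere_zero_iff_norm.mp x.2
    simp [mem_sphere_zero_iff_norm, hx]⟩

/-- `μ` is invariant under all rotations of the sphere. -/
def RotInvariant (q : ℕ) (μ : Measure (Sph q)) : Prop :=
  ∀ R : Euc q ≃ₗᵢ[ℝ] Euc q, Measure.map (rotate R) μ = μ

/-- `IterIntBV S f` : `f` is an `S` times iterated integral of a function of bounded
variation (on `[0,∞)`). -/
def IterIntBV : ℕ → (ℝ → ℝ) → Prop
  | 0, f => BoundedVariationOn f (Set.Ici 0)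
  | (S + 1), f => ∃ g : ℝ → ℝ, IterIntBV S g ∧ ∀ x : ℝ, 0 ≤ x → f x = f 0 + ∫ t in (0 : ℝ)..x, g t

/-- The standing hypotheses on the filter function `h` : `h = 1` on `[0,1/2]`, `h = 0` on
`(1,∞)`, `h` nonincreasing on `[0,∞)`, and `h` an `S` times iterated integral of a function
of bounded variation. -/
def GoodH (S : ℕ) (h : ℝ → ℝ) : Prop :=
  (∀ x : ℝ, 0 ≤ x → x ≤ 1 / 2 → h x = 1) ∧
  (∀ x : ℝ, 1 < x → h x = 0) ∧
  (∀ x y : ℝ, 0 ≤ x → x ≤ y → h y ≤ h x) ∧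
  IterIntBV S h

/-- `Y ℓ ·` is, for each `ℓ`, an orthonormal basis of the space of degree `ℓ` spherical
harmonics in `L²(μ)`. -/
def GoodBasis (q : ℕ) (μ : Measure (Sph q)) (d : ℕ → ℕ)
    (Y : (ℓ : ℕ) → Fin (d ℓ) → Sph q → ℝ) : Prop :=
  (∀ ℓ k, IsSphHarm q ℓ (Y ℓ k)) ∧
  (∀ (ℓ ℓ' : ℕ) (k : Fin (d ℓ)) (k' : Fin (d ℓ')),
      ∫ x, Y ℓ k x * Y ℓ' k' x ∂μ = if ℓ = ℓ' ∧ (k : ℕ) = (k' : ℕ) then 1 else 0) ∧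
  (∀ (ℓ : ℕ) (f : Sph q → ℝ), IsSphHarm q ℓ f →
      ∃ a : Fin (d ℓ) → ℝ, ∀ x, f x = ∑ k, a k * Y ℓ k x)

/-- The kernel `Φ_n(h; x·ξ) = Σ_{ℓ=0}^n h(ℓ/n) Σ_k Y_{ℓ,k}(x) Y_{ℓ,k}(ξ)`. -/
def Phi {q : ℕ} (d : ℕ → ℕ) (Y : (ℓ : ℕ) → Fin (d ℓ) → Sph q → ℝ) (h : ℝ → ℝ) (n : ℕ)
    (x ξ : Sph q) : ℝ :=
  ∑ ℓ ∈ range (n + 1), h ((ℓ : ℝ) / (n : ℝ)) * ∑ k, Y ℓ k x * Y ℓ k ξ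

/-- The discretized operator `σ_n(C, W; h; Z, x) = Σ_{ξ∈C} w_ξ z_ξ Φ_n(h; x·ξ)`. -/
def sigmaOp {q : ℕ} (d : ℕ → ℕ) (Y : (ℓ : ℕ) → Fin (d ℓ) → Sph q → ℝ) (h : ℝ → ℝ) (n : ℕ)
    (C : Finset (Sph q)) (w : Sph q → ℝ) (z : Sph q → ℝ) (x : Sph q) : ℝ :=
  ∑ ξ ∈ C, w ξ * z ξ * Phi d Y h n x ξ

/-- The summability operator `σ*_n(h; f, x) = ∫ f(ζ) Φ_n(h; x·ζ) dμ(ζ)`. -/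
def sigmaStar {q : ℕ} (μ : Measure (Sph q)) (d : ℕ → ℕ)
    (Y : (ℓ : ℕ) → Fin (d ℓ) → Sph q → ℝ) (h : ℝ → ℝ) (n : ℕ) (f : Sph q → ℝ)
    (x : Sph q) : ℝ :=
  ∫ ζ, f ζ * Phi d Y h n x ζ ∂μ

/-- Sup norm on the sphere. -/
def supNorm {q : ℕ} (f : Sph q → ℝ) : ℝ := ⨆ x : Sph q, |f x|

/-- Sup norm on a subset of the sphere. -/
def supNormOn {q : ℕ} (K : Set (Sph q)) (f : Sph q → ℝ) : ℝ := ⨆ x ∈ K, |f x|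

/-- The spherical cap of radius `δ` centered at `x₀`. -/
def cap {q : ℕ} (x₀ : Sph q) (δ : ℝ) : Set (Sph q) := {x | gdist x x₀ ≤ δ}

/-- `C` admits a Marcinkiewicz–Zygmund quadrature of order `m` with weights `w` and
M–Z constant `c₀`. -/
def MZQuad (q : ℕ) (μ : Measure (Sph q)) (m : ℕ) (C : Finset (Sph q)) (w : Sph q → ℝ)
    (c₀ : ℝ) : Prop :=
  (∀ P : Sph q → ℝ, InPi q (2 * m) P → ∑ ξ ∈ C, w ξ * P ξ = ∫ x, P x ∂μ) ∧
  (∀ P : Sph q → ℝ, InPi q (2 * m) P → ∀ p : ℝ, 1 ≤ p →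
      (∑ ξ ∈ C, |w ξ| * |P ξ| ^ p) ^ (1 / p) ≤ c₀ * (∫ x, |P x| ^ p ∂μ) ^ (1 / p))

/-- The sequence `n ↦ 2^((n+1)r) ‖σ*_{2^(n+1)}(h;f) − σ*_{2^n}(h;f)‖_{∞,K}`. -/
def WrSeqOn {q : ℕ} (K : Set (Sph q)) (μ : Measure (Sph q)) (d : ℕ → ℕ)
    (Y : (ℓ : ℕ) → Fin (d ℓ) → Sph q → ℝ) (h : ℝ → ℝ) (r : ℝ) (f : Sph q → ℝ) (n : ℕ) : ℝ :=
  (2 : ℝ) ^ (((n : ℝ) + 1) * r) *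
    supNormOn K (fun x => sigmaStar μ d Y h (2 ^ (n + 1)) f x - sigmaStar μ d Y h (2 ^ n) f x)

/-- The norm `‖f‖_{W_r(K)}`. -/
def WrNormOn {q : ℕ} (K : Set (Sph q)) (μ : Measure (Sph q)) (d : ℕ → ℕ)
    (Y : (ℓ : ℕ) → Fin (d ℓ) → Sph q → ℝ) (h : ℝ → ℝ) (r : ℝ) (f : Sph q → ℝ) : ℝ :=
  supNorm f + ⨆ n : ℕ, WrSeqOn K μ d Y h r f n

/-- The norm `‖f‖_{W_r}`. -/
def WrNorm {q : ℕ} (μ : Measure (Sph q)) (d : ℕ → ℕ)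
    (Y : (ℓ : ℕ) → Fin (d ℓ) → Sph q → ℝ) (h : ℝ → ℝ) (r : ℝ) (f : Sph q → ℝ) : ℝ :=
  WrNormOn Set.univ μ d Y h r f

/-- Membership in `W_r(K)` : `f` is continuous and the `W_r(K)` seminorm is finite. -/
def MemWrOn {q : ℕ} (K : Set (Sph q)) (μ : Measure (Sph q)) (d : ℕ → ℕ)
    (Y : (ℓ : ℕ) → Fin (d ℓ) → Sph q → ℝ) (h : ℝ → ℝ) (r : ℝ) (f : Sph q → ℝ) : Prop :=
  Continuous f ∧ BddAbove (Set.range (WrSeqOn K μ d Y h r f))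

/-- `y` is an orthonormal basis of `Π_n^q` in `L²(μ)` (so `N = dim Π_n^q`), whose `0`-th
element is the constant polynomial `1`. -/
def GoodPolyBasis (q n N : ℕ) (μ : Measure (Sph q)) (y : Fin N → Sph q → ℝ) : Prop :=
  (∀ i, InPi q n (y i)) ∧
  (∀ i j, ∫ x, y i x * y j x ∂μ = if i = j then 1 else 0) ∧
  (∀ P : Sph q → ℝ, InPi q n P → ∃ a : Fin N → ℝ, ∀ x, P x = ∑ i, a i * y i x) ∧
  (∀ i : Fin N, (i : ℕ) = 0 → ∀ x, y i x = 1)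

/-- The Gram matrix `(G_N)_{i,j} = Σ_{ξ∈C} v_ξ y_i(ξ) y_j(ξ)`. -/
def gram {q N : ℕ} (C : Finset (Sph q)) (v : Sph q → ℝ) (y : Fin N → Sph q → ℝ) :
    Matrix (Fin N) (Fin N) ℝ :=
  Matrix.of fun i j => ∑ ξ ∈ C, v ξ * y i ξ * y j ξ

/-- The least squares quadrature weights `w_ξ^{LSQ} = v_ξ Σ_k (G_N⁻¹)_{i₀,k} y_k(ξ)`. -/
def wLSQ {q N : ℕ} (C : Finset (Sph q)) (v : Sph q → ℝ) (y : Fin N → Sph q → ℝ) (i0 : Fin N)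
    (ξ : Sph q) : ℝ :=
  v ξ * ∑ k, (gram C v y)⁻¹ i0 k * y k ξ

/-- Two–sided Marcinkiewicz–Zygmund inequalities for the masses `v` on `C`, for all
`1 ≤ p ≤ ∞`. -/
def VMZ (q n : ℕ) (μ : Measure (Sph q)) (C : Finset (Sph q)) (v : Sph q → ℝ)
    (c₁ c₂ : ℝ) : Prop :=
  (∀ P : Sph q → ℝ, InPi q n P → ∀ p : ℝ, 1 ≤ p →
      c₁ * (∫ x, |P x| ^ p ∂μ) ^ (1 / p) ≤ (∑ ξ ∈ C, v ξ * |P ξ| ^ p) ^ (1 / p) ∧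
      (∑ ξ ∈ C, v ξ * |P ξ| ^ p) ^ (1 / p) ≤ c₂ * (∫ x, |P x| ^ p ∂μ) ^ (1 / p)) ∧
  (∀ P : Sph q → ℝ, InPi q n P →
      c₁ * supNorm P ≤ (⨆ ξ ∈ (C : Set (Sph q)), |P ξ|) ∧
      (⨆ ξ ∈ (C : Set (Sph q)), |P ξ|) ≤ c₂ * supNorm P)

section LegendreSeries

variable {A : Type*} [CommRing A]

/-- The power series `1 - 2 τ X + s X²`. -/
def quadS (τ s : A) : PowerSeries A :=
  1 - 2 * PowerSeries.C τ * PowerSeries.X + PowerSeries.C s * PowerSeries.X ^ 2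

/-- The power series `τ - s X`. -/
def linS (τ s : A) : PowerSeries A := PowerSeries.C τ - PowerSeries.C s * PowerSeries.X

lemma quadS_derivative (τ s : A) :
    PowerSeries.derivative A (quadS τ s) = -2 * linS τ s := by
  simp only [quadS, linS, map_add, map_sub, Derivation.leibniz, Derivation.leibniz_pow,
    PowerSeries.derivative_C, PowerSeries.derivative_X, PowerSeries.derivative_one, smul_eq_mul]
  have : PowerSeries.derivative A (2 : PowerSeries A) = 0 := by
    simpa using (PowerSeries.derivative A).map_natCast 2
  rw [this]
  simp
  ring

variable [Algebra ℝ A]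

/-- Homogenized Legendre polynomials: the Taylor coefficients of `(1 - 2 τ X + s X²)^(-1/2)`. -/
def legCoeff (τ s : A) : ℕ → A
  | 0 => 1
  | 1 => τ
  | (n + 2) => ((n : ℝ) + 2)⁻¹ •
      ((2 * (n : ℝ) + 3) • (τ * legCoeff τ s (n + 1)) - ((n : ℝ) + 1) • (s * legCoeff τ s n))

/-- The power series `(1 - 2 τ X + s X²)^(-1/2)`. -/
def legS (τ s : A) : PowerSeries A := PowerSeries.mk (legCoeff τ s)

lemma legCoeff_rec (τ s : A) (n : ℕ) :
    ((n : A) + 2) * legCoeff τ s (n + 2) =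
      (2 * (n : A) + 3) * τ * legCoeff τ s (n + 1) - ((n : A) + 1) * s * legCoeff τ s n := by
  have h : ((n : ℝ) + 2) ≠ 0 := by positivity
  have e : ((n : ℝ) + 2) • legCoeff τ s (n + 2) =
      (2 * (n : ℝ) + 3) • (τ * legCoeff τ s (n + 1)) - ((n : ℝ) + 1) • (s * legCoeff τ s n) := by
    rw [legCoeff, smul_inv_smul₀ h]
  simp only [Algebra.smul_def, map_add, map_mul, map_natCast, map_ofNat, map_one] at e
  linear_combination e

lemma quadS_mul_legS_derivative (τ s : A) :
    quadS τ s * PowerSeries.derivative A (legS τ s) = linS τ s * legS τ s := by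
  have e1 : quadS τ s * PowerSeries.derivative A (legS τ s) =
      PowerSeries.derivative A (legS τ s)
        - PowerSeries.C (2 * τ) * (PowerSeries.X * PowerSeries.derivative A (legS τ s))
        + PowerSeries.C s * (PowerSeries.X * (PowerSeries.X *
          PowerSeries.derivative A (legS τ s))) := by
    simp only [quadS, map_mul, map_ofNat]; ring
  have e2 : linS τ s * legS τ s = PowerSeries.C τ * legS τ s
      - PowerSeries.C s * (PowerSeries.X * legS τ s) := by
    simp only [linS]; ring
  rw [e1, e2]
  ext n
  rcases n with _ | _ | n
  · simp only [PowerSeries.coeff_derivative, legS, PowerSeries.coeff_zero_X_mul,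
      PowerSeries.coeff_C_mul, map_add, map_sub, PowerSeries.coeff_mk, legCoeff]
    simp
  · have := legCoeff_rec τ s 0
    simp only [PowerSeries.coeff_derivative, legS, PowerSeries.coeff_succ_X_mul,
      PowerSeries.coeff_zero_X_mul,
      PowerSeries.coeff_C_mul, map_add, map_sub, PowerSeries.coeff_mk, zero_add] at this ⊢
    rw [show legCoeff τ s 0 = 1 from rfl, show legCoeff τ s 1 = τ from rfl] at *
    push_cast at this ⊢
    linear_combination this
  · have := legCoeff_rec τ s (n + 1)
    simp only [PowerSeries.coeff_derivative, legS, PowerSeries.coeff_succ_X_mul,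
      PowerSeries.coeff_C_mul, map_add, map_sub, PowerSeries.coeff_mk] at this ⊢
    push_cast at this ⊢
    linear_combination this

lemma legS_sq_mul_quadS [IsAddTorsionFree A] (τ s : A) : legS τ s ^ 2 * quadS τ s = 1 := by
  apply PowerSeries.derivative.ext
  · rw [Derivation.leibniz, Derivation.leibniz_pow, quadS_derivative, PowerSeries.derivative_one]
    have := quadS_mul_legS_derivative τ s
    simp only [smul_eq_mul, nsmul_eq_mul]
    push_cast
    simp
    linear_combination 2 * legS τ s * this
  · simp [legS, quadS, legCoeff]

variable [IsAddTorsionFree A]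

lemma legS_derivative (τ s : A) :
    PowerSeries.derivative A (legS τ s) = legS τ s ^ 3 * linS τ s := by
  linear_combination legS τ s ^ 2 * quadS_mul_legS_derivative τ s
    - PowerSeries.derivative A (legS τ s) * legS_sq_mul_quadS τ s

lemma legS_pow_derivative (τ s : A) (m : ℕ) :
    PowerSeries.derivative A (legS τ s ^ m) =
      (m : PowerSeries A) * legS τ s ^ (m + 2) * linS τ s := by
  rcases m with _ | m
  · simp
  · rw [Derivation.leibniz_pow, legS_derivative]
    simp only [smul_eq_mul, nsmul_eq_mul, Nat.add_sub_cancel]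
    ring

lemma X_mul_legS_pow_derivative (τ s : A) (m : ℕ) :
    2 * PowerSeries.X * PowerSeries.derivative A (legS τ s ^ m) +
        (m : PowerSeries A) * legS τ s ^ m =
      (m : PowerSeries A) * ((1 - PowerSeries.C s * PowerSeries.X ^ 2) * legS τ s ^ (m + 2)) := by
  rw [legS_pow_derivative]
  have h := legS_sq_mul_quadS τ s
  have : (m : PowerSeries A) * legS τ s ^ m =
      (m : PowerSeries A) * legS τ s ^ (m + 2) * quadS τ s := by
    linear_combination - (m : PowerSeries A) * legS τ s ^ m * h
  rw [this, linS, quadS]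
  ring

lemma quadS_pow_mul_legS_pow_derivative (τ s : A) (a m : ℕ) :
    PowerSeries.derivative A (quadS τ s ^ (a + 1) * legS τ s ^ m) =
      PowerSeries.C ((m : A) - 2 * ((a : A) + 1)) *
        (quadS τ s ^ a * legS τ s ^ m * linS τ s) := by
  rw [Derivation.leibniz, legS_pow_derivative, Derivation.leibniz_pow, quadS_derivative]
  have h := legS_sq_mul_quadS τ s
  simp only [smul_eq_mul, nsmul_eq_mul, Nat.add_sub_cancel, map_sub, map_mul, map_add, map_natCast,
    map_ofNat, map_one]
  push_cast
  linear_combination (m : PowerSeries A) * legS τ s ^ m * linS τ s * quadS τ s ^ a * h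

lemma quadS_mul_legS_pow_derivative (τ s : A) (m : ℕ) :
    quadS τ s * PowerSeries.derivative A (legS τ s ^ m) =
      (m : PowerSeries A) * legS τ s ^ m * linS τ s := by
  rw [legS_pow_derivative]
  linear_combination (m : PowerSeries A) * legS τ s ^ m * linS τ s * legS_sq_mul_quadS τ s

end LegendreSeries

section LegendreBounds

lemma legCoeff_map {A B : Type*} [CommRing A] [Algebra ℝ A] [CommRing B] [Algebra ℝ B]
    (φ : A →ₐ[ℝ] B) (τ s : A) (n : ℕ) :
    φ (legCoeff τ s n) = legCoeff (φ τ) (φ s) n := by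
  induction n using Nat.twoStepInduction with
  | zero => simp [legCoeff]
  | one => simp [legCoeff]
  | more n h1 h2 => simp [legCoeff, h1, h2]

/-- Taylor coefficients of `(1 - X)^(-1/2)`. -/
def sqrtCoeff (j : ℕ) : ℝ := (Nat.centralBinom j : ℝ) / 4 ^ j

lemma sqrtCoeff_zero : sqrtCoeff 0 = 1 := by simp [sqrtCoeff]

lemma sqrtCoeff_succ (j : ℕ) :
    ((j : ℝ) + 1) * sqrtCoeff (j + 1) = ((j : ℝ) + 1 / 2) * sqrtCoeff j := by
  have h : ((j : ℝ) + 1) * (Nat.centralBinom (j + 1) : ℝ) =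
      2 * (2 * (j : ℝ) + 1) * (Nat.centralBinom j : ℝ) := by
    exact_mod_cast Nat.succ_mul_centralBinom_succ j
  unfold sqrtCoeff
  rw [pow_succ]
  field_simp
  linear_combination 2 * h

lemma sqrtCoeff_pos (j : ℕ) : 0 < sqrtCoeff j := by
  unfold sqrtCoeff
  have := Nat.centralBinom_pos j
  positivity

lemma sqrtCoeff_antitone : Antitone sqrtCoeff := by
  refine antitone_nat_of_succ_le fun j => ?_
  have h := sqrtCoeff_succ j
  have hp := sqrtCoeff_pos j
  have hj : (0 : ℝ) ≤ j := Nat.cast_nonneg j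
  by_contra hc
  push Not at hc
  nlinarith

lemma sqrtCoeff_sq_le (j : ℕ) : sqrtCoeff j ^ 2 * ((j : ℝ) + 1) ≤ 1 := by
  induction j with
  | zero => simp [sqrtCoeff_zero]
  | succ j ih =>
    have h := sqrtCoeff_succ j
    have hj : (0 : ℝ) ≤ j := Nat.cast_nonneg j
    have e : ((j : ℝ) + 1) ^ 2 * sqrtCoeff (j + 1) ^ 2 =
        ((j : ℝ) + 1 / 2) ^ 2 * sqrtCoeff j ^ 2 := by
      rw [← mul_pow, h, mul_pow]
    have h2 : ((j : ℝ) + 1) ^ 3 * (sqrtCoeff (j + 1) ^ 2 * (((j + 1 : ℕ) : ℝ) + 1)) ≤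
        ((j : ℝ) + 1) ^ 3 * 1 := by
      push_cast
      calc ((j : ℝ) + 1) ^ 3 * (sqrtCoeff (j + 1) ^ 2 * ((j : ℝ) + 1 + 1))
          = ((j : ℝ) + 2) * ((j : ℝ) + 1 / 2) ^ 2 * (sqrtCoeff j ^ 2 * ((j : ℝ) + 1)) := by
            linear_combination ((j : ℝ) + 1) * ((j : ℝ) + 2) * e
        _ ≤ ((j : ℝ) + 2) * ((j : ℝ) + 1 / 2) ^ 2 * 1 := by gcongr
        _ ≤ ((j : ℝ) + 1) ^ 3 * 1 := by nlinarith [mul_nonneg hj hj]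
    exact le_of_mul_le_mul_left h2 (by positivity)

lemma sqrtCoeff_le (j : ℕ) : sqrtCoeff j ≤ 1 / √((j : ℝ) + 1) := by
  rw [le_div_iff₀ (by positivity)]
  have h := sqrtCoeff_sq_le j
  have hp := sqrtCoeff_pos j
  rw [← abs_of_pos (mul_pos hp (show 0 < √((j : ℝ) + 1) by positivity))]
  apply abs_le_of_sq_le_sq' _ zero_le_one |> abs_le.mpr
  rw [mul_pow, Real.sq_sqrt (by positivity)]
  simpa using h

lemma sum_range_inv_sqrt_le (n : ℕ) : ∑ j ∈ range n, 1 / √((j : ℝ) + 1) ≤ 2 * √n := by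
  induction n with
  | zero => simp
  | succ n ih =>
    rw [sum_range_succ]
    have h1 : √(n : ℝ) ^ 2 = n := Real.sq_sqrt (Nat.cast_nonneg n)
    have h2 : √((n : ℝ) + 1) ^ 2 = (n : ℝ) + 1 := Real.sq_sqrt (by positivity)
    have h3 : 0 < √((n : ℝ) + 1) := by positivity
    have h4 : 1 / √((n : ℝ) + 1) ≤ 2 * √((n : ℝ) + 1) - 2 * √n := by
      rw [div_le_iff₀ h3]
      nlinarith [sq_nonneg (√((n : ℝ) + 1) - √n)]
    push_cast
    linarith

/-- The power series of `(1 - w X)^(-1/2)`. -/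
def sqrtS (w : ℂ) : PowerSeries ℂ := PowerSeries.mk fun j => (sqrtCoeff j : ℂ) * w ^ j

lemma sqrtS_sq (w : ℂ) :
    sqrtS w ^ 2 * (1 - PowerSeries.C w * PowerSeries.X) = 1 := by
  have key : 2 * PowerSeries.derivative ℂ (sqrtS w) * (1 - PowerSeries.C w * PowerSeries.X) =
      PowerSeries.C w * sqrtS w := by
    have e : 2 * PowerSeries.derivative ℂ (sqrtS w) * (1 - PowerSeries.C w * PowerSeries.X) =
        PowerSeries.C 2 * PowerSeries.derivative ℂ (sqrtS w) -
          PowerSeries.C (2 * w) * (PowerSeries.X * PowerSeries.derivative ℂ (sqrtS w)) := by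
      simp only [map_mul, map_ofNat]; ring
    rw [e]
    ext n
    rcases n with _ | n
    · have h := sqrtCoeff_succ 0
      have h' : (sqrtCoeff 1 : ℂ) = 1 / 2 * (sqrtCoeff 0 : ℂ) := by
        rw [show (sqrtCoeff 1) = 1 / 2 * sqrtCoeff 0 by simpa using h]; push_cast; ring
      simp only [map_sub, PowerSeries.coeff_C_mul, PowerSeries.coeff_derivative, sqrtS,
        PowerSeries.coeff_mk, PowerSeries.coeff_zero_X_mul, zero_add]
      rw [h']; push_cast; ring
    · have h := sqrtCoeff_succ (n + 1)
      have h' : ((n : ℂ) + 1 + 1) * (sqrtCoeff (n + 1 + 1) : ℂ) =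
          ((n : ℂ) + 1 + 1 / 2) * (sqrtCoeff (n + 1) : ℂ) := by
        have := congrArg (fun x : ℝ => (x : ℂ)) h
        push_cast at this
        exact this
      simp only [map_sub, PowerSeries.coeff_C_mul, PowerSeries.coeff_derivative, sqrtS,
        PowerSeries.coeff_mk, PowerSeries.coeff_succ_X_mul]
      push_cast
      linear_combination 2 * w ^ (n + 1 + 1) * h'
  apply PowerSeries.derivative.ext
  · rw [Derivation.leibniz, Derivation.leibniz_pow, PowerSeries.derivative_one]
    simp only [map_sub, Derivation.leibniz, PowerSeries.derivative_one, PowerSeries.derivative_C,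
      PowerSeries.derivative_X, smul_eq_mul, nsmul_eq_mul]
    push_cast
    simp
    linear_combination sqrtS w * key
  · simp [sqrtS, sqrtCoeff_zero]

/-- The point `t + i √(1-t²)` of the unit circle. -/
def circPt (t : ℝ) : ℂ := ⟨t, √(1 - t ^ 2)⟩

lemma one_sub_sq_nonneg_of_abs_le_one {t : ℝ} (ht : |t| ≤ 1) : 0 ≤ 1 - t ^ 2 := by
  have := (sq_le_one_iff_abs_le_one t).mpr ht
  linarith

lemma circPt_mul_conj {t : ℝ} (ht : |t| ≤ 1) :
    circPt t * (starRingEnd ℂ) (circPt t) = 1 := by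
  rw [Complex.mul_conj]
  simp only [circPt, Complex.normSq_mk]
  rw [Real.mul_self_sqrt (one_sub_sq_nonneg_of_abs_le_one ht)]
  norm_num
  norm_cast
  ring

lemma norm_circPt {t : ℝ} (ht : |t| ≤ 1) : ‖circPt t‖ = 1 := by
  have h := circPt_mul_conj ht
  rw [Complex.mul_conj, Complex.normSq_eq_norm_sq] at h
  have h2 : ‖circPt t‖ ^ 2 = 1 := by exact_mod_cast h
  exact (pow_eq_one_iff_of_nonneg (norm_nonneg _) two_ne_zero).mp h2

lemma legS_complex_eq {t : ℝ} (ht : |t| ≤ 1) :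
    legS (t : ℂ) 1 = sqrtS (circPt t) * sqrtS ((starRingEnd ℂ) (circPt t)) := by
  set w := circPt t
  set v := (starRingEnd ℂ) w
  have hwv : w * v = 1 := circPt_mul_conj ht
  have hsum : w + v = 2 * (t : ℂ) := by
    rw [Complex.add_conj]; simp [w, circPt]
  have hQ : quadS (t : ℂ) 1 = (1 - PowerSeries.C w * PowerSeries.X) *
      (1 - PowerSeries.C v * PowerSeries.X) := by
    have h1 : (PowerSeries.C w + PowerSeries.C v : PowerSeries ℂ) = 2 * PowerSeries.C (t : ℂ) := by
      rw [← map_add, hsum, map_mul, map_ofNat]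
    have h2 : (PowerSeries.C w * PowerSeries.C v : PowerSeries ℂ) = 1 := by
      rw [← map_mul, hwv, map_one]
    rw [quadS, map_one]
    linear_combination PowerSeries.X * h1 - PowerSeries.X ^ 2 * h2
  have hL := legS_sq_mul_quadS (t : ℂ) 1
  have hM : (sqrtS w * sqrtS v) ^ 2 * quadS (t : ℂ) 1 = 1 := by
    rw [hQ]
    linear_combination sqrtS_sq w * (sqrtS v ^ 2 * (1 - PowerSeries.C v * PowerSeries.X))
      + sqrtS_sq v
  have hsq : legS (t : ℂ) 1 ^ 2 = (sqrtS w * sqrtS v) ^ 2 := by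
    linear_combination (sqrtS w * sqrtS v) ^ 2 * hL - legS (t : ℂ) 1 ^ 2 * hM
  rcases sq_eq_sq_iff_eq_or_eq_neg.mp hsq with h | h
  · exact h
  · exfalso
    have := congrArg PowerSeries.constantCoeff h
    simp [legS, legCoeff, sqrtS, sqrtCoeff_zero] at this
    norm_num [self_eq_neg] at this

lemma legCoeff_complex {t : ℝ} (ht : |t| ≤ 1) (n : ℕ) :
    ((legCoeff t 1 n : ℝ) : ℂ) = ∑ j ∈ range (n + 1), (sqrtCoeff j : ℂ) * circPt t ^ j *
      ((sqrtCoeff (n - j) : ℂ) * (starRingEnd ℂ) (circPt t) ^ (n - j)) := by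
  have h1 : ((legCoeff t 1 n : ℝ) : ℂ) = legCoeff (t : ℂ) 1 n := by
    simpa using legCoeff_map Complex.ofRealAm t 1 n
  have h2 : legCoeff (t : ℂ) 1 n = PowerSeries.coeff n (legS (t : ℂ) 1) := by simp [legS]
  rw [h1, h2, legS_complex_eq ht, PowerSeries.coeff_mul,
    Finset.Nat.sum_antidiagonal_eq_sum_range_succ_mk]
  simp [sqrtS]

lemma sum_sqrtCoeff_mul (n : ℕ) :
    ∑ j ∈ range (n + 1), sqrtCoeff j * sqrtCoeff (n - j) = 1 := by
  have h := sqrtS_sq 1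
  have h2 : sqrtS 1 ^ 2 = PowerSeries.mk 1 := by
    have h3 := PowerSeries.mk_one_mul_one_sub_eq_one ℂ
    rw [map_one, one_mul] at h
    linear_combination (PowerSeries.mk 1) * h - sqrtS 1 ^ 2 * h3
  have h4 := congrArg (PowerSeries.coeff n) h2
  rw [sq, PowerSeries.coeff_mul, Finset.Nat.sum_antidiagonal_eq_sum_range_succ_mk] at h4
  simp only [sqrtS, PowerSeries.coeff_mk, one_pow, mul_one, Pi.one_apply] at h4
  exact_mod_cast h4

lemma abs_legCoeff_le_one {t : ℝ} (ht : |t| ≤ 1) (n : ℕ) : |legCoeff t 1 n| ≤ 1 := by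
  have h := legCoeff_complex ht n
  have e : |legCoeff t 1 n| = ‖((legCoeff t 1 n : ℝ) : ℂ)‖ := by simp
  rw [e, h, ← sum_sqrtCoeff_mul n]
  refine (norm_sum_le _ _).trans (le_of_eq (sum_congr rfl fun j _ => ?_))
  simp [norm_circPt ht, abs_of_pos (sqrtCoeff_pos _)]

lemma abel_sum_identity (b : ℕ → ℝ) (f : ℕ → ℂ) (m : ℕ) :
    ∑ j ∈ range m, (b j : ℂ) * f j = (b m : ℂ) * ∑ j ∈ range m, f j +
      ∑ j ∈ range m, ((b j - b (j + 1) : ℝ) : ℂ) * ∑ i ∈ range (j + 1), f i := by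
  induction m with
  | zero => simp
  | succ m ih =>
    rw [sum_range_succ, ih, sum_range_succ (fun j => ((b j - b (j + 1) : ℝ) : ℂ) * _),
      sum_range_succ f m]
    push_cast
    ring

/-- Abel's inequality. -/
lemma norm_sum_antitone_mul_le {b : ℕ → ℝ} (hb : Antitone b) (hb0 : ∀ j, 0 ≤ b j) {f : ℕ → ℂ}
    {m : ℕ} {M : ℝ} (hM : ∀ p ≤ m, ‖∑ j ∈ range p, f j‖ ≤ M) :
    ‖∑ j ∈ range m, (b j : ℂ) * f j‖ ≤ b 0 * M := by
  rw [abel_sum_identity]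
  have h1 : ‖(b m : ℂ) * ∑ j ∈ range m, f j‖ ≤ b m * M := by
    rw [norm_mul, Complex.norm_real, Real.norm_of_nonneg (hb0 m)]
    exact mul_le_mul_of_nonneg_left (hM m le_rfl) (hb0 m)
  have h2 : ‖∑ j ∈ range m, ((b j - b (j + 1) : ℝ) : ℂ) * ∑ i ∈ range (j + 1), f i‖ ≤
      ∑ j ∈ range m, (b j - b (j + 1)) * M := by
    refine (norm_sum_le _ _).trans (sum_le_sum fun j hj => ?_)
    have hd : 0 ≤ b j - b (j + 1) := sub_nonneg.mpr (hb (Nat.le_succ j))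
    rw [norm_mul, Complex.norm_real, Real.norm_of_nonneg hd]
    exact mul_le_mul_of_nonneg_left (hM _ (mem_range.mp hj)) hd
  rw [← sum_mul, sum_range_sub'] at h2
  calc _ ≤ _ := norm_add_le _ _
    _ ≤ b m * M + (b 0 - b m) * M := add_le_add h1 h2
    _ = b 0 * M := by ring

lemma norm_geom_sum_le {z : ℂ} (hz : ‖z‖ = 1) (hz1 : z ≠ 1) (m : ℕ) :
    ‖∑ j ∈ range m, z ^ j‖ ≤ 2 / ‖1 - z‖ := by
  have h0 : 0 < ‖1 - z‖ := norm_pos_iff.mpr (sub_ne_zero.mpr hz1.symm)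
  rw [geom_sum_eq hz1, norm_div, norm_sub_rev z 1]
  gcongr
  calc ‖z ^ m - 1‖ ≤ ‖z ^ m‖ + ‖(1 : ℂ)‖ := norm_sub_le _ _
    _ = 2 := by rw [norm_pow, hz]; norm_num

lemma sum_sqrtCoeff_le (J : ℕ) : ∑ j ∈ range J, sqrtCoeff j ≤ 2 * √(J : ℝ) :=
  (sum_le_sum fun j _ => sqrtCoeff_le j).trans (sum_range_inv_sqrt_le J)

lemma norm_sum_sqrtCoeff_mul_pow_le {z : ℂ} (hz : ‖z‖ = 1) (hz1 : z ≠ 1) (m : ℕ) :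
    ‖∑ j ∈ range m, (sqrtCoeff j : ℂ) * z ^ j‖ ≤ 6 / √‖1 - z‖ := by
  set δ := ‖1 - z‖ with hδ
  have h0 : 0 < δ := norm_pos_iff.mpr (sub_ne_zero.mpr hz1.symm)
  have hδ2 : δ ≤ 2 := by
    calc δ ≤ ‖(1 : ℂ)‖ + ‖z‖ := norm_sub_le _ _
      _ = 2 := by rw [hz]; norm_num
  have hs : 0 < √δ := Real.sqrt_pos.mpr h0
  set J := ⌈1 / δ⌉₊ with hJ
  have hJ1 : 1 / δ ≤ J := Nat.le_ceil _
  have hJ2 : (J : ℝ) < 1 / δ + 1 := Nat.ceil_lt_add_one (by positivity)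
  have hJ3 : √(J : ℝ) ≤ 2 / √δ := by
    rw [Real.sqrt_le_left (by positivity), div_pow, Real.sq_sqrt h0.le]
    have : 1 ≤ 2 / δ := by rw [le_div_iff₀ h0]; linarith
    have e : (2 : ℝ) ^ 2 / δ = 1 / δ + 1 / δ + 2 / δ := by ring
    have : 0 < 1 / δ := by positivity
    linarith
  have first : ∀ p ≤ J, ‖∑ j ∈ range p, (sqrtCoeff j : ℂ) * z ^ j‖ ≤ 4 / √δ := by
    intro p hp
    calc ‖∑ j ∈ range p, (sqrtCoeff j : ℂ) * z ^ j‖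
        ≤ ∑ j ∈ range p, sqrtCoeff j := by
          refine (norm_sum_le _ _).trans (le_of_eq (sum_congr rfl fun j _ => ?_))
          simp [hz, abs_of_pos (sqrtCoeff_pos _)]
      _ ≤ 2 * √(p : ℝ) := sum_sqrtCoeff_le p
      _ ≤ 2 * √(J : ℝ) := by gcongr
      _ ≤ 2 * (2 / √δ) := by gcongr
      _ = 4 / √δ := by ring
  rcases le_total m J with hm | hm
  · exact (first m hm).trans (by gcongr; norm_num)
  · obtain ⟨p, rfl⟩ := Nat.exists_eq_add_of_le hm
    rw [sum_range_add]
    have second : ‖∑ i ∈ range p, (sqrtCoeff (J + i) : ℂ) * z ^ (J + i)‖ ≤ 2 / √δ := by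
      have hab := norm_sum_antitone_mul_le (b := fun i => sqrtCoeff (J + i))
        (f := fun i => z ^ (J + i)) (m := p) (M := 2 / δ)
        (fun a b hab => sqrtCoeff_antitone (by omega)) (fun j => (sqrtCoeff_pos _).le)
        (fun k _ => by
          simp only [pow_add]
          rw [← mul_sum, norm_mul, norm_pow, hz, one_pow, one_mul]
          exact norm_geom_sum_le hz hz1 k)
      refine hab.trans ?_
      simp only [add_zero]
      have h1 : sqrtCoeff J ≤ √δ := by
        refine (sqrtCoeff_le J).trans ?_
        rw [div_le_iff₀ (by positivity), ← Real.sqrt_mul h0.le, Real.one_le_sqrt]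
        have : δ * (1 / δ) = 1 := by field_simp
        nlinarith
      calc sqrtCoeff J * (2 / δ) ≤ √δ * (2 / δ) := by gcongr
        _ = 2 / √δ := by
          rw [← Real.mul_self_sqrt h0.le, Real.sqrt_mul_self (Real.sqrt_nonneg _)]
          field_simp
    calc _ ≤ _ := norm_add_le _ _
      _ ≤ 4 / √δ + 2 / √δ := add_le_add (first J le_rfl) second
      _ = 6 / √δ := by ring

lemma norm_half_sum_le {w v : ℂ} (hw : ‖w‖ = 1) (hwv : w * v = 1) (hw1 : w ^ 2 ≠ 1) (n m : ℕ)
    (hm : m ≤ n / 2 + 1) :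
    ‖∑ j ∈ range m, (sqrtCoeff j : ℂ) * w ^ j * ((sqrtCoeff (n - j) : ℂ) * v ^ (n - j))‖ ≤
      17 / (√‖1 - w ^ 2‖ * √((n : ℝ) + 1)) := by
  have hv : ‖v‖ = 1 := by
    have := congrArg norm hwv
    rw [norm_mul, hw] at this
    simpa using this
  have hδ : 0 < ‖1 - w ^ 2‖ := norm_pos_iff.mpr (sub_ne_zero.mpr hw1.symm)
  set K := 6 / √‖1 - w ^ 2‖ with hK
  have hKpos : 0 < K := by positivity
  set f : ℕ → ℂ := fun j => v ^ n * ((sqrtCoeff j : ℂ) * (w ^ 2) ^ j) with hf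
  have hF : ∀ p, ‖∑ j ∈ range p, f j‖ ≤ K := by
    intro p
    rw [hf, ← mul_sum, norm_mul, norm_pow, hv, one_pow, one_mul]
    exact norm_sum_sqrtCoeff_mul_pow_le (by rw [norm_pow, hw, one_pow]) hw1 p
  have e1 : ∑ j ∈ range m, (sqrtCoeff j : ℂ) * w ^ j * ((sqrtCoeff (n - j) : ℂ) * v ^ (n - j)) =
      ∑ i ∈ range m, (sqrtCoeff (n + 1 - m + i) : ℂ) * f (m - 1 - i) := by
    rw [← sum_range_reflect]
    refine sum_congr rfl fun i hi => ?_
    have hi' := mem_range.mp hi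
    have hmn : m ≤ n + 1 := by omega
    rw [show n - (m - 1 - i) = n + 1 - m + i by omega]
    set k := m - 1 - i with hk
    have hkn : k + (n + 1 - m + i) = n := by omega
    have : v ^ n * (w ^ 2) ^ k = w ^ k * v ^ (n + 1 - m + i) := by
      have h3 : w ^ k * v ^ k = 1 := by rw [← mul_pow, hwv, one_pow]
      have h4 : v ^ n = v ^ k * v ^ (n + 1 - m + i) := by rw [← pow_add, hkn]
      rw [h4, ← pow_mul, two_mul, pow_add]
      linear_combination w ^ k * v ^ (n + 1 - m + i) * h3
    simp only [hf]
    linear_combination -(sqrtCoeff k : ℂ) * (sqrtCoeff (n + 1 - m + i) : ℂ) * this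
  rw [e1]
  have hab := norm_sum_antitone_mul_le (b := fun i => sqrtCoeff (n + 1 - m + i))
        (f := fun i => f (m - 1 - i)) (m := m) (M := 2 * K)
        (fun a b hab => sqrtCoeff_antitone (by omega)) (fun j => (sqrtCoeff_pos _).le)
        (fun p hp => by
          have h1 : ∑ i ∈ range p, f (m - 1 - i) =
              ∑ i ∈ range m, f i - ∑ i ∈ range (m - p), f i := by
            obtain ⟨r, rfl⟩ := Nat.exists_eq_add_of_le hp
            rw [Nat.add_sub_cancel_left, add_comm p r, sum_range_add, add_sub_cancel_left,
              ← sum_range_reflect]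
            refine sum_congr rfl fun i hi => ?_
            have := mem_range.mp hi
            congr 1
            omega
          rw [h1]
          calc _ ≤ _ := norm_sub_le _ _
            _ ≤ K + K := add_le_add (hF _) (hF _)
            _ = 2 * K := by ring)
  refine hab.trans ?_
  simp only [add_zero]
  have h1 : sqrtCoeff (n + 1 - m) ≤ √2 / √((n : ℝ) + 1) := by
    refine (sqrtCoeff_antitone (show n - n / 2 ≤ n + 1 - m by omega)).trans
      ((sqrtCoeff_le _).trans ?_)
    rw [div_le_div_iff₀ (by positivity) (by positivity), one_mul, ← Real.sqrt_mul (by norm_num)]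
    apply Real.sqrt_le_sqrt
    have : n + 1 ≤ 2 * (n - n / 2 + 1) := by omega
    exact_mod_cast this
  have h2 : √2 ≤ (17 / 12 : ℝ) := by
    rw [Real.sqrt_le_left (by norm_num)]; norm_num
  calc sqrtCoeff (n + 1 - m) * (2 * K) ≤ √2 / √((n : ℝ) + 1) * (2 * K) := by gcongr
    _ ≤ (17 / 12) / √((n : ℝ) + 1) * (2 * K) := by gcongr
    _ = 17 / (√‖1 - w ^ 2‖ * √((n : ℝ) + 1)) := by rw [hK]; field_simp; norm_num

/-- Bernstein's inequality for Legendre polynomials. -/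
lemma abs_legCoeff_le_bernstein {t : ℝ} (ht : |t| < 1) (n : ℕ) :
    |legCoeff t 1 n| ≤ 34 / (√(√(1 - t ^ 2)) * √((n : ℝ) + 1)) := by
  have hσ2 : 0 < 1 - t ^ 2 := by
    have := (sq_lt_one_iff_abs_lt_one t).mpr ht
    linarith
  have hσ : 0 < √(1 - t ^ 2) := Real.sqrt_pos.mpr hσ2
  set w := circPt t with hw
  set v := (starRingEnd ℂ) w with hv
  have hw1 : ‖w‖ = 1 := norm_circPt ht.le
  have hwv : w * v = 1 := circPt_mul_conj ht.le
  have hv1 : ‖v‖ = 1 := by rw [hv, Complex.norm_conj, hw1]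
  have hdiff : ‖v - w‖ = 2 * √(1 - t ^ 2) := by
    have : v - w = ((-(2 * √(1 - t ^ 2)) : ℝ) : ℂ) * Complex.I := by
      apply Complex.ext <;> simp [hv, hw, circPt]
      ring
    rw [this, norm_mul, Complex.norm_I, mul_one, Complex.norm_real, norm_neg,
      Real.norm_of_nonneg (by positivity)]
  have hd : ‖1 - w ^ 2‖ = 2 * √(1 - t ^ 2) := by
    rw [← hdiff, show 1 - w ^ 2 = w * (v - w) by linear_combination -hwv, norm_mul, hw1, one_mul]
  have hd' : ‖1 - v ^ 2‖ = 2 * √(1 - t ^ 2) := by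
    rw [← hdiff, show 1 - v ^ 2 = -(v * (v - w)) by linear_combination -hwv, norm_neg, norm_mul,
      hv1, one_mul]
  have hne : w ^ 2 ≠ 1 := by
    intro h
    rw [h] at hd
    simp at hd
    linarith
  have hne' : v ^ 2 ≠ 1 := by
    intro h
    rw [h] at hd'
    simp at hd'
    linarith
  have e : |legCoeff t 1 n| = ‖((legCoeff t 1 n : ℝ) : ℂ)‖ := by simp
  rw [e, legCoeff_complex ht.le n]
  obtain ⟨r, hr⟩ : ∃ r, n + 1 = (n / 2 + 1) + r := ⟨n - n / 2, by omega⟩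
  rw [hr, sum_range_add]
  have b1 := norm_half_sum_le hw1 hwv hne n (n / 2 + 1) le_rfl
  have b2 := norm_half_sum_le hv1 ((mul_comm v w).trans hwv) hne' n r (by omega)
  rw [← sum_range_reflect] at b2
  have e2 : ∑ j ∈ range r, (sqrtCoeff (r - 1 - j) : ℂ) * v ^ (r - 1 - j) *
      ((sqrtCoeff (n - (r - 1 - j)) : ℂ) * w ^ (n - (r - 1 - j))) =
      ∑ x ∈ range r, (sqrtCoeff (n / 2 + 1 + x) : ℂ) * w ^ (n / 2 + 1 + x) *
        ((sqrtCoeff (n - (n / 2 + 1 + x)) : ℂ) * v ^ (n - (n / 2 + 1 + x))) := by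
    refine sum_congr rfl fun j hj => ?_
    have := mem_range.mp hj
    rw [show n - (r - 1 - j) = n / 2 + 1 + j by omega,
      show n - (n / 2 + 1 + j) = r - 1 - j by omega]
    ring
  rw [e2] at b2
  rw [hd] at b1
  rw [hd'] at b2
  have mono : 17 / (√(2 * √(1 - t ^ 2)) * √((n : ℝ) + 1)) ≤
      17 / (√(√(1 - t ^ 2)) * √((n : ℝ) + 1)) := by
    gcongr
    linarith
  calc _ ≤ _ := norm_add_le _ _
    _ ≤ 17 / (√(√(1 - t ^ 2)) * √((n : ℝ) + 1)) + 17 / (√(√(1 - t ^ 2)) * √((n : ℝ) + 1)) :=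
      add_le_add (b1.trans mono) (b2.trans mono)
    _ = _ := by ring

end LegendreBounds

section PowerBounds

lemma abs_coeff_legS_pow_le {t : ℝ} (ht : |t| ≤ 1) (m ℓ : ℕ) :
    |PowerSeries.coeff ℓ (legS t 1 ^ (m + 1))| ≤ ((ℓ : ℝ) + 1) ^ m := by
  induction m generalizing ℓ with
  | zero => simpa [legS] using abs_legCoeff_le_one ht ℓ
  | succ m ih =>
    rw [pow_succ, PowerSeries.coeff_mul]
    calc _ ≤ ∑ p ∈ antidiagonal ℓ, |PowerSeries.coeff p.1 (legS t 1 ^ (m + 1)) *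
            PowerSeries.coeff p.2 (legS t 1)| := abs_sum_le_sum_abs _ _
      _ ≤ ∑ p ∈ antidiagonal ℓ, ((ℓ : ℝ) + 1) ^ m := by
        refine sum_le_sum fun p hp => ?_
        have hp' := mem_antidiagonal.mp hp
        have h1 : (p.1 : ℝ) ≤ ℓ := by exact_mod_cast (by omega : p.1 ≤ ℓ)
        have h2 : |PowerSeries.coeff p.2 (legS t 1)| ≤ 1 := by
          simpa [legS] using abs_legCoeff_le_one ht p.2
        rw [abs_mul]
        calc _ ≤ ((p.1 : ℝ) + 1) ^ m * 1 :=
              mul_le_mul (ih p.1) h2 (abs_nonneg _) (by positivity)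
          _ ≤ _ := by rw [mul_one]; gcongr
      _ = _ := by
        rw [sum_const, Finset.Nat.card_antidiagonal, nsmul_eq_mul]; push_cast; ring

lemma coeff_legS_sq_rec (t : ℝ) :
    PowerSeries.coeff 0 (legS t 1 ^ 2) = 1 ∧ PowerSeries.coeff 1 (legS t 1 ^ 2) = 2 * t ∧
    ∀ ℓ, PowerSeries.coeff (ℓ + 2) (legS t 1 ^ 2) =
      2 * t * PowerSeries.coeff (ℓ + 1) (legS t 1 ^ 2) - PowerSeries.coeff ℓ (legS t 1 ^ 2) := by
  have h := legS_sq_mul_quadS t (1 : ℝ)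
  have e : legS t 1 ^ 2 * quadS t 1 = legS t 1 ^ 2
      - PowerSeries.C (2 * t) * (PowerSeries.X * legS t 1 ^ 2)
      + PowerSeries.X * (PowerSeries.X * legS t 1 ^ 2) := by
    simp only [quadS, map_mul, map_ofNat, map_one]; ring
  rw [e] at h
  have h0 : PowerSeries.coeff 0 (legS t 1 ^ 2) = 1 := by
    have := congrArg (PowerSeries.coeff 0) h
    rw [map_add, map_sub, PowerSeries.coeff_C_mul, PowerSeries.coeff_zero_X_mul,
      PowerSeries.coeff_zero_X_mul, PowerSeries.coeff_zero_one] at this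
    linarith
  refine ⟨h0, ?_, fun ℓ => ?_⟩
  · have := congrArg (PowerSeries.coeff (0 + 1)) h
    rw [map_add, map_sub, PowerSeries.coeff_C_mul, PowerSeries.coeff_succ_X_mul,
      PowerSeries.coeff_succ_X_mul, PowerSeries.coeff_zero_X_mul, h0] at this
    simp [PowerSeries.coeff_one] at this
    linarith
  · have := congrArg (PowerSeries.coeff (ℓ + 2)) h
    rw [map_add, map_sub, PowerSeries.coeff_C_mul,
      show ℓ + 2 = (ℓ + 1) + 1 from rfl, PowerSeries.coeff_succ_X_mul,
      PowerSeries.coeff_succ_X_mul, PowerSeries.coeff_succ_X_mul, PowerSeries.coeff_one] at this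
    simp at this
    linarith

lemma abs_coeff_legS_sq_le {t : ℝ} (ht : |t| < 1) (ℓ : ℕ) :
    |PowerSeries.coeff ℓ (legS t 1 ^ 2)| ≤ 1 / √(1 - t ^ 2) := by
  obtain ⟨h0, h1, hr⟩ := coeff_legS_sq_rec t
  set u : ℕ → ℝ := fun ℓ => PowerSeries.coeff ℓ (legS t 1 ^ 2) with hu
  have hE : ∀ ℓ, u (ℓ + 1) ^ 2 - 2 * t * u (ℓ + 1) * u ℓ + u ℓ ^ 2 = 1 := by
    intro ℓ
    induction ℓ with
    | zero => simp only [hu, zero_add]; rw [h0, h1]; ring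
    | succ ℓ ih =>
      have := hr ℓ
      change u (ℓ + 2) = 2 * t * u (ℓ + 1) - u ℓ at this
      rw [this]
      linear_combination ih
  have hpos : 0 < 1 - t ^ 2 := by
    have := (sq_lt_one_iff_abs_lt_one t).mpr ht
    linarith
  have hsq : u ℓ ^ 2 * (1 - t ^ 2) ≤ 1 := by
    have := hE ℓ
    nlinarith [sq_nonneg (u (ℓ + 1) - t * u ℓ)]
  change |u ℓ| ≤ _
  rw [le_div_iff₀ (Real.sqrt_pos.mpr hpos)]
  rw [← Real.sqrt_sq_eq_abs, ← Real.sqrt_mul (sq_nonneg _)]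
  exact Real.sqrt_le_one.mpr hsq

lemma sum_range_rpow_le (m n : ℕ) :
    ∑ j ∈ range n, ((j : ℝ) + 1) ^ (((m : ℝ) - 1) / 2) ≤ 2 * (n : ℝ) ^ (((m : ℝ) + 1) / 2) := by
  rcases Nat.eq_zero_or_pos m with rfl | hm
  · have := sum_range_inv_sqrt_le n
    simp only [Real.sqrt_eq_rpow] at this
    convert this using 2
    · rename_i j
      rw [one_div, ← Real.rpow_neg (by positivity)]; norm_num
    · norm_num
  · have hm' : (1 : ℝ) ≤ m := by exact_mod_cast hm
    rcases Nat.eq_zero_or_pos n with rfl | hn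
    · simp; positivity
    have hn' : (0 : ℝ) < n := by exact_mod_cast hn
    calc _ ≤ ∑ j ∈ range n, (n : ℝ) ^ (((m : ℝ) - 1) / 2) := by
          refine sum_le_sum fun j hj => ?_
          have : (j : ℝ) + 1 ≤ n := by exact_mod_cast mem_range.mp hj
          exact Real.rpow_le_rpow (by positivity) this (by linarith)
      _ = (n : ℝ) ^ (((m : ℝ) + 1) / 2) := by
        rw [sum_const, card_range, nsmul_eq_mul, mul_comm]
        nth_rewrite 2 [← Real.rpow_one (n : ℝ)]
        rw [← Real.rpow_add hn']; ring_nf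
      _ ≤ _ := by
        have : 0 ≤ (n : ℝ) ^ (((m : ℝ) + 1) / 2) := by positivity
        linarith

/-- Decay of the Taylor coefficients of `(1 - 2 t X + X²)^(-(m+1)/2)` away from `t = ±1`. -/
lemma abs_coeff_legS_pow_le_sharp (m : ℕ) : ∃ C : ℝ, 0 ≤ C ∧ ∀ t : ℝ, |t| < 1 → ∀ ℓ : ℕ,
    |PowerSeries.coeff ℓ (legS t 1 ^ (m + 1))| ≤
      C * ((ℓ : ℝ) + 1) ^ (((m : ℝ) - 1) / 2) * √(1 - t ^ 2) ^ (-(((m : ℝ) + 1) / 2)) := by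
  induction m using Nat.twoStepInduction with
  | zero =>
    refine ⟨34, by norm_num, fun t ht ℓ => ?_⟩
    have h := abs_legCoeff_le_bernstein ht ℓ
    simp only [zero_add, pow_one, legS, PowerSeries.coeff_mk]
    refine h.trans_eq ?_
    rw [Real.sqrt_eq_rpow (√(1 - t ^ 2)), Real.sqrt_eq_rpow ((ℓ : ℝ) + 1)]
    have e1 : ((ℓ : ℝ) + 1) ^ ((((0 : ℕ) : ℝ) - 1) / 2) = (((ℓ : ℝ) + 1) ^ ((1 : ℝ) / 2))⁻¹ := by
      rw [← Real.rpow_neg (by positivity)]; norm_num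
    have e2 : √(1 - t ^ 2) ^ (-((((0 : ℕ) : ℝ) + 1) / 2)) = (√(1 - t ^ 2) ^ ((1 : ℝ) / 2))⁻¹ := by
      rw [← Real.rpow_neg (by positivity)]; norm_num
    rw [e1, e2, div_eq_mul_inv, mul_inv]; ring
  | one =>
    refine ⟨1, by norm_num, fun t ht ℓ => ?_⟩
    have h := abs_coeff_legS_sq_le ht ℓ
    norm_num
    rw [Real.rpow_neg_one, ← one_div]
    exact h
  | more m ih _ =>
    obtain ⟨C, hC, ih⟩ := ih
    refine ⟨2 * C, by positivity, fun t ht ℓ => ?_⟩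
    have hpos : 0 < 1 - t ^ 2 := by
      have := (sq_lt_one_iff_abs_lt_one t).mpr ht
      linarith
    have hσ := Real.sqrt_pos.mpr hpos
    set σ := √(1 - t ^ 2) with hσd
    rw [show m + 2 + 1 = (m + 1) + 2 by ring, pow_add, PowerSeries.coeff_mul]
    calc _ ≤ ∑ p ∈ antidiagonal ℓ, |PowerSeries.coeff p.1 (legS t 1 ^ (m + 1)) *
            PowerSeries.coeff p.2 (legS t 1 ^ 2)| := abs_sum_le_sum_abs _ _
      _ ≤ ∑ p ∈ antidiagonal ℓ,
          (C * ((p.1 : ℝ) + 1) ^ (((m : ℝ) - 1) / 2) * σ ^ (-(((m : ℝ) + 1) / 2))) * (1 / σ) := by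
        refine sum_le_sum fun p hp => ?_
        rw [abs_mul]
        exact mul_le_mul (ih t ht p.1) (abs_coeff_legS_sq_le ht p.2) (abs_nonneg _) (by positivity)
      _ = (∑ j ∈ range (ℓ + 1), ((j : ℝ) + 1) ^ (((m : ℝ) - 1) / 2)) *
          (C * (σ ^ (-(((m : ℝ) + 1) / 2)) * σ ^ (-(1 : ℝ)))) := by
        rw [Finset.Nat.sum_antidiagonal_eq_sum_range_succ_mk, sum_mul]
        refine sum_congr rfl fun j _ => ?_
        rw [Real.rpow_neg_one]; ring
      _ ≤ (2 * ((ℓ + 1 : ℕ) : ℝ) ^ (((m : ℝ) + 1) / 2)) *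
          (C * (σ ^ (-(((m : ℝ) + 1) / 2)) * σ ^ (-(1 : ℝ)))) := by
        gcongr
        exact sum_range_rpow_le m (ℓ + 1)
      _ = _ := by
        rw [← Real.rpow_add hσ]
        push_cast
        rw [show ((m : ℝ) + 2 - 1) / 2 = ((m : ℝ) + 1) / 2 by ring,
          show -(((m : ℝ) + 2 + 1) / 2) = -(((m : ℝ) + 1) / 2) + -1 by ring]
        ring

/-- `G t` has coefficients of size `O(ℓ^(q-a))`, uniformly for `|t| ≤ 1`. -/
def CoeffGrowth (a q : ℕ) (G : ℝ → PowerSeries ℝ) : Prop :=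
  ∃ C : ℝ, 0 ≤ C ∧ ∀ t : ℝ, |t| ≤ 1 → ∀ ℓ : ℕ,
    ((ℓ : ℝ) + 1) ^ a * |PowerSeries.coeff ℓ (G t)| ≤ C * ((ℓ : ℝ) + 1) ^ q

lemma CoeffGrowth.add {a q : ℕ} {G H : ℝ → PowerSeries ℝ} (hG : CoeffGrowth a q G)
    (hH : CoeffGrowth a q H) : CoeffGrowth a q (fun t => G t + H t) := by
  obtain ⟨C, hC, hG⟩ := hG
  obtain ⟨C', hC', hH⟩ := hH
  refine ⟨C + C', by positivity, fun t ht ℓ => ?_⟩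
  rw [map_add]
  calc _ ≤ ((ℓ : ℝ) + 1) ^ a * (|PowerSeries.coeff ℓ (G t)| + |PowerSeries.coeff ℓ (H t)|) := by
        gcongr; exact abs_add_le _ _
    _ ≤ _ := by have := hG t ht ℓ; have := hH t ht ℓ; nlinarith

lemma CoeffGrowth.const_mul {a q : ℕ} {G : ℝ → PowerSeries ℝ} (hG : CoeffGrowth a q G)
    {c : ℝ → ℝ} {B : ℝ} (hc : ∀ t, |t| ≤ 1 → |c t| ≤ B) :
    CoeffGrowth a q (fun t => PowerSeries.C (c t) * G t) := by
  obtain ⟨C, hC, hG⟩ := hG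
  have hB : 0 ≤ B := (abs_nonneg _).trans (hc 0 (by simp))
  refine ⟨B * C, by positivity, fun t ht ℓ => ?_⟩
  rw [PowerSeries.coeff_C_mul, abs_mul]
  calc _ = |c t| * (((ℓ : ℝ) + 1) ^ a * |PowerSeries.coeff ℓ (G t)|) := by ring
    _ ≤ B * (C * ((ℓ : ℝ) + 1) ^ q) :=
      mul_le_mul (hc t ht) (hG t ht ℓ) (by positivity) hB
    _ = _ := by ring

lemma add_two_pow_le (ℓ : ℝ) (hℓ : 0 ≤ ℓ) (a : ℕ) : (ℓ + 1 + 1) ^ a ≤ 2 ^ a * (ℓ + 1) ^ a := by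
  rw [← mul_pow]
  gcongr
  linarith

lemma CoeffGrowth.X_mul {a q : ℕ} {G : ℝ → PowerSeries ℝ} (hG : CoeffGrowth a q G) :
    CoeffGrowth a q (fun t => PowerSeries.X * G t) := by
  obtain ⟨C, hC, hG⟩ := hG
  refine ⟨2 ^ a * C, by positivity, fun t ht ℓ => ?_⟩
  cases ℓ with
  | zero => rw [PowerSeries.coeff_zero_X_mul]; simp; positivity
  | succ ℓ =>
    rw [PowerSeries.coeff_succ_X_mul]
    push_cast
    calc _ ≤ (2 ^ a * ((ℓ : ℝ) + 1) ^ a) * |PowerSeries.coeff ℓ (G t)| := by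
          gcongr; exact add_two_pow_le _ (by positivity) a
      _ ≤ 2 ^ a * (C * ((ℓ : ℝ) + 1) ^ q) := by
        rw [mul_assoc]
        exact mul_le_mul_of_nonneg_left (hG t ht ℓ) (by positivity)
      _ ≤ _ := by rw [mul_assoc]; gcongr; linarith

lemma CoeffGrowth.one_add_X_mul {a q : ℕ} {G : ℝ → PowerSeries ℝ} (hG : CoeffGrowth a q G) :
    CoeffGrowth a q (fun t => (1 + PowerSeries.X) * G t) := by
  have := hG.add hG.X_mul
  simpa only [add_mul, one_mul] using this

lemma CoeffGrowth.one_sub_X_mul {a q : ℕ} {G : ℝ → PowerSeries ℝ} (hG : CoeffGrowth a q G) :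
    CoeffGrowth a q (fun t => (1 - PowerSeries.X) * G t) := by
  have := hG.add (hG.X_mul.const_mul (c := fun _ => -1) (B := 1) (by simp))
  simpa only [sub_mul, one_mul, map_neg, map_one, neg_mul, ← sub_eq_add_neg] using this

lemma CoeffGrowth.one_sub_X_pow_mul {a q : ℕ} {G : ℝ → PowerSeries ℝ} (hG : CoeffGrowth a q G)
    (k : ℕ) : CoeffGrowth a q (fun t => (1 - PowerSeries.X) ^ k * G t) := by
  induction k with
  | zero => simpa using hG
  | succ k ih => simpa only [pow_succ', mul_assoc] using ih.one_sub_X_mul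

lemma CoeffGrowth.anti {a b q : ℕ} {G : ℝ → PowerSeries ℝ} (hG : CoeffGrowth a q G)
    (hab : b ≤ a) : CoeffGrowth b q G := by
  obtain ⟨C, hC, hG⟩ := hG
  refine ⟨C, hC, fun t ht ℓ => le_trans ?_ (hG t ht ℓ)⟩
  gcongr
  linarith [(Nat.cast_nonneg ℓ : (0 : ℝ) ≤ ℓ)]

lemma CoeffGrowth.of_derivative {a q : ℕ} {G H : ℝ → PowerSeries ℝ} (hG : CoeffGrowth a q G)
    (hd : ∀ t, PowerSeries.derivative ℝ (H t) = G t)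
    (h0 : ∀ t, PowerSeries.constantCoeff (H t) = 1) : CoeffGrowth (a + 1) q H := by
  obtain ⟨C, hC, hG⟩ := hG
  refine ⟨max 1 (2 ^ (a + 1) * C), by positivity, fun t ht ℓ => ?_⟩
  cases ℓ with
  | zero => simp [h0]
  | succ ℓ =>
    have h1 : PowerSeries.coeff (ℓ + 1) (H t) * ((ℓ : ℝ) + 1) = PowerSeries.coeff ℓ (G t) := by
      rw [← hd, PowerSeries.coeff_derivative]
    have h2 : |PowerSeries.coeff (ℓ + 1) (H t)| * ((ℓ : ℝ) + 1) = |PowerSeries.coeff ℓ (G t)| := by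
      rw [← h1, abs_mul, abs_of_nonneg (by positivity : (0 : ℝ) ≤ (ℓ : ℝ) + 1)]
    push_cast
    calc _ ≤ (2 ^ (a + 1) * ((ℓ : ℝ) + 1) ^ (a + 1)) * |PowerSeries.coeff (ℓ + 1) (H t)| := by
          gcongr; exact add_two_pow_le _ (by positivity) _
      _ = 2 ^ (a + 1) * (((ℓ : ℝ) + 1) ^ a * |PowerSeries.coeff ℓ (G t)|) := by rw [← h2]; ring
      _ ≤ 2 ^ (a + 1) * (C * ((ℓ : ℝ) + 1) ^ q) :=
        mul_le_mul_of_nonneg_left (hG t ht ℓ) (by positivity)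
      _ ≤ max 1 (2 ^ (a + 1) * C) * ((ℓ : ℝ) + 1 + 1) ^ q := by
        rw [← mul_assoc]
        gcongr
        · exact le_max_right _ _
        · linarith

lemma coeffGrowth_quadS_pow_mul (q a : ℕ) :
    CoeffGrowth a q (fun t => quadS t 1 ^ a * legS t 1 ^ (q + 1)) := by
  induction a with
  | zero =>
    refine ⟨1, by norm_num, fun t ht ℓ => ?_⟩
    simpa using abs_coeff_legS_pow_le ht q ℓ
  | succ a ih =>
    have h1 := (ih.const_mul (c := fun t => t) (B := 1) (fun t ht => ht)).add
      (ih.X_mul.const_mul (c := fun _ => -1) (B := 1) (by simp))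
    have h2 := h1.const_mul (c := fun _ => ((q + 1 : ℕ) : ℝ) - 2 * ((a : ℝ) + 1))
      (fun _ _ => le_rfl)
    refine h2.of_derivative (fun t => ?_) (fun t => ?_)
    · rw [quadS_pow_mul_legS_pow_derivative]
      simp only [linS, map_neg, map_one]
      ring
    · have h0 : PowerSeries.constantCoeff (legS t (1 : ℝ)) = 1 := by
        rw [← PowerSeries.coeff_zero_eq_constantCoeff_apply, legS, PowerSeries.coeff_mk, legCoeff]
      simp [quadS, h0]

end PowerBounds

section FilterDifferences

/-- Backward difference with step `δ`. -/
def stepDiff (δ : ℝ) (f : ℝ → ℝ) (x : ℝ) : ℝ := f x - f (x + δ)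

lemma IterIntBV.intervalIntegrable {S : ℕ} {f : ℝ → ℝ} (hf : IterIntBV S f) {a b : ℝ}
    (ha : 0 ≤ a) (hb : 0 ≤ b) : IntervalIntegrable f volume a b := by
  induction S generalizing f a b with
  | zero =>
    have hf' : BoundedVariationOn f (Set.Ici 0) := hf
    obtain ⟨p, r, hp, hr, rfl⟩ :=
      hf'.locallyBoundedVariationOn.exists_monotoneOn_sub_monotoneOn
    have hs : Set.uIcc a b ⊆ Set.Ici 0 := fun x hx => by
      rcases Set.mem_uIcc.mp hx with h | h
      · exact ha.trans h.1
      · exact hb.trans h.1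
    exact (hp.mono hs).intervalIntegrable.sub (hr.mono hs).intervalIntegrable
  | succ S ih =>
    obtain ⟨g, hg, hfg⟩ := hf
    have hs : Set.uIcc a b ⊆ Set.Ici 0 := fun x hx => by
      rcases Set.mem_uIcc.mp hx with h | h
      · exact ha.trans h.1
      · exact hb.trans h.1
    have hm : 0 ≤ max a b := ha.trans (le_max_left _ _)
    have hc : ContinuousOn (fun x => f 0 + ∫ t in (0 : ℝ)..x, g t) (Set.uIcc 0 (max a b)) := by
      refine continuousOn_const.add (intervalIntegral.continuousOn_primitive_interval ?_)
      rw [Set.uIcc_of_le hm]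
      exact ((intervalIntegrable_iff_integrableOn_Icc_of_le hm).mp (ih hg le_rfl hm))
    have hsub : Set.uIcc a b ⊆ Set.uIcc 0 (max a b) := fun x hx => by
      rw [Set.uIcc_of_le hm]
      exact ⟨hs hx, by rw [Set.uIcc, Set.mem_Icc] at hx; exact hx.2⟩
    refine ContinuousOn.intervalIntegrable ((hc.mono hsub).congr fun x hx => hfg x (hs hx))

lemma stepDiff_eq_neg_integral {S : ℕ} {f g : ℝ → ℝ} (hg : IterIntBV S g)
    (hfg : ∀ x : ℝ, 0 ≤ x → f x = f 0 + ∫ t in (0 : ℝ)..x, g t) {δ : ℝ} (hδ : 0 ≤ δ) {x : ℝ}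
    (hx : 0 ≤ x) : stepDiff δ f x = -∫ s in (0 : ℝ)..δ, g (x + s) := by
  have h1 := intervalIntegral.integral_add_adjacent_intervals
    (hg.intervalIntegrable le_rfl hx) (hg.intervalIntegrable hx (add_nonneg hx hδ))
  have h2 : ∫ s in (0 : ℝ)..δ, g (x + s) = ∫ s in x..(x + δ), g s := by
    rw [intervalIntegral.integral_comp_add_left (fun s => g s) x, add_zero]
  rw [stepDiff, hfg x hx, hfg (x + δ) (add_nonneg hx hδ), h2, ← h1]
  ring

lemma intervalIntegrable_shift {g : ℝ → ℝ}
    (hg : ∀ a b : ℝ, 0 ≤ a → 0 ≤ b → IntervalIntegrable g volume a b) {c : ℝ} (hc : 0 ≤ c)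
    {a b : ℝ} (ha : 0 ≤ a) (hb : 0 ≤ b) :
    IntervalIntegrable (fun s => g (s + c)) volume a b := by
  have := (hg (a + c) (b + c) (by positivity) (by positivity)).comp_add_right c
  simpa using this

lemma intervalIntegrable_stepDiff_iterate {g : ℝ → ℝ} {δ : ℝ} (hδ : 0 ≤ δ)
    (hg : ∀ a b : ℝ, 0 ≤ a → 0 ≤ b → IntervalIntegrable g volume a b) (k : ℕ) {a b : ℝ}
    (ha : 0 ≤ a) (hb : 0 ≤ b) : IntervalIntegrable ((stepDiff δ)^[k] g) volume a b := by
  induction k generalizing a b with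
  | zero => exact hg a b ha hb
  | succ k ih =>
    rw [Function.iterate_succ_apply']
    exact (ih ha hb).sub (intervalIntegrable_shift (fun a b ha hb => ih ha hb) hδ ha hb)

lemma stepDiff_iterate_eq_neg_integral {ψ g : ℝ → ℝ} {δ : ℝ} (hδ : 0 ≤ δ)
    (hg : ∀ a b : ℝ, 0 ≤ a → 0 ≤ b → IntervalIntegrable g volume a b)
    (hψ : ∀ x : ℝ, 0 ≤ x → ψ x = -∫ s in (0 : ℝ)..δ, g (x + s)) (k : ℕ) {x : ℝ} (hx : 0 ≤ x) :
    (stepDiff δ)^[k] ψ x = -∫ s in (0 : ℝ)..δ, (stepDiff δ)^[k] g (x + s) := by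
  induction k generalizing x with
  | zero => exact hψ x hx
  | succ k ih =>
    have hi := fun a b ha hb =>
      intervalIntegrable_stepDiff_iterate hδ hg k (a := a) (b := b) ha hb
    have i1 : IntervalIntegrable (fun s => (stepDiff δ)^[k] g (x + s)) volume 0 δ := by
      simpa only [add_comm] using intervalIntegrable_shift hi hx le_rfl hδ
    have i2 : IntervalIntegrable (fun s => (stepDiff δ)^[k] g (x + s + δ)) volume 0 δ := by
      have := intervalIntegrable_shift hi (add_nonneg hx hδ) le_rfl hδ
      refine this.congr fun s _ => ?_
      ring_nf
    simp only [Function.iterate_succ_apply', stepDiff]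
    rw [intervalIntegral.integral_sub i1 i2, ih hx, ih (add_nonneg hx hδ)]
    simp only [add_right_comm x δ]
    ring

lemma IterIntBV.sum_abs_stepDiff_le {S : ℕ} {f : ℝ → ℝ} (hf : IterIntBV S f) :
    ∃ V : ℝ, 0 ≤ V ∧ ∀ δ : ℝ, 0 ≤ δ → ∀ y : ℝ, 0 ≤ y → ∀ N : ℕ,
      ∑ ℓ ∈ range N, |(stepDiff δ)^[S + 1] f (y + ℓ * δ)| ≤ V * δ ^ S := by
  induction S generalizing f with
  | zero =>
    have hf' : BoundedVariationOn f (Set.Ici 0) := hf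
    refine ⟨(eVariationOn f (Set.Ici 0)).toReal, ENNReal.toReal_nonneg, fun δ hδ y hy N => ?_⟩
    have hmono : Monotone (fun ℓ : ℕ => y + ℓ * δ) := fun a b hab => by
      have : (a : ℝ) ≤ b := by exact_mod_cast hab
      simp only
      gcongr
    have := eVariationOn.sum_le (f := f) (s := Set.Ici 0) (n := N) hmono
      (fun i => by simp only [Set.mem_Ici]; positivity)
    rw [pow_zero, mul_one]
    have h2 := ENNReal.toReal_mono hf' this
    rw [ENNReal.toReal_sum (fun i _ => edist_ne_top _ _)] at h2
    refine le_trans (le_of_eq (sum_congr rfl fun i _ => ?_)) h2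
    rw [← dist_edist, Real.dist_eq, abs_sub_comm]
    simp only [zero_add, Function.iterate_one, stepDiff]
    push_cast
    ring_nf
  | succ S ih =>
    obtain ⟨g, hg, hfg⟩ := hf
    obtain ⟨V, hV, ih⟩ := ih hg
    refine ⟨V, hV, fun δ hδ y hy N => ?_⟩
    have hgi := fun a b ha hb => hg.intervalIntegrable (a := a) (b := b) ha hb
    have hi := fun a b ha hb =>
      intervalIntegrable_stepDiff_iterate hδ hgi (S + 1) (a := a) (b := b) ha hb
    have hint : ∀ x, 0 ≤ x →
        IntervalIntegrable (fun s => (stepDiff δ)^[S + 1] g (x + s)) volume 0 δ := fun x hx => by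
      simpa only [add_comm] using intervalIntegrable_shift hi hx le_rfl hδ
    calc _ ≤ ∑ ℓ ∈ range N, ∫ s in (0 : ℝ)..δ, |(stepDiff δ)^[S + 1] g (y + ℓ * δ + s)| := by
          refine sum_le_sum fun ℓ _ => ?_
          rw [Function.iterate_succ_apply, stepDiff_iterate_eq_neg_integral hδ hgi
            (fun x hx => stepDiff_eq_neg_integral hg hfg hδ hx) (S + 1) (by positivity), abs_neg]
          exact intervalIntegral.abs_integral_le_integral_abs hδ
      _ = ∫ s in (0 : ℝ)..δ, ∑ ℓ ∈ range N, |(stepDiff δ)^[S + 1] g (y + ℓ * δ + s)| := by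
        rw [intervalIntegral.integral_finsetSum]
        exact fun ℓ _ => (hint _ (by positivity)).abs
      _ ≤ ∫ s in (0 : ℝ)..δ, V * δ ^ S := by
        refine intervalIntegral.integral_mono_on hδ ?_ (by simp) fun s hs => ?_
        · have := IntervalIntegrable.sum (range N)
            (f := fun (ℓ : ℕ) s => |(stepDiff δ)^[S + 1] g (y + ℓ * δ + s)|)
            (fun ℓ _ => (hint (y + ℓ * δ) (by positivity)).abs)
          simpa [Finset.sum_fn] using this
        · have := ih δ hδ (y + s) (add_nonneg hy hs.1) N
          simpa only [add_right_comm y s] using this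
      _ = _ := by
        rw [intervalIntegral.integral_const, smul_eq_mul]; ring

/-- Backward difference of a sequence. -/
def seqDiff (f : ℕ → ℝ) (m : ℕ) : ℝ := f m - f (m + 1)

/-- Backward difference of a sequence with step two. -/
def seqDiff₂ (f : ℕ → ℝ) (m : ℕ) : ℝ := f m - f (m + 2)

lemma seqDiff_iterate_sample (h : ℝ → ℝ) (n k m : ℕ) :
    seqDiff^[k] (fun m : ℕ => h ((m : ℝ) / n)) m =
      (stepDiff (1 / (n : ℝ)))^[k] h ((m : ℝ) / n) := by
  induction k generalizing m with
  | zero => rfl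
  | succ k ih =>
    rw [Function.iterate_succ_apply', Function.iterate_succ_apply', seqDiff, stepDiff, ih, ih]
    congr 2
    push_cast
    ring_nf

lemma seqDiff_iterate_eq_zero {u : ℕ → ℝ} {n : ℕ} (hu : ∀ m, n < m → u m = 0) (k : ℕ) {m : ℕ}
    (hm : n < m) : seqDiff^[k] u m = 0 := by
  induction k generalizing m with
  | zero => exact hu m hm
  | succ k ih => rw [Function.iterate_succ_apply', seqDiff, ih hm, ih (by omega), sub_zero]

lemma abs_le_sum_abs_seqDiff {u : ℕ → ℝ} {n : ℕ} (hu : ∀ m, n < m → u m = 0) (m : ℕ) :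
    |u m| ≤ ∑ ℓ ∈ range (n + 1), |seqDiff u ℓ| := by
  rcases lt_or_ge n m with h | h
  · rw [hu m h, abs_zero]; positivity
  · have h1 : ∀ p, ∑ ℓ ∈ range p, seqDiff u ℓ = u 0 - u p := fun p => by
      simp only [seqDiff]
      exact sum_range_sub' u p
    have h2 : ∑ ℓ ∈ Ico m (n + 1), seqDiff u ℓ = u m := by
      rw [sum_Ico_eq_sub _ (by omega), h1, h1, hu (n + 1) (by omega)]; ring
    rw [← h2]
    refine (abs_sum_le_sum_abs _ _).trans
      (sum_le_sum_of_subset_of_nonneg ?_ (by intros; positivity))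
    intro a ha
    exact mem_range.mpr (mem_Ico.mp ha).2

lemma GoodH.sample_eq_zero {S : ℕ} {h : ℝ → ℝ} (hh : GoodH S h) {n : ℕ} (hn : 1 ≤ n) {m : ℕ}
    (hm : n < m) : h ((m : ℝ) / n) = 0 := by
  refine hh.2.1 _ ?_
  have h1 : (0 : ℝ) < n := by exact_mod_cast hn
  have h2 : (n : ℝ) < m := by exact_mod_cast hm
  rwa [lt_div_iff₀ h1, one_mul]

lemma GoodH.sum_abs_seqDiff_le {S : ℕ} {h : ℝ → ℝ} (hh : GoodH S h) :
    ∃ V : ℝ, 0 ≤ V ∧ ∀ n : ℕ, 1 ≤ n → ∀ N : ℕ,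
      (∑ ℓ ∈ range N, |seqDiff^[S + 1] (fun m : ℕ => h ((m : ℝ) / n)) ℓ|) * (n : ℝ) ^ S ≤ V := by
  obtain ⟨V, hV, hs⟩ := hh.2.2.2.sum_abs_stepDiff_le
  refine ⟨V, hV, fun n hn N => ?_⟩
  have h1 : (0 : ℝ) < n := by exact_mod_cast hn
  have := hs (1 / n) (by positivity) 0 le_rfl N
  simp only [seqDiff_iterate_sample]
  simp only [zero_add, one_div, inv_pow] at this
  rw [← div_eq_mul_inv, le_div_iff₀ (by positivity)] at this
  simpa only [one_div, div_eq_mul_inv, one_mul] using this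

lemma GoodH.abs_seqDiff_le {S : ℕ} {h : ℝ → ℝ} (hh : GoodH S h) (i : ℕ) {j : ℕ} (hj : j + i = S) :
    ∃ C : ℝ, 0 ≤ C ∧ ∀ n : ℕ, 1 ≤ n → ∀ m : ℕ,
      |seqDiff^[j] (fun m : ℕ => h ((m : ℝ) / n)) m| * (n : ℝ) ^ j ≤ C := by
  induction i generalizing j with
  | zero =>
    obtain rfl : j = S := by omega
    obtain ⟨V, hV, hs⟩ := hh.sum_abs_seqDiff_le
    refine ⟨V, hV, fun n hn m => le_trans ?_ (hs n hn (n + 1))⟩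
    gcongr
    simp only [Function.iterate_succ_apply']
    exact abs_le_sum_abs_seqDiff
      (fun m hm => seqDiff_iterate_eq_zero (fun m hm => hh.sample_eq_zero hn hm) j hm) m
  | succ i ih =>
    obtain ⟨C, hC, ih⟩ := ih (j := j + 1) (by omega)
    refine ⟨2 * C, by positivity, fun n hn m => ?_⟩
    have h1 : (1 : ℝ) ≤ n := by exact_mod_cast hn
    have h2 := abs_le_sum_abs_seqDiff (u := seqDiff^[j] (fun m : ℕ => h ((m : ℝ) / n)))
      (fun m hm => seqDiff_iterate_eq_zero (fun m hm => hh.sample_eq_zero hn hm) j hm) m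
    have h3 : ∀ ℓ, |seqDiff (seqDiff^[j] (fun m : ℕ => h ((m : ℝ) / n))) ℓ| * (n : ℝ) ^ (j + 1)
        ≤ C := fun ℓ => by
      have := ih n hn ℓ
      rwa [Function.iterate_succ_apply'] at this
    have h4 : (∑ ℓ ∈ range (n + 1), |seqDiff (seqDiff^[j] (fun m : ℕ => h ((m : ℝ) / n))) ℓ|) *
        (n : ℝ) ^ (j + 1) ≤ ((n : ℝ) + 1) * C := by
      rw [sum_mul]
      refine (sum_le_sum fun ℓ _ => h3 ℓ).trans_eq ?_
      rw [sum_const, card_range, nsmul_eq_mul]; push_cast; ring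
    have h5 : |seqDiff^[j] (fun m : ℕ => h ((m : ℝ) / n)) m| * (n : ℝ) ^ j * n ≤ 2 * C * n := by
      calc _ = |seqDiff^[j] (fun m : ℕ => h ((m : ℝ) / n)) m| * (n : ℝ) ^ (j + 1) := by ring
        _ ≤ _ := (mul_le_mul_of_nonneg_right h2 (by positivity)).trans h4
        _ ≤ _ := by nlinarith
    exact le_of_mul_le_mul_right h5 (by linarith)

lemma seqDiff₂_iterate_add_shift (f : ℕ → ℝ) (j m : ℕ) :
    seqDiff₂^[j] (fun m => f m + f (m + 1)) m = seqDiff₂^[j] f m + seqDiff₂^[j] f (m + 1) := by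
  induction j generalizing m with
  | zero => rfl
  | succ j ih =>
    simp only [Function.iterate_succ_apply', seqDiff₂, ih]
    rw [show m + 2 + 1 = m + 1 + 2 by ring]; ring

lemma GoodH.abs_seqDiff₂_le {S : ℕ} {h : ℝ → ℝ} (hh : GoodH S h) (j : ℕ) {i : ℕ} (hj : i + j ≤ S) :
    ∃ C : ℝ, 0 ≤ C ∧ ∀ n : ℕ, 1 ≤ n → ∀ m : ℕ,
      |seqDiff₂^[j] (seqDiff^[i] (fun m : ℕ => h ((m : ℝ) / n))) m| * (n : ℝ) ^ (i + j) ≤ C := by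
  induction j generalizing i with
  | zero => exact hh.abs_seqDiff_le (S - i) (by omega)
  | succ j ih =>
    obtain ⟨C, hC, ih⟩ := ih (i := i + 1) (by omega)
    refine ⟨2 * C, by positivity, fun n hn m => ?_⟩
    have e : seqDiff₂ (seqDiff^[i] (fun m : ℕ => h ((m : ℝ) / n))) = fun m =>
        seqDiff^[i + 1] (fun m : ℕ => h ((m : ℝ) / n)) m +
        seqDiff^[i + 1] (fun m : ℕ => h ((m : ℝ) / n)) (m + 1) := by
      funext m
      simp only [Function.iterate_succ_apply', seqDiff₂, seqDiff]; ring
    rw [Function.iterate_succ_apply, e, seqDiff₂_iterate_add_shift]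
    have h1 := ih n hn m
    have h2 := ih n hn (m + 1)
    rw [show i + 1 + j = i + (j + 1) by ring] at h1 h2
    refine (mul_le_mul_of_nonneg_right (abs_add_le _ _) (by positivity)).trans ?_
    linarith

end FilterDifferences

section ZonalSums

/-- The sum `∑_{ℓ ≤ n} h(ℓ/n) K_ℓ(t)` of zonal kernels, where `∑_ℓ K_ℓ(t) z^ℓ` is the generating
function `(1 - z²) (1 - 2 t z + z²)^(-(q+1)/2)`. -/
def zonalSum (q : ℕ) (h : ℝ → ℝ) (n : ℕ) (t : ℝ) : ℝ :=
  ∑ ℓ ∈ range (n + 1), h ((ℓ : ℝ) / n) *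
    PowerSeries.coeff ℓ ((1 - PowerSeries.X ^ 2) * legS t 1 ^ (q + 1))

lemma GoodH.abs_le_one {S : ℕ} {h : ℝ → ℝ} (hh : GoodH S h) {x : ℝ} (hx : 0 ≤ x) : |h x| ≤ 1 := by
  have h0 : h 0 = 1 := hh.1 0 le_rfl (by norm_num)
  have h1 : h x ≤ h 0 := hh.2.2.1 0 x le_rfl hx
  have h2 : h (x + 2) ≤ h x := hh.2.2.1 x (x + 2) hx (by linarith)
  rw [hh.2.1 (x + 2) (by linarith)] at h2
  rw [abs_of_nonneg h2]
  linarith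

lemma abs_zonalSum_le (q : ℕ) {S : ℕ} {h : ℝ → ℝ} (hh : GoodH S h) (n : ℕ) {t : ℝ}
    (ht : |t| ≤ 1) : |zonalSum q h n t| ≤ 2 * ((n : ℝ) + 1) ^ (q + 1) := by
  have hG : ∀ ℓ ≤ n, |PowerSeries.coeff ℓ ((1 - PowerSeries.X ^ 2) * legS t 1 ^ (q + 1))| ≤
      2 * ((n : ℝ) + 1) ^ q := by
    intro ℓ hℓ
    have hm : ∀ k ≤ n, |PowerSeries.coeff k (legS t 1 ^ (q + 1))| ≤ ((n : ℝ) + 1) ^ q :=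
      fun k hk => (abs_coeff_legS_pow_le ht q k).trans (by gcongr)
    rw [sub_mul, one_mul, map_sub, PowerSeries.coeff_X_pow_mul']
    refine (abs_sub _ _).trans ?_
    have h1 := hm ℓ hℓ
    have h2 : |if 2 ≤ ℓ then PowerSeries.coeff (ℓ - 2) (legS t 1 ^ (q + 1)) else 0| ≤
        ((n : ℝ) + 1) ^ q := by
      split_ifs
      · exact hm _ (by omega)
      · simp; positivity
    linarith
  refine (abs_sum_le_sum_abs _ _).trans ?_
  calc _ ≤ ∑ ℓ ∈ range (n + 1), 1 * (2 * ((n : ℝ) + 1) ^ q) := by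
        refine sum_le_sum fun ℓ hℓ => ?_
        rw [abs_mul]
        exact mul_le_mul (hh.abs_le_one (by positivity))
          (hG ℓ (Nat.lt_succ_iff.mp (mem_range.mp hℓ))) (abs_nonneg _) zero_le_one
    _ = _ := by rw [sum_const, card_range, nsmul_eq_mul]; push_cast; ring

/-- Pairing of a sequence with the first `N` coefficients of a power series. -/
def coeffPair (N : ℕ) (f : ℕ → ℝ) (G : PowerSeries ℝ) : ℝ :=
  ∑ m ∈ range N, f m * PowerSeries.coeff m G

lemma coeffPair_X_mul {N : ℕ} {f : ℕ → ℝ} (hf : ∀ m, N ≤ m → f m = 0) (G : PowerSeries ℝ) :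
    coeffPair N f (PowerSeries.X * G) = coeffPair N (fun m => f (m + 1)) G := by
  have h : coeffPair N f (PowerSeries.X * G) =
      ∑ m ∈ range (N + 1), f m * PowerSeries.coeff m (PowerSeries.X * G) := by
    rw [sum_range_succ, hf N le_rfl, zero_mul, add_zero, coeffPair]
  rw [h, sum_range_succ', PowerSeries.coeff_zero_X_mul, mul_zero, add_zero, coeffPair]
  simp only [PowerSeries.coeff_succ_X_mul]

lemma coeffPair_sub (N : ℕ) (f : ℕ → ℝ) (G H : PowerSeries ℝ) :
    coeffPair N f (G - H) = coeffPair N f G - coeffPair N f H := by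
  simp only [coeffPair, map_sub, mul_sub, sum_sub_distrib]

lemma coeffPair_one_sub_X_mul {N : ℕ} {f : ℕ → ℝ} (hf : ∀ m, N ≤ m → f m = 0)
    (G : PowerSeries ℝ) :
    coeffPair N f ((1 - PowerSeries.X) * G) = coeffPair N (seqDiff f) G := by
  rw [sub_mul, one_mul, coeffPair_sub, coeffPair_X_mul hf]
  simp only [coeffPair, seqDiff, sub_mul, sum_sub_distrib]

lemma coeffPair_one_sub_X_sq_mul {N : ℕ} {f : ℕ → ℝ} (hf : ∀ m, N ≤ m → f m = 0)
    (G : PowerSeries ℝ) :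
    coeffPair N f ((1 - PowerSeries.X ^ 2) * G) = coeffPair N (seqDiff₂ f) G := by
  rw [sub_mul, one_mul, coeffPair_sub, pow_two, mul_assoc, coeffPair_X_mul hf,
    coeffPair_X_mul (fun m hm => hf (m + 1) (by omega))]
  simp only [coeffPair, seqDiff₂, sub_mul, sum_sub_distrib, add_assoc, Nat.reduceAdd]

lemma coeff_legS_pow_eq (t : ℝ) (m ℓ : ℕ) :
    (2 * (ℓ : ℝ) + m) * PowerSeries.coeff ℓ (legS t 1 ^ m) =
      m * PowerSeries.coeff ℓ ((1 - PowerSeries.X ^ 2) * legS t 1 ^ (m + 2)) := by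
  have h := congrArg (PowerSeries.coeff ℓ) (X_mul_legS_pow_derivative t (1 : ℝ) m)
  have e1 : 2 * PowerSeries.X * PowerSeries.derivative ℝ (legS t 1 ^ m) =
      PowerSeries.C (2 : ℝ) * (PowerSeries.X * PowerSeries.derivative ℝ (legS t 1 ^ m)) := by
    rw [map_ofNat]; ring
  have e2 : ((m : ℕ) : PowerSeries ℝ) = PowerSeries.C (m : ℝ) := (map_natCast _ m).symm
  rw [e1, e2, map_add, PowerSeries.coeff_C_mul, PowerSeries.coeff_C_mul, PowerSeries.coeff_C_mul,
    map_one, one_mul] at h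
  rw [← h]
  cases ℓ with
  | zero => rw [PowerSeries.coeff_zero_X_mul]; push_cast; ring
  | succ ℓ =>
    rw [PowerSeries.coeff_succ_X_mul, PowerSeries.coeff_derivative]; push_cast; ring

/-- The sequence obtained by one summation by parts against the Taylor coefficients of
`(1 - 2 t X + X²)^(-m/2)`. -/
def partsStep (m : ℕ) (g : ℕ → ℝ) : ℕ → ℝ := fun ℓ => (m : ℝ) / (2 * (ℓ : ℝ) + m) * g ℓ

lemma coeffPair_legS_pow {N : ℕ} {g : ℕ → ℝ} (hg : ∀ m, N ≤ m → g m = 0) (t : ℝ) {m : ℕ}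
    (hm : 0 < m) : coeffPair N g (legS t 1 ^ m) =
      coeffPair N (seqDiff₂ (partsStep m g)) (legS t 1 ^ (m + 2)) := by
  rw [← coeffPair_one_sub_X_sq_mul (fun k hk => by rw [partsStep, hg k hk, mul_zero])]
  refine sum_congr rfl fun ℓ _ => ?_
  have h := coeff_legS_pow_eq t m ℓ
  have hm' : (0 : ℝ) < m := by exact_mod_cast hm
  have : (2 * (ℓ : ℝ) + m) ≠ 0 := by positivity
  rw [partsStep]
  field_simp
  linear_combination g ℓ * h

/-- The sequence obtained by iterated summation by parts. -/
def partsSeq (q : ℕ) (u : ℕ → ℝ) : ℕ → ℕ → ℝ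
  | 0 => seqDiff₂ u
  | (k + 1) => seqDiff₂ (partsStep (q + 1 + 2 * k) (partsSeq q u k))

lemma partsSeq_eq_zero (q : ℕ) {u : ℕ → ℝ} {N : ℕ} (hu : ∀ m, N ≤ m → u m = 0) (k : ℕ) {m : ℕ}
    (hm : N ≤ m) : partsSeq q u k m = 0 := by
  induction k generalizing m with
  | zero => rw [partsSeq, seqDiff₂, hu m hm, hu (m + 2) (by omega), sub_zero]
  | succ k ih =>
    rw [partsSeq, seqDiff₂, partsStep, partsStep, ih hm, ih (m := m + 2) (by omega)]; simp

lemma partsSeq_eq_zero_of_const (q : ℕ) {u : ℕ → ℝ} {N : ℕ} (hu : ∀ m, 2 * m ≤ N → u m = 1)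
    (k : ℕ) {m : ℕ} (hm : 2 * (m + 2 * k + 2) ≤ N) : partsSeq q u k m = 0 := by
  induction k generalizing m with
  | zero => rw [partsSeq, seqDiff₂, hu m (by omega), hu (m + 2) (by omega), sub_self]
  | succ k ih =>
    rw [partsSeq, seqDiff₂, partsStep, partsStep, ih (by omega), ih (m := m + 2) (by omega)]; simp

lemma coeffPair_partsSeq (q : ℕ) {u : ℕ → ℝ} {N : ℕ} (hu : ∀ m, N ≤ m → u m = 0) (t : ℝ) (k : ℕ) :
    coeffPair N u ((1 - PowerSeries.X ^ 2) * legS t 1 ^ (q + 1)) =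
      coeffPair N (partsSeq q u k) (legS t 1 ^ (q + 1 + 2 * k)) := by
  induction k with
  | zero => rw [coeffPair_one_sub_X_sq_mul hu]; rfl
  | succ k ih =>
    rw [ih, coeffPair_legS_pow (fun m hm => partsSeq_eq_zero q hu k hm) t (by omega)]
    rfl

/-- The first `J` differences of `u n` decay like `n^(-A-j)` on `[n/4, ∞)`. -/
def DiffDecay (A J : ℕ) (u : ℕ → ℕ → ℝ) : Prop :=
  ∀ j ≤ J, ∃ C : ℝ, 0 ≤ C ∧ ∀ n : ℕ, 1 ≤ n → ∀ ℓ : ℕ, n ≤ 4 * ℓ →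
    |seqDiff₂^[j] (u n) ℓ| * (n : ℝ) ^ (A + j) ≤ C

lemma DiffDecay.seqDiff₂ {A J : ℕ} {u : ℕ → ℕ → ℝ} (hu : DiffDecay A (J + 1) u) :
    DiffDecay (A + 1) J (fun n => seqDiff₂ (u n)) := by
  intro j hj
  obtain ⟨C, hC, h⟩ := hu (j + 1) (by omega)
  refine ⟨C, hC, fun n hn ℓ hℓ => ?_⟩
  have := h n hn ℓ hℓ
  rwa [Function.iterate_succ_apply, show A + (j + 1) = A + 1 + j by ring] at this

lemma seqDiff₂_iterate_linear_mul (b : ℝ) (w : ℕ → ℝ) (j ℓ : ℕ) :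
    seqDiff₂^[j + 1] (fun ℓ => (2 * (ℓ : ℝ) + b) * w ℓ) ℓ =
      (2 * (ℓ : ℝ) + b) * seqDiff₂^[j + 1] w ℓ - 4 * ((j : ℝ) + 1) * seqDiff₂^[j] w (ℓ + 2) := by
  induction j generalizing ℓ with
  | zero => simp [seqDiff₂]; ring
  | succ j ih =>
    rw [Function.iterate_succ_apply', seqDiff₂, ih, ih]
    have e1 : seqDiff₂^[j + 1 + 1] w ℓ = seqDiff₂^[j + 1] w ℓ - seqDiff₂^[j + 1] w (ℓ + 2) := by
      rw [Function.iterate_succ_apply' (n := j + 1), seqDiff₂]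
    have e2 : seqDiff₂^[j + 1] w (ℓ + 2) = seqDiff₂^[j] w (ℓ + 2) - seqDiff₂^[j] w (ℓ + 2 + 2) := by
      rw [Function.iterate_succ_apply', seqDiff₂]
    rw [e1]
    push_cast
    linear_combination (-4 * ((j : ℝ) + 1)) * (-e2)

lemma seqDiff₂_iterate_const_mul (b : ℝ) (w : ℕ → ℝ) (j ℓ : ℕ) :
    seqDiff₂^[j] (fun ℓ => b * w ℓ) ℓ = b * seqDiff₂^[j] w ℓ := by
  induction j generalizing ℓ with
  | zero => rfl
  | succ j ih => simp only [Function.iterate_succ_apply', seqDiff₂, ih]; ring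

lemma DiffDecay.partsStep {A J m : ℕ} (hm : 0 < m) {u : ℕ → ℕ → ℝ} (hu : DiffDecay A J u) :
    DiffDecay (A + 1) J (fun n => partsStep m (u n)) := by
  have hm' : (0 : ℝ) < m := by exact_mod_cast hm
  have key : ∀ n : ℕ, (fun ℓ : ℕ => (2 * (ℓ : ℝ) + m) * SD.partsStep m (u n) ℓ) =
      fun ℓ : ℕ => (m : ℝ) * u n ℓ := by
    intro n
    funext ℓ
    have : (2 * (ℓ : ℝ) + m) ≠ 0 := by positivity
    rw [SD.partsStep]
    field_simp
  intro j
  induction j with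
  | zero =>
    intro _
    obtain ⟨C, hC, h⟩ := hu 0 (by omega)
    refine ⟨2 * (m * C), by positivity, fun n hn ℓ hℓ => ?_⟩
    have h1 := h n hn ℓ hℓ
    have h2 := congrFun (key n) ℓ
    have hℓ' : (n : ℝ) ≤ 4 * ℓ := by exact_mod_cast hℓ
    simp only [Function.iterate_zero, id_eq, add_zero] at h1 h2 ⊢
    have h3 : (2 * (ℓ : ℝ) + m) * |SD.partsStep m (u n) ℓ| = m * |u n ℓ| := by
      have := congrArg abs h2
      rwa [abs_mul, abs_mul, abs_of_nonneg (by positivity), abs_of_nonneg hm'.le] at this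
    calc _ = (n : ℝ) * |SD.partsStep m (u n) ℓ| * (n : ℝ) ^ A := by ring
      _ ≤ (2 * ((2 * (ℓ : ℝ) + m) * |SD.partsStep m (u n) ℓ|)) * (n : ℝ) ^ A := by
        rw [← mul_assoc]
        gcongr
        linarith
      _ = 2 * (m * (|u n ℓ| * (n : ℝ) ^ A)) := by rw [h3]; ring
      _ ≤ _ := by gcongr
  | succ j ih =>
    intro hj
    obtain ⟨C, hC, h⟩ := hu (j + 1) hj
    obtain ⟨C', hC', h'⟩ := ih (by omega)
    refine ⟨2 * (m * C + 4 * ((j : ℝ) + 1) * C'), by positivity, fun n hn ℓ hℓ => ?_⟩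
    have h1 := h n hn ℓ hℓ
    have h1' := h' n hn (ℓ + 2) (by omega)
    have h2 := seqDiff₂_iterate_linear_mul m (SD.partsStep m (u n)) j ℓ
    rw [key, seqDiff₂_iterate_const_mul] at h2
    have hℓ' : (n : ℝ) ≤ 4 * ℓ := by exact_mod_cast hℓ
    set D := SD.seqDiff₂^[j + 1] (SD.partsStep m (u n)) ℓ
    set D' := SD.seqDiff₂^[j] (SD.partsStep m (u n)) (ℓ + 2)
    set E := SD.seqDiff₂^[j + 1] (u n) ℓ
    have h3 : (2 * (ℓ : ℝ) + m) * |D| ≤ m * |E| + 4 * ((j : ℝ) + 1) * |D'| := by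
      have e : (2 * (ℓ : ℝ) + m) * D = m * E + 4 * ((j : ℝ) + 1) * D' := by linarith
      have := congrArg abs e
      rw [abs_mul, abs_of_nonneg (by positivity)] at this
      rw [this]
      refine (abs_add_le _ _).trans_eq ?_
      rw [abs_mul, abs_mul, abs_of_nonneg hm'.le,
        abs_of_nonneg (by positivity : (0 : ℝ) ≤ 4 * ((j : ℝ) + 1))]
    calc _ = (n : ℝ) * |D| * (n : ℝ) ^ (A + (j + 1)) := by ring
      _ ≤ (2 * ((2 * (ℓ : ℝ) + m) * |D|)) * (n : ℝ) ^ (A + (j + 1)) := by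
        rw [← mul_assoc]
        gcongr
        linarith
      _ ≤ (2 * (m * |E| + 4 * ((j : ℝ) + 1) * |D'|)) * (n : ℝ) ^ (A + (j + 1)) := by gcongr
      _ = 2 * (m * (|E| * (n : ℝ) ^ (A + (j + 1))) +
          4 * ((j : ℝ) + 1) * (|D'| * (n : ℝ) ^ (A + 1 + j))) := by ring
      _ ≤ _ := by gcongr

lemma GoodH.diffDecay_partsSeq (q : ℕ) {S : ℕ} {h : ℝ → ℝ} (hh : GoodH S h) (k : ℕ) {J : ℕ}
    (hJ : J + k + 1 = S) :
    DiffDecay (2 * k + 1) J (fun n => partsSeq q (fun m : ℕ => h ((m : ℝ) / n)) k) := by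
  induction k generalizing J with
  | zero =>
    have : DiffDecay 0 (J + 1) (fun n (m : ℕ) => h ((m : ℝ) / n)) := by
      intro j hj
      obtain ⟨C, hC, hb⟩ := hh.abs_seqDiff₂_le j (i := 0) (by omega)
      exact ⟨C, hC, fun n hn ℓ _ => hb n hn ℓ⟩
    exact this.seqDiff₂
  | succ k ih =>
    have := ((ih (J := J + 1) (by omega)).partsStep (m := q + 1 + 2 * k) (by omega)).seqDiff₂
    exact this

/-- Bound for the zonal sums for `t ∈ [0, 1)` and large `n`. -/
lemma GoodH.abs_zonalSum_le_of_large (q : ℕ) {S : ℕ} (hS : 1 ≤ S) {h : ℝ → ℝ} (hh : GoodH S h) :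
    ∃ c : ℝ, 0 ≤ c ∧ ∀ n : ℕ, 1 ≤ n → 8 * S ≤ n → ∀ t : ℝ, 0 ≤ t → t < 1 →
      |zonalSum q h n t| ≤ c * (n : ℝ) ^ (((q : ℝ) + 1) / 2 - S) *
        √(1 - t) ^ (-(((q : ℝ) - 1) / 2 + S)) := by
  obtain ⟨k, rfl⟩ : ∃ k, S = k + 1 := ⟨S - 1, by omega⟩
  obtain ⟨C, hC, hg⟩ := hh.diffDecay_partsSeq q k (J := 0) (by omega) 0 le_rfl
  obtain ⟨C', hC', hL⟩ := abs_coeff_legS_pow_le_sharp (q + 2 * k)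
  set ν : ℝ := ((q : ℝ) - 1) / 2 + ((k + 1 : ℕ) : ℝ) with hν
  have e1 : (((q + 2 * k : ℕ) : ℝ) + 1) / 2 = ν := by rw [hν]; push_cast; ring
  have hν0 : 0 < ν := by rw [← e1]; positivity
  refine ⟨C * C' * 2 * 2 ^ ν, by positivity, fun n hn hnS t ht0 ht1 => ?_⟩
  have hn0 : (0 : ℝ) < n := by exact_mod_cast hn
  have htabs : |t| < 1 := by rw [abs_of_nonneg ht0]; exact ht1
  set u : ℕ → ℝ := fun m => h ((m : ℝ) / n) with hu
  have hu0 : ∀ m, n + 1 ≤ m → u m = 0 := fun m hm => hh.sample_eq_zero hn hm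
  have hu1 : ∀ m, 2 * m ≤ n → u m = 1 := fun m hm => by
    refine hh.1 _ (by positivity) ?_
    have : 2 * (m : ℝ) ≤ n := by exact_mod_cast hm
    rw [div_le_iff₀ hn0]; linarith
  have hz : zonalSum q h n t = coeffPair (n + 1) (partsSeq q u k) (legS t 1 ^ (q + 1 + 2 * k)) :=
    coeffPair_partsSeq q hu0 t k
  have hgb : ∀ ℓ, |partsSeq q u k ℓ| ≤ C / (n : ℝ) ^ (2 * k + 1) := fun ℓ => by
    rcases Nat.lt_or_ge (4 * ℓ) n with hlt | hge
    · rw [partsSeq_eq_zero_of_const q hu1 k (by omega), abs_zero]; positivity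
    · rw [le_div_iff₀ (by positivity)]
      exact hg n hn ℓ hge
  set σ := √(1 - t ^ 2) with hσ
  have hσ1 : √(1 - t) ≤ σ := Real.sqrt_le_sqrt (by nlinarith)
  have hpos : 0 < √(1 - t) := Real.sqrt_pos.mpr (by linarith)
  have hσ2 : σ ^ (-ν) ≤ √(1 - t) ^ (-ν) :=
    Real.rpow_le_rpow_of_nonpos hpos hσ1 (by linarith)
  have hsum : ∑ ℓ ∈ range (n + 1), ((ℓ : ℝ) + 1) ^ ((((q + 2 * k : ℕ) : ℝ) - 1) / 2) ≤
      2 * (2 ^ ν * (n : ℝ) ^ ν) := by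
    refine (sum_range_rpow_le (q + 2 * k) (n + 1)).trans ?_
    rw [e1, ← Real.mul_rpow (by norm_num) hn0.le]
    have : (1 : ℝ) ≤ n := by exact_mod_cast hn
    gcongr
    push_cast; linarith
  rw [hz]
  refine (abs_sum_le_sum_abs _ _).trans ?_
  calc _ ≤ ∑ ℓ ∈ range (n + 1), C / (n : ℝ) ^ (2 * k + 1) *
          (C' * ((ℓ : ℝ) + 1) ^ ((((q + 2 * k : ℕ) : ℝ) - 1) / 2) * σ ^ (-ν)) := by
        refine sum_le_sum fun ℓ _ => ?_
        rw [abs_mul]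
        refine mul_le_mul (hgb ℓ) ?_ (abs_nonneg _) (by positivity)
        have := hL t htabs ℓ
        rwa [e1, show q + 2 * k + 1 = q + 1 + 2 * k by ring] at this
    _ = C / (n : ℝ) ^ (2 * k + 1) * C' * σ ^ (-ν) *
        ∑ ℓ ∈ range (n + 1), ((ℓ : ℝ) + 1) ^ ((((q + 2 * k : ℕ) : ℝ) - 1) / 2) := by
      rw [mul_sum]; exact sum_congr rfl fun ℓ _ => by ring
    _ ≤ C / (n : ℝ) ^ (2 * k + 1) * C' * √(1 - t) ^ (-ν) * (2 * (2 ^ ν * (n : ℝ) ^ ν)) := by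
      gcongr
    _ = C * C' * 2 * 2 ^ ν * ((n : ℝ) ^ ν / (n : ℝ) ^ (2 * k + 1)) * √(1 - t) ^ (-ν) := by ring
    _ = _ := by
      congr 2
      rw [← Real.rpow_natCast (n : ℝ) (2 * k + 1), ← Real.rpow_sub hn0, hν]
      congr 1; push_cast; ring

/-- Bound for the zonal sums for `t ∈ [0, 1)`. -/
theorem GoodH.abs_zonalSum_le_of_nonneg (q : ℕ) {S : ℕ} (hS : 1 ≤ S) {h : ℝ → ℝ}
    (hh : GoodH S h) : ∃ c : ℝ, 0 ≤ c ∧ ∀ n : ℕ, 1 ≤ n → ∀ t : ℝ, 0 ≤ t → t < 1 →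
      |zonalSum q h n t| ≤
        c * (n : ℝ) ^ q * ((n : ℝ) * √(1 - t)) ^ ((1 : ℝ) / 2 - (q : ℝ) / 2 - (S : ℝ)) := by
  obtain ⟨c, hc, hb⟩ := hh.abs_zonalSum_le_of_large q hS
  set ν : ℝ := ((q : ℝ) - 1) / 2 + (S : ℝ) with hν
  have hS' : (1 : ℝ) ≤ S := by exact_mod_cast hS
  have hν0 : 0 < ν := by rw [hν]; linarith [(Nat.cast_nonneg q : (0 : ℝ) ≤ q)]
  refine ⟨c + 2 * ((8 * S : ℕ) : ℝ) ^ (q + 1) * ((8 * S : ℕ) : ℝ) ^ ν, by positivity,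
    fun n hn t ht0 ht1 => ?_⟩
  have hn0 : (0 : ℝ) < n := by exact_mod_cast hn
  have hn1 : (1 : ℝ) ≤ n := by exact_mod_cast hn
  have hpos : 0 < √(1 - t) := Real.sqrt_pos.mpr (by linarith)
  have he : (1 : ℝ) / 2 - (q : ℝ) / 2 - (S : ℝ) = -ν := by rw [hν]; ring
  have hR : (0 : ℝ) ≤ ((n : ℝ) * √(1 - t)) ^ (-ν) := by positivity
  rw [he]
  rcases Nat.lt_or_ge n (8 * S) with hlt | hge
  · have h1 := abs_zonalSum_le q hh n (t := t) (by rw [abs_of_nonneg ht0]; exact ht1.le)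
    have hle : (n : ℝ) + 1 ≤ ((8 * S : ℕ) : ℝ) := by exact_mod_cast hlt
    have hM : (0 : ℝ) < ((8 * S : ℕ) : ℝ) := by linarith
    have h2 : ((8 * S : ℕ) : ℝ) ^ (-ν) ≤ ((n : ℝ) * √(1 - t)) ^ (-ν) := by
      refine Real.rpow_le_rpow_of_nonpos (by positivity) ?_ (by linarith)
      have : √(1 - t) ≤ 1 := Real.sqrt_le_one.mpr (by linarith)
      nlinarith
    have h3 : ((8 * S : ℕ) : ℝ) ^ ν * ((8 * S : ℕ) : ℝ) ^ (-ν) = 1 := by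
      rw [← Real.rpow_add hM, add_neg_cancel, Real.rpow_zero]
    have h4 : (1 : ℝ) ≤ (n : ℝ) ^ q := one_le_pow₀ hn1
    calc _ ≤ 2 * ((8 * S : ℕ) : ℝ) ^ (q + 1) * 1 := by
          rw [mul_one]
          refine h1.trans ?_
          gcongr
      _ = 2 * ((8 * S : ℕ) : ℝ) ^ (q + 1) * ((8 * S : ℕ) : ℝ) ^ ν * 1 * ((8 * S : ℕ) : ℝ) ^ (-ν) := by
        linear_combination (-2 * ((8 * S : ℕ) : ℝ) ^ (q + 1)) * h3
      _ ≤ 2 * ((8 * S : ℕ) : ℝ) ^ (q + 1) * ((8 * S : ℕ) : ℝ) ^ ν * (n : ℝ) ^ q *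
          ((n : ℝ) * √(1 - t)) ^ (-ν) := by gcongr
      _ ≤ _ := by
        gcongr
        linarith
  · refine (hb n hn hge t ht0 ht1).trans ?_
    rw [Real.mul_rpow hn0.le hpos.le]
    have e : (n : ℝ) ^ (((q : ℝ) + 1) / 2 - S) = (n : ℝ) ^ q * (n : ℝ) ^ (-ν) := by
      rw [← Real.rpow_natCast (n : ℝ) q, ← Real.rpow_add hn0]
      congr 1; rw [hν]; ring
    rw [e]
    calc _ = c * (n : ℝ) ^ q * ((n : ℝ) ^ (-ν) * √(1 - t) ^ (-ν)) := by ring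
      _ ≤ _ := by
        gcongr
        have : (0 : ℝ) ≤ 2 * ((8 * S : ℕ) : ℝ) ^ (q + 1) * ((8 * S : ℕ) : ℝ) ^ ν := by positivity
        linarith

end ZonalSums

section NegativeArguments

lemma coeffPair_X_pow_mul {N : ℕ} {f : ℕ → ℝ} (hf : ∀ m, N ≤ m → f m = 0) (G : PowerSeries ℝ)
    (M : ℕ) : coeffPair N f (PowerSeries.X ^ M * G) = coeffPair N (fun m => f (m + M)) G := by
  induction M generalizing f with
  | zero => simp
  | succ M ih =>
    rw [pow_succ', mul_assoc, coeffPair_X_mul hf, ih (fun m hm => hf (m + 1) (by omega))]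
    simp only [add_assoc, add_comm M 1]

lemma coeffPair_one_sub_X_pow_mul {N : ℕ} {f : ℕ → ℝ} (hf : ∀ m, N ≤ m → f m = 0)
    (G : PowerSeries ℝ) (k : ℕ) :
    coeffPair N f ((1 - PowerSeries.X) ^ k * G) = coeffPair N (seqDiff^[k] f) G := by
  induction k generalizing f with
  | zero => simp
  | succ k ih =>
    rw [pow_succ', mul_assoc, coeffPair_one_sub_X_mul hf, ih, Function.iterate_succ_apply]
    intro m hm
    rw [seqDiff, hf m hm, hf (m + 1) (by omega), sub_zero]

lemma abs_coeffPair_le {N : ℕ} {w : ℕ → ℝ} {G : PowerSeries ℝ} {B W : ℝ}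
    (hw : ∑ m ∈ range N, |w m| ≤ W) (hB : 0 ≤ B)
    (hG : ∀ m < N, w m ≠ 0 → |PowerSeries.coeff m G| ≤ B) : |coeffPair N w G| ≤ W * B := by
  refine (abs_sum_le_sum_abs _ _).trans ?_
  calc _ ≤ ∑ m ∈ range N, |w m| * B := by
        refine sum_le_sum fun m hm => ?_
        rw [abs_mul]
        by_cases h0 : w m = 0
        · simp [h0]
        · exact mul_le_mul_of_nonneg_left (hG m (mem_range.mp hm) h0) (abs_nonneg _)
    _ = (∑ m ∈ range N, |w m|) * B := (sum_mul _ _ _).symm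
    _ ≤ _ := by gcongr

lemma seqDiff_iterate_shift (f : ℕ → ℝ) (M k m : ℕ) :
    seqDiff^[k] (fun m => f (m + M)) m = seqDiff^[k] f (m + M) := by
  induction k generalizing m with
  | zero => rfl
  | succ k ih =>
    simp only [Function.iterate_succ_apply', seqDiff, ih]
    rw [add_right_comm]

lemma seqDiff_iterate_eq_zero_of_const {f : ℕ → ℝ} {N : ℕ} (hf : ∀ m, 2 * m ≤ N → f m = 1)
    (k : ℕ) {m : ℕ} (hm : 2 * (m + k + 1) ≤ N) : seqDiff^[k + 1] f m = 0 := by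
  induction k generalizing m with
  | zero => simp only [zero_add, Function.iterate_one, seqDiff]
            rw [hf m (by omega), hf (m + 1) (by omega), sub_self]
  | succ k ih =>
    rw [Function.iterate_succ_apply', seqDiff, ih (by omega), ih (by omega), sub_zero]

/-- The samples `h((m - M)/n)`, extended by `h(0)` for `m < M`. -/
def shiftSample (h : ℝ → ℝ) (M n m : ℕ) : ℝ := h (((m - M : ℕ) : ℝ) / n)

lemma shiftSample_add (h : ℝ → ℝ) (M n m : ℕ) :
    shiftSample h M n (m + M) = h ((m : ℝ) / n) := by
  rw [shiftSample, Nat.add_sub_cancel]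

lemma GoodH.shiftSample_eq_zero {S : ℕ} {h : ℝ → ℝ} (hh : GoodH S h) (M : ℕ) {n : ℕ} (hn : 1 ≤ n)
    {m : ℕ} (hm : n + M + 1 ≤ m) : shiftSample h M n m = 0 :=
  hh.sample_eq_zero hn (by omega)

lemma GoodH.shiftSample_eq_one {S : ℕ} {h : ℝ → ℝ} (hh : GoodH S h) (M : ℕ) {n : ℕ} (hn : 1 ≤ n)
    {m : ℕ} (hm : 2 * m ≤ n + 2 * M) : shiftSample h M n m = 1 := by
  refine hh.1 _ (by positivity) ?_
  have h1 : (0 : ℝ) < n := by exact_mod_cast hn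
  have : 2 * ((m - M : ℕ) : ℝ) ≤ n := by exact_mod_cast (by omega : 2 * (m - M) ≤ n)
  rw [div_le_iff₀ h1]; linarith

lemma GoodH.shiftSample_antitone {S : ℕ} {h : ℝ → ℝ} (hh : GoodH S h) (M n : ℕ) (m : ℕ) :
    shiftSample h M n (m + 1) ≤ shiftSample h M n m := by
  refine hh.2.2.1 _ _ (by positivity) ?_
  gcongr
  omega

lemma add_le_mul_of_one_le (n K : ℕ) (hn : 1 ≤ n) : (n : ℝ) + K ≤ (K + 1) * n := by
  have : (1 : ℝ) ≤ n := by exact_mod_cast hn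
  nlinarith [(Nat.cast_nonneg K : (0 : ℝ) ≤ K)]

lemma GoodH.abs_coeffPair_shiftSample_le_of_many {S : ℕ} {h : ℝ → ℝ} (hh : GoodH S h)
    (M q : ℕ) {G : ℝ → PowerSeries ℝ} (hG : CoeffGrowth 0 q G) :
    ∃ C : ℝ, 0 ≤ C ∧ ∀ n : ℕ, 1 ≤ n → 2 * S ≤ n → ∀ t : ℝ, |t| ≤ 1 →
      |coeffPair (n + M + 1) (shiftSample h M n) ((1 - PowerSeries.X) ^ (S + 1) * G t)| ≤
        C * ((n : ℝ) ^ q / (n : ℝ) ^ S) := by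
  obtain ⟨V, hV, hs⟩ := hh.sum_abs_seqDiff_le
  obtain ⟨C, hC, hG⟩ := hG
  refine ⟨V * (C * ((M + 1 : ℕ) + 1) ^ q), by positivity, fun n hn hnS t ht => ?_⟩
  have h1 : (0 : ℝ) < n := by exact_mod_cast hn
  rw [coeffPair_one_sub_X_pow_mul (fun m hm => hh.shiftSample_eq_zero M hn hm)]
  have hw : ∑ m ∈ range (n + M + 1), |seqDiff^[S + 1] (shiftSample h M n) m| ≤
      V / (n : ℝ) ^ S := by
    rw [show n + M + 1 = M + (n + 1) by ring, sum_range_add]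
    have z : ∑ m ∈ range M, |seqDiff^[S + 1] (shiftSample h M n) m| = 0 :=
      sum_eq_zero fun m hm => by
        have := mem_range.mp hm
        rw [seqDiff_iterate_eq_zero_of_const (N := n + 2 * M)
          (fun m hm => hh.shiftSample_eq_one M hn hm) S (by omega), abs_zero]
    rw [z, zero_add, le_div_iff₀ (by positivity)]
    refine le_trans (le_of_eq ?_) (hs n hn (n + 1))
    congr 1
    refine sum_congr rfl fun m _ => ?_
    rw [add_comm M m, ← seqDiff_iterate_shift]
    simp only [shiftSample_add]
  refine (abs_coeffPair_le hw (B := C * (((M + 1 : ℕ) + 1) * n) ^ q) (by positivity)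
    fun m hm _ => ?_).trans_eq ?_
  · have := hG t ht m
    rw [pow_zero, one_mul] at this
    refine this.trans ?_
    gcongr
    have h2 := add_le_mul_of_one_le n (M + 1) hn
    have h3 : (m : ℝ) + 1 ≤ ((n + (M + 1) : ℕ) : ℝ) := by exact_mod_cast (by omega)
    push_cast at h2 h3 ⊢
    linarith
  · rw [mul_pow]; ring

lemma GoodH.abs_coeffPair_shiftSample_le_of_one {S : ℕ} {h : ℝ → ℝ} (hh : GoodH S h)
    (M q : ℕ) {G : ℝ → PowerSeries ℝ} (hG : CoeffGrowth S q G) :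
    ∃ C : ℝ, 0 ≤ C ∧ ∀ n : ℕ, 1 ≤ n → ∀ t : ℝ, |t| ≤ 1 →
      |coeffPair (n + M + 1) (shiftSample h M n) ((1 - PowerSeries.X) * G t)| ≤
        C * ((n : ℝ) ^ q / (n : ℝ) ^ S) := by
  obtain ⟨C, hC, hG⟩ := hG
  refine ⟨2 ^ S * (C * ((M + 1 : ℕ) + 1) ^ q), by positivity, fun n hn t ht => ?_⟩
  have h1 : (0 : ℝ) < n := by exact_mod_cast hn
  rw [coeffPair_one_sub_X_mul (fun m hm => hh.shiftSample_eq_zero M hn hm)]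
  have hw : ∑ m ∈ range (n + M + 1), |seqDiff (shiftSample h M n) m| ≤ 1 := by
    have e : ∀ m, |seqDiff (shiftSample h M n) m| =
        shiftSample h M n m - shiftSample h M n (m + 1) := fun m =>
      abs_of_nonneg (sub_nonneg.mpr (hh.shiftSample_antitone M n m))
    simp only [e]
    rw [sum_range_sub', hh.shiftSample_eq_one M hn (by omega), hh.shiftSample_eq_zero M hn le_rfl]
    norm_num
  refine (abs_coeffPair_le hw (B := 2 ^ S * (C * (((M + 1 : ℕ) + 1) * n) ^ q) / (n : ℝ) ^ S)
    (by positivity) fun m hm hm0 => ?_).trans_eq ?_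
  · have hmn : n ≤ 2 * (m + 1) := by
      by_contra hcon
      refine hm0 ?_
      rw [seqDiff, hh.shiftSample_eq_one M hn (by omega), hh.shiftSample_eq_one M hn (by omega),
        sub_self]
    have hmn' : (n : ℝ) ≤ 2 * ((m : ℝ) + 1) := by exact_mod_cast hmn
    have h2 := add_le_mul_of_one_le n (M + 1) hn
    have h3 : (m : ℝ) + 1 ≤ ((n + (M + 1) : ℕ) : ℝ) := by exact_mod_cast (by omega)
    rw [le_div_iff₀ (by positivity), mul_comm]
    calc _ ≤ (2 * ((m : ℝ) + 1)) ^ S * |PowerSeries.coeff m (G t)| := by gcongr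
      _ = 2 ^ S * (((m : ℝ) + 1) ^ S * |PowerSeries.coeff m (G t)|) := by rw [mul_pow]; ring
      _ ≤ 2 ^ S * (C * ((m : ℝ) + 1) ^ q) := by gcongr 2 ^ S * ?_; exact hG t ht m
      _ ≤ _ := by
        gcongr
        push_cast at h2 h3 ⊢
        linarith
  · rw [mul_pow]; ring

lemma GoodH.abs_coeffPair_shiftSample_le {S : ℕ} {h : ℝ → ℝ} (hh : GoodH S h) (q b : ℕ) :
    ∃ C : ℝ, 0 ≤ C ∧ ∀ n : ℕ, 1 ≤ n → 2 * S ≤ n → ∀ t : ℝ, |t| ≤ 1 →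
      |coeffPair (n + 2 * S + 1) (shiftSample h (2 * S) n)
        (((1 - PowerSeries.X) ^ 2) ^ b * quadS t 1 ^ (2 * S - b) *
          ((1 - PowerSeries.X ^ 2) * legS t 1 ^ (q + 1)))| ≤
        C * ((n : ℝ) ^ q / (n : ℝ) ^ S) := by
  have hV := (coeffGrowth_quadS_pow_mul q (2 * S - b)).one_add_X_mul
  rcases Nat.lt_or_ge (2 * b) S with hb | hb
  · obtain ⟨C, hC, hbd⟩ := hh.abs_coeffPair_shiftSample_le_of_one (2 * S) q
      ((hV.one_sub_X_pow_mul (2 * b)).anti (by omega : S ≤ 2 * S - b))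
    refine ⟨C, hC, fun n hn _ t ht => ?_⟩
    convert hbd n hn t ht using 3
    rw [← pow_mul]
    ring
  · obtain ⟨r, hr⟩ : ∃ r, 2 * b = S + r := ⟨2 * b - S, by omega⟩
    obtain ⟨C, hC, hbd⟩ := hh.abs_coeffPair_shiftSample_le_of_many (2 * S) q
      ((hV.one_sub_X_pow_mul r).anti (Nat.zero_le _))
    refine ⟨C, hC, fun n hn hnS t ht => ?_⟩
    convert hbd n hn hnS t ht using 3
    rw [← pow_mul, hr]
    ring

lemma coeffPair_sum (N : ℕ) (f : ℕ → ℝ) {ι : Type*} (s : Finset ι) (a : ι → ℝ)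
    (G : ι → PowerSeries ℝ) :
    coeffPair N f (∑ i ∈ s, PowerSeries.C (a i) * G i) = ∑ i ∈ s, a i * coeffPair N f (G i) := by
  simp only [coeffPair, map_sum, PowerSeries.coeff_C_mul, mul_sum]
  rw [sum_comm]
  exact sum_congr rfl fun i _ => sum_congr rfl fun m _ => by ring

lemma pow_mul_zonalSum_eq (q : ℕ) {S : ℕ} {h : ℝ → ℝ} (hh : GoodH S h) (M : ℕ) {n : ℕ}
    (hn : 1 ≤ n) (t : ℝ) :
    (2 * (1 - t)) ^ M * zonalSum q h n t = ∑ b ∈ range (M + 1), ((-1) ^ b * (M.choose b : ℝ)) *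
      coeffPair (n + M + 1) (shiftSample h M n) (((1 - PowerSeries.X) ^ 2) ^ b *
        quadS t 1 ^ (M - b) * ((1 - PowerSeries.X ^ 2) * legS t 1 ^ (q + 1))) := by
  rw [← coeffPair_sum]
  have e1 : PowerSeries.C (2 * (1 - t)) * PowerSeries.X =
      -(1 - PowerSeries.X) ^ 2 + quadS t 1 := by
    simp only [quadS, map_mul, map_sub, map_one, map_ofNat]; ring
  have e2 := congrArg (fun P => P ^ M * ((1 - PowerSeries.X ^ 2) * legS t 1 ^ (q + 1))) e1
  simp only [add_pow, sum_mul, mul_pow] at e2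
  have e3 : ∑ b ∈ range (M + 1), PowerSeries.C ((-1) ^ b * (M.choose b : ℝ)) *
      (((1 - PowerSeries.X) ^ 2) ^ b *
        quadS t 1 ^ (M - b) * ((1 - PowerSeries.X ^ 2) * legS t 1 ^ (q + 1))) =
      PowerSeries.C ((2 * (1 - t)) ^ M) *
        (PowerSeries.X ^ M * ((1 - PowerSeries.X ^ 2) * legS t 1 ^ (q + 1))) := by
    rw [map_pow, ← mul_assoc, e2]
    refine sum_congr rfl fun b _ => ?_
    rw [map_mul, map_pow, map_neg, map_one, map_natCast, neg_pow ((1 - PowerSeries.X) ^ 2)]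
    ring
  have e4 : ∀ G : PowerSeries ℝ, coeffPair (n + M + 1) (shiftSample h M n)
      (PowerSeries.C ((2 * (1 - t)) ^ M) * G) = (2 * (1 - t)) ^ M *
        coeffPair (n + M + 1) (shiftSample h M n) G := fun G => by
    simp only [coeffPair, PowerSeries.coeff_C_mul, mul_sum]
    exact sum_congr rfl fun m _ => by ring
  rw [e3, e4, coeffPair_X_pow_mul (fun m hm => hh.shiftSample_eq_zero M hn hm)]
  simp only [shiftSample_add]
  congr 1
  rw [zonalSum, coeffPair]
  refine sum_subset (range_subset_range.mpr (by omega)) fun m _ hm => ?_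
  rw [hh.sample_eq_zero hn (by simpa using hm), zero_mul]

/-- Bound for the zonal sums for `t ∈ [-1, 0)`. -/
theorem GoodH.abs_zonalSum_le_of_neg (q : ℕ) {S : ℕ} {h : ℝ → ℝ} (hh : GoodH S h) :
    ∃ c : ℝ, 0 ≤ c ∧ ∀ n : ℕ, 1 ≤ n → ∀ t : ℝ, -1 ≤ t → t < 0 →
      |zonalSum q h n t| ≤ c * (n : ℝ) ^ ((q : ℝ) - (S : ℝ)) := by
  choose C hC hb using fun b => hh.abs_coeffPair_shiftSample_le q b
  refine ⟨∑ b ∈ range (2 * S + 1), ((2 * S).choose b : ℝ) * C b +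
    2 * (2 * (S : ℝ)) ^ (q + 1) * (2 * (S : ℝ)) ^ S,
    add_nonneg (sum_nonneg fun b _ => mul_nonneg (by positivity) (hC b)) (by positivity),
    fun n hn t ht0 ht1 => ?_⟩
  have h0 : 0 ≤ ∑ b ∈ range (2 * S + 1), ((2 * S).choose b : ℝ) * C b :=
    sum_nonneg fun b _ => mul_nonneg (by positivity) (hC b)
  have hn0 : (0 : ℝ) < n := by exact_mod_cast hn
  have hn1 : (1 : ℝ) ≤ n := by exact_mod_cast hn
  have htabs : |t| ≤ 1 := abs_le.mpr ⟨ht0, by linarith⟩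
  rw [Real.rpow_sub hn0, Real.rpow_natCast, Real.rpow_natCast]
  rcases Nat.lt_or_ge n (2 * S) with hlt | hge
  · have h1 := abs_zonalSum_le q hh n htabs
    have hle : (n : ℝ) + 1 ≤ 2 * (S : ℝ) := by exact_mod_cast hlt
    have h2 : 1 ≤ (2 * (S : ℝ)) ^ S * ((n : ℝ) ^ q / (n : ℝ) ^ S) := by
      rw [← mul_div_assoc, le_div_iff₀ (by positivity), one_mul]
      calc (n : ℝ) ^ S ≤ (2 * (S : ℝ)) ^ S * 1 := by rw [mul_one]; gcongr; linarith
        _ ≤ _ := by gcongr; exact one_le_pow₀ hn1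
    calc _ ≤ 2 * (2 * (S : ℝ)) ^ (q + 1) * 1 := by
          rw [mul_one]; refine h1.trans ?_; gcongr
      _ ≤ 2 * (2 * (S : ℝ)) ^ (q + 1) * ((2 * (S : ℝ)) ^ S * ((n : ℝ) ^ q / (n : ℝ) ^ S)) := by
        gcongr
      _ = (2 * (2 * (S : ℝ)) ^ (q + 1) * (2 * (S : ℝ)) ^ S) * ((n : ℝ) ^ q / (n : ℝ) ^ S) := by ring
      _ ≤ _ := by gcongr; linarith
  · have e := congrArg abs (pow_mul_zonalSum_eq q hh (2 * S) hn t)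
    rw [abs_mul] at e
    have hp : 1 ≤ |(2 * (1 - t)) ^ (2 * S)| := by
      rw [abs_of_nonneg (by have : 0 < 1 - t := by linarith
                            positivity)]
      exact one_le_pow₀ (by linarith)
    calc |zonalSum q h n t| ≤ |(2 * (1 - t)) ^ (2 * S)| * |zonalSum q h n t| :=
          le_mul_of_one_le_left (abs_nonneg _) hp
      _ ≤ _ := e.le
      _ ≤ ∑ b ∈ range (2 * S + 1), ((2 * S).choose b : ℝ) * (C b * ((n : ℝ) ^ q / (n : ℝ) ^ S)) := by
        refine (abs_sum_le_sum_abs _ _).trans (sum_le_sum fun b _ => ?_)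
        rw [abs_mul, abs_mul, abs_pow, abs_neg, abs_one, one_pow, one_mul, Nat.abs_cast]
        exact mul_le_mul_of_nonneg_left (hb b n hn hge t htabs) (by positivity)
      _ = (∑ b ∈ range (2 * S + 1), ((2 * S).choose b : ℝ) * C b) *
          ((n : ℝ) ^ q / (n : ℝ) ^ S) := by
        rw [sum_mul]; exact sum_congr rfl fun b _ => by ring
      _ ≤ _ := by
        gcongr
        have : 0 ≤ 2 * (2 * (S : ℝ)) ^ (q + 1) * (2 * (S : ℝ)) ^ S := by positivity
        linarith

end NegativeArguments

section ZonalHarmonics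

/-- Real polynomials in `q + 1` variables. -/
abbrev RPoly (q : ℕ) := MvPolynomial (Fin (q + 1)) ℝ

/-- The linear form `x ↦ ⟨a, x⟩`. -/
def linForm {q : ℕ} (a : Fin (q + 1) → ℝ) : RPoly q := ∑ i, MvPolynomial.C (a i) * MvPolynomial.X i

/-- The quadratic form `x ↦ |x|²`. -/
def sqForm (q : ℕ) : RPoly q := ∑ i, MvPolynomial.X i ^ 2

/-- The Laplacian of a polynomial. -/
def lap {q : ℕ} (P : RPoly q) : RPoly q := ∑ i, MvPolynomial.pderiv i (MvPolynomial.pderiv i P)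

lemma linForm_isHomogeneous {q : ℕ} (a : Fin (q + 1) → ℝ) : (linForm a).IsHomogeneous 1 :=
  MvPolynomial.IsHomogeneous.sum _ _ _ fun _ _ => MvPolynomial.isHomogeneous_C_mul_X _ _

lemma sqForm_isHomogeneous (q : ℕ) : (sqForm q).IsHomogeneous 2 :=
  MvPolynomial.IsHomogeneous.sum _ _ _ fun _ _ => MvPolynomial.isHomogeneous_X_pow _ _

lemma pderiv_linForm {q : ℕ} (a : Fin (q + 1) → ℝ) (i : Fin (q + 1)) :
    MvPolynomial.pderiv i (linForm a) = MvPolynomial.C (a i) := by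
  simp [linForm, Derivation.leibniz, MvPolynomial.pderiv_X, Pi.single_apply]

lemma pderiv_sqForm {q : ℕ} (i : Fin (q + 1)) :
    MvPolynomial.pderiv i (sqForm q) = 2 * MvPolynomial.X i := by
  simp [sqForm, Derivation.leibniz_pow, MvPolynomial.pderiv_X, Pi.single_apply]

/-- Differentiation of the coefficients of a power series with respect to a variable. -/
def coeffDeriv {q : ℕ} (i : Fin (q + 1)) :
    Derivation ℝ (PowerSeries (RPoly q)) (PowerSeries (RPoly q)) :=
  Derivation.mk'
    { toFun := fun f => PowerSeries.mk fun n => MvPolynomial.pderiv i (PowerSeries.coeff n f)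
      map_add' := fun f g => by ext1 n; simp
      map_smul' := fun c f => by
        ext1 n
        simp }
    (fun f g => by
      ext1 n
      simp only [LinearMap.coe_mk, AddHom.coe_mk, PowerSeries.coeff_mk, smul_eq_mul, map_add,
        PowerSeries.coeff_mul, map_sum, Derivation.leibniz, sum_add_distrib]
      congr 1
      rw [← Finset.Nat.sum_antidiagonal_swap]
      rfl)

lemma coeff_coeffDeriv {q : ℕ} (i : Fin (q + 1)) (f : PowerSeries (RPoly q)) (n : ℕ) :
    PowerSeries.coeff n (coeffDeriv i f) = MvPolynomial.pderiv i (PowerSeries.coeff n f) := by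
  simp [coeffDeriv]

lemma coeffDeriv_C {q : ℕ} (i : Fin (q + 1)) (P : RPoly q) :
    coeffDeriv i (PowerSeries.C P) = PowerSeries.C (MvPolynomial.pderiv i P) := by
  ext1 n
  rw [coeff_coeffDeriv, PowerSeries.coeff_C, PowerSeries.coeff_C]
  split_ifs <;> simp

lemma coeffDeriv_X {q : ℕ} (i : Fin (q + 1)) :
    coeffDeriv i (PowerSeries.X : PowerSeries (RPoly q)) = 0 := by
  ext1 n
  rw [coeff_coeffDeriv, PowerSeries.coeff_X]
  split_ifs <;> simp

/-- The power series `a i X - x i X²`. -/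
def gradS {q : ℕ} (a : Fin (q + 1) → ℝ) (i : Fin (q + 1)) : PowerSeries (RPoly q) :=
  PowerSeries.C (MvPolynomial.C (a i)) * PowerSeries.X
    - PowerSeries.C (MvPolynomial.X i) * PowerSeries.X ^ 2

lemma coeffDeriv_two {q : ℕ} (i : Fin (q + 1)) :
    coeffDeriv i (2 : PowerSeries (RPoly q)) = 0 := by
  simpa using (coeffDeriv i).map_natCast 2

lemma coeffDeriv_quadS {q : ℕ} (a : Fin (q + 1) → ℝ) (i : Fin (q + 1)) :
    coeffDeriv i (quadS (linForm a) (sqForm q)) = -2 * gradS a i := by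
  simp only [quadS, gradS, map_add, map_sub, Derivation.leibniz, Derivation.leibniz_pow,
    Derivation.map_one_eq_zero, smul_eq_mul, coeffDeriv_C, coeffDeriv_X, coeffDeriv_two,
    pderiv_linForm, pderiv_sqForm, map_mul, map_ofNat]
  simp
  ring

lemma coeffDeriv_legS {q : ℕ} (a : Fin (q + 1) → ℝ) (i : Fin (q + 1)) :
    coeffDeriv i (legS (linForm a) (sqForm q)) =
      legS (linForm a) (sqForm q) ^ 3 * gradS a i := by
  have h := legS_sq_mul_quadS (linForm a) (sqForm q)
  have h' := congrArg (coeffDeriv i) h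
  rw [Derivation.leibniz, Derivation.leibniz_pow, Derivation.map_one_eq_zero,
    coeffDeriv_quadS] at h'
  simp only [smul_eq_mul, nsmul_eq_mul] at h'
  push_cast at h'
  have : (2 : PowerSeries (RPoly q)) ≠ 0 := fun h0 => by
    have h1 := congrArg PowerSeries.constantCoeff h0
    rw [map_ofNat, map_zero] at h1
    exact two_ne_zero h1
  apply mul_left_cancel₀ this
  linear_combination legS (linForm a) (sqForm q) * h'
    - 2 * coeffDeriv i (legS (linForm a) (sqForm q)) * h

lemma coeffDeriv_legS_pow {q : ℕ} (a : Fin (q + 1) → ℝ) (i : Fin (q + 1)) (m : ℕ) :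
    coeffDeriv i (legS (linForm a) (sqForm q) ^ m) =
      (m : PowerSeries (RPoly q)) * legS (linForm a) (sqForm q) ^ (m + 2) * gradS a i := by
  rcases m with _ | m
  · simp
  · rw [Derivation.leibniz_pow, coeffDeriv_legS]
    simp only [smul_eq_mul, nsmul_eq_mul, Nat.add_sub_cancel]
    ring

lemma coeffDeriv_gradS {q : ℕ} (a : Fin (q + 1) → ℝ) (i : Fin (q + 1)) :
    coeffDeriv i (gradS a i) = -PowerSeries.X ^ 2 := by
  simp only [gradS, map_sub, Derivation.leibniz, Derivation.leibniz_pow, smul_eq_mul,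
    coeffDeriv_C, coeffDeriv_X, MvPolynomial.pderiv_C, MvPolynomial.pderiv_X]
  simp

lemma sum_X_mul_gradS {q : ℕ} (a : Fin (q + 1) → ℝ) :
    ∑ i, PowerSeries.C (MvPolynomial.X i) * gradS a i =
      PowerSeries.C (linForm a) * PowerSeries.X - PowerSeries.C (sqForm q) * PowerSeries.X ^ 2 := by
  simp only [linForm, sqForm, gradS, map_sum, sum_mul, ← sum_sub_distrib]
  refine sum_congr rfl fun i _ => ?_
  simp only [map_mul, map_pow]
  ring

lemma sum_gradS_sq {q : ℕ} {a : Fin (q + 1) → ℝ} (ha : ∑ i, a i ^ 2 = 1) :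
    ∑ i, gradS a i ^ 2 = PowerSeries.X ^ 2 * quadS (linForm a) (sqForm q) := by
  have h1 : ∑ i, gradS a i ^ 2 =
      PowerSeries.C (MvPolynomial.C (∑ i, a i ^ 2)) * PowerSeries.X ^ 2
        - 2 * PowerSeries.C (linForm a) * PowerSeries.X ^ 3
        + PowerSeries.C (sqForm q) * PowerSeries.X ^ 4 := by
    simp only [linForm, sqForm, gradS, map_sum, sum_mul, mul_sum, ← sum_sub_distrib,
      ← sum_add_distrib]
    refine sum_congr rfl fun i _ => ?_
    simp only [map_mul, map_pow]
    ring
  rw [h1, ha, quadS]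
  simp only [map_one]
  ring

/-- The generating function of the zonal harmonics with pole `a`. -/
def zonalS {q : ℕ} (a : Fin (q + 1) → ℝ) : PowerSeries (RPoly q) :=
  (1 - PowerSeries.C (sqForm q) * PowerSeries.X ^ 2) * legS (linForm a) (sqForm q) ^ (q + 1)

lemma sum_coeffDeriv_zonalS {q : ℕ} {a : Fin (q + 1) → ℝ} (ha : ∑ i, a i ^ 2 = 1) :
    ∑ i, coeffDeriv i (coeffDeriv i (zonalS a)) = 0 := by
  set L := legS (linForm a) (sqForm q) with hL
  set T : PowerSeries (RPoly q) := PowerSeries.X with hT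
  set s := PowerSeries.C (sqForm q) with hs
  have h1 : ∀ i, coeffDeriv i (coeffDeriv i (zonalS a)) =
      -2 * T ^ 2 * L ^ (q + 1)
      - 4 * ((q + 1 : ℕ) : PowerSeries (RPoly q)) * T ^ 2 * L ^ (q + 3) *
        (PowerSeries.C (MvPolynomial.X i) * gradS a i)
      + (1 - s * T ^ 2) * ((q + 1 : ℕ) : PowerSeries (RPoly q)) *
        ((q + 3 : ℕ) : PowerSeries (RPoly q)) * L ^ (q + 5) * gradS a i ^ 2
      - (1 - s * T ^ 2) * ((q + 1 : ℕ) : PowerSeries (RPoly q)) * L ^ (q + 3) * T ^ 2 := by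
    intro i
    have hds : coeffDeriv i s = 2 * PowerSeries.C (MvPolynomial.X i) := by
      rw [hs, coeffDeriv_C, pderiv_sqForm, map_mul, map_ofNat]
    have hdx : coeffDeriv i (PowerSeries.C (MvPolynomial.X i : RPoly q)) = 1 := by
      rw [coeffDeriv_C, MvPolynomial.pderiv_X_self, map_one]
    have hdT : coeffDeriv i (T ^ 2) = 0 := by
      rw [Derivation.leibniz_pow, hT, coeffDeriv_X]
      simp
    have hdL : ∀ m : ℕ, coeffDeriv i (L ^ m) =
        (m : PowerSeries (RPoly q)) * L ^ (m + 2) * gradS a i := coeffDeriv_legS_pow a i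
    have hdg : coeffDeriv i (gradS a i) = -T ^ 2 := coeffDeriv_gradS a i
    have hd1 : coeffDeriv i (zonalS a) =
        -(2 * PowerSeries.C (MvPolynomial.X i) * T ^ 2 * L ^ (q + 1)) +
        (1 - s * T ^ 2) * (((q + 1 : ℕ) : PowerSeries (RPoly q)) * L ^ (q + 3) * gradS a i) := by
      rw [zonalS, Derivation.leibniz, hdL, map_sub, Derivation.leibniz, hdT, hds,
        Derivation.map_one_eq_zero]
      simp only [smul_eq_mul, mul_zero]
      ring
    rw [hd1]
    simp only [map_add, map_neg, map_sub, Derivation.leibniz, Derivation.map_natCast, hdx, hds,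
      hdT, hdL, hdg, coeffDeriv_two, Derivation.map_one_eq_zero, smul_eq_mul, mul_zero]
    ring
  rw [sum_congr rfl fun i _ => h1 i]
  simp only [sum_add_distrib, sum_sub_distrib, ← mul_sum, sum_X_mul_gradS, sum_gradS_sq ha,
    sum_const, card_univ, Fintype.card_fin, nsmul_eq_mul]
  have h := legS_sq_mul_quadS (linForm a) (sqForm q)
  rw [← hL] at h
  have e : quadS (linForm a) (sqForm q) = 1 - 2 * PowerSeries.C (linForm a) * T + s * T ^ 2 := rfl
  have h2 := h
  rw [e] at h2
  push_cast
  linear_combination ((1 - s * T ^ 2) * ((q : PowerSeries (RPoly q)) + 1) *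
    ((q : PowerSeries (RPoly q)) + 3) * L ^ (q + 3) * T ^ 2) * h +
    2 * ((q : PowerSeries (RPoly q)) + 1) * T ^ 2 * L ^ (q + 1) * h2

lemma lap_coeff_zonalS {q : ℕ} {a : Fin (q + 1) → ℝ} (ha : ∑ i, a i ^ 2 = 1) (n : ℕ) :
    lap (PowerSeries.coeff n (zonalS a)) = 0 := by
  have := congrArg (PowerSeries.coeff n) (sum_coeffDeriv_zonalS ha)
  simpa only [lap, map_sum, coeff_coeffDeriv, map_zero] using this

/-- The `n`-th coefficient is homogeneous of degree `n`. -/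
def GradedS {q : ℕ} (f : PowerSeries (RPoly q)) : Prop :=
  ∀ n, (PowerSeries.coeff n f).IsHomogeneous n

lemma GradedS.mul {q : ℕ} {f g : PowerSeries (RPoly q)} (hf : GradedS f) (hg : GradedS g) :
    GradedS (f * g) := fun n => by
  rw [PowerSeries.coeff_mul]
  refine MvPolynomial.IsHomogeneous.sum _ _ _ fun p hp => ?_
  rw [← mem_antidiagonal.mp hp]
  exact (hf _).mul (hg _)

lemma GradedS.one {q : ℕ} : GradedS (1 : PowerSeries (RPoly q)) := fun n => by
  rw [PowerSeries.coeff_one]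
  split_ifs with h
  · rw [h]; exact MvPolynomial.isHomogeneous_one _ _
  · exact MvPolynomial.isHomogeneous_zero _ _ _

lemma GradedS.pow {q : ℕ} {f : PowerSeries (RPoly q)} (hf : GradedS f) (m : ℕ) :
    GradedS (f ^ m) := by
  induction m with
  | zero => rw [pow_zero]; exact GradedS.one
  | succ m ih => rw [pow_succ]; exact ih.mul hf

lemma GradedS.C_mul_X_pow {q : ℕ} {P : RPoly q} {m : ℕ} (hP : P.IsHomogeneous m) :
    GradedS (PowerSeries.C P * PowerSeries.X ^ m) := fun n => by
  rw [PowerSeries.coeff_C_mul, PowerSeries.coeff_X_pow]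
  split_ifs with h
  · rw [h, mul_one]; exact hP
  · rw [mul_zero]; exact MvPolynomial.isHomogeneous_zero _ _ _

lemma isHomogeneous_smul {q n : ℕ} {P : RPoly q} (hP : P.IsHomogeneous n) (c : ℝ) :
    (c • P).IsHomogeneous n := by
  rw [MvPolynomial.smul_eq_C_mul]; exact hP.C_mul c

lemma gradedS_legS {q : ℕ} (a : Fin (q + 1) → ℝ) : GradedS (legS (linForm a) (sqForm q)) := by
  have key : ∀ n, (legCoeff (linForm a) (sqForm q) n).IsHomogeneous n ∧
      (legCoeff (linForm a) (sqForm q) (n + 1)).IsHomogeneous (n + 1) := by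
    intro n
    induction n with
    | zero => exact ⟨MvPolynomial.isHomogeneous_one _ _, linForm_isHomogeneous a⟩
    | succ n ih =>
      refine ⟨ih.2, ?_⟩
      rw [legCoeff]
      refine isHomogeneous_smul (MvPolynomial.IsHomogeneous.sub ?_ ?_) _
      · refine isHomogeneous_smul ?_ _
        have := (linForm_isHomogeneous a).mul ih.2
        rwa [add_comm 1] at this
      · refine isHomogeneous_smul ?_ _
        have := (sqForm_isHomogeneous q).mul ih.1
        rwa [add_comm 2] at this
  intro n
  rw [legS, PowerSeries.coeff_mk]
  exact (key n).1

lemma gradedS_zonalS {q : ℕ} (a : Fin (q + 1) → ℝ) : GradedS (zonalS a) := by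
  refine GradedS.mul (fun n => ?_) ((gradedS_legS a).pow _)
  rw [map_sub]
  exact (GradedS.one n).sub (GradedS.C_mul_X_pow (sqForm_isHomogeneous q) n)

lemma sum_sq_eq_one {q : ℕ} (x : Sph q) : ∑ i, (x : Euc q) i ^ 2 = 1 := by
  have hx : ‖(x : Euc q)‖ = 1 := mem_sphere_zero_iff_norm.mp x.2
  have := EuclideanSpace.norm_sq_eq (x : Euc q)
  rw [hx] at this
  simpa using this.symm

/-- Evaluation of a polynomial at a point of the sphere. -/
def sphEval {q : ℕ} (x : Sph q) : RPoly q →ₐ[ℝ] ℝ := MvPolynomial.aeval fun i => (x : Euc q) i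

lemma sphEval_X {q : ℕ} (x : Sph q) (i : Fin (q + 1)) :
    sphEval x (MvPolynomial.X i) = (x : Euc q) i := by simp [sphEval]

lemma sphEval_eq_eval {q : ℕ} (x : Sph q) (P : RPoly q) :
    sphEval x P = MvPolynomial.eval (fun i => (x : Euc q) i) P := by
  rw [sphEval, MvPolynomial.aeval_eq_eval]

lemma sphEval_sqForm {q : ℕ} (x : Sph q) : sphEval x (sqForm q) = 1 := by
  simp [sqForm, sphEval_X, sum_sq_eq_one]

lemma sphEval_linForm {q : ℕ} (x ξ : Sph q) :
    sphEval x (linForm fun i => (ξ : Euc q) i) = dot x ξ := by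
  simp [linForm, sphEval_X, dot, mul_comm]

lemma map_legS {A B : Type*} [CommRing A] [Algebra ℝ A] [CommRing B] [Algebra ℝ B]
    (φ : A →ₐ[ℝ] B) (τ s : A) :
    PowerSeries.map (φ : A →+* B) (legS τ s) = legS (φ τ) (φ s) := by
  ext n
  simp [legS, legCoeff_map]

lemma sphEval_coeff_zonalS {q : ℕ} (x ξ : Sph q) (n : ℕ) :
    sphEval x (PowerSeries.coeff n (zonalS fun i => (ξ : Euc q) i)) =
      PowerSeries.coeff n ((1 - PowerSeries.X ^ 2) * legS (dot x ξ) 1 ^ (q + 1)) := by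
  have h : PowerSeries.map (sphEval x : RPoly q →+* ℝ) (zonalS fun i => (ξ : Euc q) i) =
      (1 - PowerSeries.X ^ 2) * legS (dot x ξ) 1 ^ (q + 1) := by
    simp only [zonalS, map_mul, map_sub, map_one, map_pow, map_legS, PowerSeries.map_C,
      PowerSeries.map_X, RingHom.coe_coe, sphEval_sqForm, sphEval_linForm, one_mul]
  rw [← h, PowerSeries.coeff_map]
  rfl

end ZonalHarmonics

section SphereIntegral

lemma continuous_sphEval {q : ℕ} (P : RPoly q) : Continuous fun x : Sph q => sphEval x P := by
  simp only [sphEval_eq_eval]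
  exact (MvPolynomial.continuous_eval P).comp (by fun_prop)

lemma integral_rotate {q : ℕ} (μ : Measure (Sph q)) (hrot : RotInvariant q μ)
    (R : Euc q ≃ₗᵢ[ℝ] Euc q) {f : Sph q → ℝ} (hf : Continuous f) : ∫ x, f (rotate R x) ∂μ = ∫ x, f x ∂μ := by
  have hR : Continuous (rotate R) := by
    unfold rotate
    exact Continuous.subtype_mk (R.continuous.comp continuous_subtype_val) _
  have := integral_map (μ := μ) (φ := rotate R) hR.aemeasurable
    (f := f) hf.aestronglyMeasurable
  rw [hrot R] at this
  exact this.symm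

variable {q : ℕ} (μ : Measure (Sph q)) [IsProbabilityMeasure μ]

lemma integrable_of_continuous_sphere {f : Sph q → ℝ} (hf : Continuous f) : Integrable f μ :=
  hf.integrable_of_hasCompactSupport (HasCompactSupport.of_compactSpace f)

/-- Integration of polynomials over the sphere. -/
def sphInt : RPoly q →ₗ[ℝ] ℝ where
  toFun P := ∫ x, sphEval x P ∂μ
  map_add' P Q := by
    simp only [map_add]
    exact integral_add (integrable_of_continuous_sphere μ (continuous_sphEval P))
      (integrable_of_continuous_sphere μ (continuous_sphEval Q))
  map_smul' c P := by
    simp only [map_smul, smul_eq_mul, RingHom.id_apply]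
    exact integral_const_mul _ _

lemma sphInt_apply (P : RPoly q) : sphInt μ P = ∫ x, sphEval x P ∂μ := rfl

lemma sphInt_C_mul (c : ℝ) (P : RPoly q) : sphInt μ (MvPolynomial.C c * P) = c * sphInt μ P := by
  rw [← MvPolynomial.smul_eq_C_mul, map_smul, smul_eq_mul]

lemma sphInt_sqForm_mul (P : RPoly q) : sphInt μ (sqForm q * P) = sphInt μ P := by
  simp only [sphInt_apply, map_mul, sphEval_sqForm, one_mul]

lemma hasDerivAt_eval_mvPolynomial {σ : Type*} [Fintype σ] (P : MvPolynomial σ ℝ)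
    {c c' : ℝ → σ → ℝ} {t : ℝ} (hc : ∀ i, HasDerivAt (fun u => c u i) (c' t i) t) :
    HasDerivAt (fun u => MvPolynomial.eval (c u) P)
      (∑ i, c' t i * MvPolynomial.eval (c t) (MvPolynomial.pderiv i P)) t := by
  classical
  induction P using MvPolynomial.induction_on with
  | C r => simpa using hasDerivAt_const t r
  | add P Q hP hQ =>
    simp only [map_add, mul_add, sum_add_distrib]
    exact hP.add hQ
  | mul_X P j hP =>
    simp only [map_mul, MvPolynomial.eval_X, Derivation.leibniz, MvPolynomial.pderiv_X, smul_eq_mul,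
      map_add, mul_add, sum_add_distrib]
    refine (hP.mul (hc j)).congr_deriv ?_
    rw [add_comm, sum_mul]
    congr 1
    · rw [sum_eq_single j]
      · simp [mul_comm]
      · intro i _ hij
        simp [hij.symm]
      · simp
    · exact sum_congr rfl fun i _ => by ring

/-- The unit vector `cos φ e_i + sin φ e_j`. -/
def planeVec (i j : Fin (q + 1)) (φ : ℝ) : Euc q :=
  Real.cos φ • EuclideanSpace.single i 1 + Real.sin φ • EuclideanSpace.single j 1

/-- Coordinates of the reflection of `x` in the hyperplane orthogonal to `planeVec i j φ`. -/
def reflCoord (i j : Fin (q + 1)) (x : Sph q) (φ : ℝ) (k : Fin (q + 1)) : ℝ :=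
  (x : Euc q) k - 2 * (Real.cos φ * (x : Euc q) i + Real.sin φ * (x : Euc q) j) *
    planeVec i j φ k

lemma planeVec_apply (i j : Fin (q + 1)) (φ : ℝ) (k : Fin (q + 1)) :
    planeVec i j φ k =
      Real.cos φ * (if k = i then 1 else 0) + Real.sin φ * (if k = j then 1 else 0) := by
  simp [planeVec]

lemma norm_planeVec {i j : Fin (q + 1)} (hij : i ≠ j) (φ : ℝ) : ‖planeVec i j φ‖ = 1 := by
  have h : ‖planeVec i j φ‖ ^ 2 = 1 := by
    rw [EuclideanSpace.norm_sq_eq]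
    have : ∀ k, ‖planeVec i j φ k‖ ^ 2 = Real.cos φ ^ 2 * (if k = i then 1 else 0) +
        Real.sin φ ^ 2 * (if k = j then 1 else 0) := by
      intro k
      rw [planeVec_apply, Real.norm_eq_abs, sq_abs]
      by_cases h1 : k = i
      · have h2 : k ≠ j := fun h => hij (h1.symm.trans h)
        simp [h1, hij]
      · by_cases h2 : k = j
        · simp [h2, hij.symm]
        · simp [h1, h2]
    simp only [this, sum_add_distrib, ← mul_sum]
    simp
  have h0 := norm_nonneg (planeVec i j φ)
  nlinarith

lemma reflection_planeVec_apply {i j : Fin (q + 1)} (hij : i ≠ j) (x : Sph q) (φ : ℝ)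
    (k : Fin (q + 1)) :
    ((rotate (Submodule.reflection (ℝ ∙ planeVec i j φ)ᗮ) x : Sph q) : Euc q) k =
      reflCoord i j x φ k := by
  have hin : inner ℝ (planeVec i j φ) (x : Euc q) =
      Real.cos φ * (x : Euc q) i + Real.sin φ * (x : Euc q) j := by
    simp [planeVec, inner_add_left, inner_smul_left, EuclideanSpace.inner_single_left]
  simp only [rotate]
  rw [Submodule.reflection_orthogonal_apply, Submodule.reflection_singleton_apply,
    hin, norm_planeVec hij]
  simp [reflCoord]
  ring

/-- The derivative of `reflCoord`. -/
def reflCoordDeriv (i j : Fin (q + 1)) (x : Sph q) (φ : ℝ) (k : Fin (q + 1)) : ℝ :=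
  -(2 * (-Real.sin φ * (x : Euc q) i + Real.cos φ * (x : Euc q) j) * planeVec i j φ k +
    2 * (Real.cos φ * (x : Euc q) i + Real.sin φ * (x : Euc q) j) *
      (-Real.sin φ * (if k = i then 1 else 0) + Real.cos φ * (if k = j then 1 else 0)))

lemma hasDerivAt_reflCoord (i j : Fin (q + 1)) (x : Sph q) (φ : ℝ) (k : Fin (q + 1)) :
    HasDerivAt (fun u => reflCoord i j x u k) (reflCoordDeriv i j x φ k) φ := by
  simp only [reflCoord, planeVec_apply, reflCoordDeriv]
  have h1 := (((Real.hasDerivAt_cos φ).mul_const ((x : Euc q) i)).add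
    ((Real.hasDerivAt_sin φ).mul_const ((x : Euc q) j))).const_mul 2
  have h2 := ((Real.hasDerivAt_cos φ).mul_const (if k = i then (1 : ℝ) else 0)).add
    ((Real.hasDerivAt_sin φ).mul_const (if k = j then (1 : ℝ) else 0))
  exact (h1.mul h2).const_sub _

/-- The derivative of `φ ↦ G (reflCoord i j x φ)`. -/
def reflEvalDeriv (i j : Fin (q + 1)) (G : RPoly q) (φ : ℝ) (x : Sph q) : ℝ :=
  ∑ k, reflCoordDeriv i j x φ k *
    MvPolynomial.eval (reflCoord i j x φ) (MvPolynomial.pderiv k G)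

lemma continuous_reflCoord (i j : Fin (q + 1)) :
    Continuous fun p : ℝ × Sph q => reflCoord i j p.2 p.1 := by
  refine continuous_pi fun k => ?_
  simp only [reflCoord, planeVec_apply]
  fun_prop

lemma continuous_reflEvalDeriv (i j : Fin (q + 1)) (G : RPoly q) :
    Continuous fun p : ℝ × Sph q => reflEvalDeriv i j G p.1 p.2 := by
  unfold reflEvalDeriv
  refine continuous_finsetSum _ fun k _ => Continuous.mul ?_
    ((MvPolynomial.continuous_eval _).comp (continuous_reflCoord i j))
  simp only [reflCoordDeriv, planeVec_apply]
  fun_prop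

lemma integral_reflEvalDeriv_eq_zero (hrot : RotInvariant q μ) {i j : Fin (q + 1)} (hij : i ≠ j)
    (G : RPoly q) : ∫ x, reflEvalDeriv i j G 0 x ∂μ = 0 := by
  have hcont : ∀ φ : ℝ, Continuous fun x : Sph q => MvPolynomial.eval (reflCoord i j x φ) G :=
    fun φ => by
      have h1 : Continuous fun x : Sph q => reflCoord i j x φ := by
        have := (continuous_reflCoord (q := q) i j).comp
          (Continuous.prodMk_right (Y := Sph q) φ)
        exact this
      exact (MvPolynomial.continuous_eval G).comp h1
  have hcont' : Continuous fun x : Sph q => reflEvalDeriv i j G 0 x := by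
    have := (continuous_reflEvalDeriv i j G).comp (Continuous.prodMk_right (Y := Sph q) 0)
    exact this
  obtain ⟨C, hC⟩ := ((isCompact_closedBall (0 : ℝ) 1).prod
    (isCompact_univ (X := Sph q))).exists_bound_of_continuousOn
      (continuous_reflEvalDeriv i j G).continuousOn
  have hd := (hasDerivAt_integral_of_dominated_loc_of_deriv_le (μ := μ)
    (F := fun φ x => MvPolynomial.eval (reflCoord i j x φ) G)
    (F' := fun φ x => reflEvalDeriv i j G φ x) (x₀ := (0 : ℝ)) (bound := fun _ => C)
    (s := Metric.closedBall (0 : ℝ) 1)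
    (Metric.closedBall_mem_nhds _ one_pos)
    (Filter.Eventually.of_forall fun φ => (hcont φ).aestronglyMeasurable)
    (integrable_of_continuous_sphere μ (hcont 0))
    hcont'.aestronglyMeasurable
    (Filter.Eventually.of_forall fun x φ hφ => hC (φ, x) ⟨hφ, Set.mem_univ _⟩)
    (integrable_const C)
    (Filter.Eventually.of_forall fun x φ _ =>
      hasDerivAt_eval_mvPolynomial (c := reflCoord i j x) (c' := reflCoordDeriv i j x) G
        fun k => hasDerivAt_reflCoord i j x φ k)).2
  have hconst : ∀ φ : ℝ, ∫ x, MvPolynomial.eval (reflCoord i j x φ) G ∂μ =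
      ∫ x, sphEval x G ∂μ := by
    intro φ
    rw [← integral_rotate μ hrot (Submodule.reflection (ℝ ∙ planeVec i j φ)ᗮ)
      (continuous_sphEval G)]
    congr 1
    ext x
    rw [sphEval_eq_eval]
    congr 2
    ext k
    exact (reflection_planeVec_apply hij x φ k).symm
  simp only [hconst] at hd
  exact hd.unique (hasDerivAt_const _ _)

lemma reflEvalDeriv_zero {i j : Fin (q + 1)} (hij : i ≠ j) (G : RPoly q) (x : Sph q) :
    reflEvalDeriv i j G 0 x =
      2 * sphEval (rotate (Submodule.reflection (ℝ ∙ planeVec i j 0)ᗮ) x)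
        (MvPolynomial.X i * MvPolynomial.pderiv j G -
          MvPolynomial.X j * MvPolynomial.pderiv i G) := by
  have he : ∀ P : RPoly q, sphEval (rotate (Submodule.reflection (ℝ ∙ planeVec i j 0)ᗮ) x) P =
      MvPolynomial.eval (reflCoord i j x 0) P := by
    intro P
    rw [sphEval_eq_eval]
    congr 2
    ext k
    exact reflection_planeVec_apply hij x 0 k
  have hi : reflCoord i j x 0 i = -(x : Euc q) i := by
    simp [reflCoord, planeVec_apply]; ring
  have hj : reflCoord i j x 0 j = (x : Euc q) j := by
    simp [reflCoord, planeVec_apply, hij.symm]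
  simp only [he, map_sub, map_mul, MvPolynomial.eval_X, hi, hj]
  have hk : ∀ k, reflCoordDeriv i j x 0 k = (if k = i then -(2 * (x : Euc q) j) else 0) +
      (if k = j then -(2 * (x : Euc q) i) else 0) := by
    intro k
    simp only [reflCoordDeriv, planeVec_apply, Real.sin_zero, Real.cos_zero]
    split_ifs <;> ring
  simp only [reflEvalDeriv, hk, add_mul, sum_add_distrib, ite_mul, zero_mul, sum_ite_eq',
    mem_univ, if_true]
  ring

lemma sphInt_angular (hrot : RotInvariant q μ) (i j : Fin (q + 1)) (G : RPoly q) :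
    sphInt μ (MvPolynomial.X i * MvPolynomial.pderiv j G
      - MvPolynomial.X j * MvPolynomial.pderiv i G) = 0 := by
  by_cases hij : i = j
  · rw [hij, sub_self, map_zero]
  · have h := integral_reflEvalDeriv_eq_zero μ hrot hij G
    simp only [reflEvalDeriv_zero hij] at h
    rw [integral_const_mul, integral_rotate μ hrot _
      (continuous_sphEval (MvPolynomial.X i * MvPolynomial.pderiv j G
        - MvPolynomial.X j * MvPolynomial.pderiv i G))] at h
    rw [sphInt_apply]
    linarith

end SphereIntegral

section ReproducingKernel

variable {q : ℕ}

lemma lap_mul (U V : RPoly q) :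
    lap (U * V) = lap U * V + U * lap V +
      2 * ∑ i, MvPolynomial.pderiv i U * MvPolynomial.pderiv i V := by
  simp only [lap, Derivation.leibniz, smul_eq_mul, map_add, sum_mul, mul_sum, ← sum_add_distrib]
  exact sum_congr rfl fun i _ => by ring

lemma pderiv_pderiv_comm (i j : Fin (q + 1)) (P : RPoly q) :
    MvPolynomial.pderiv i (MvPolynomial.pderiv j P) =
      MvPolynomial.pderiv j (MvPolynomial.pderiv i P) := by
  have h : ⁅(MvPolynomial.pderiv i : Derivation ℝ (RPoly q) (RPoly q)),
      (MvPolynomial.pderiv j : Derivation ℝ (RPoly q) (RPoly q))⁆ = 0 := by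
    apply MvPolynomial.derivation_ext
    intro k
    rw [Derivation.commutator_apply]
    simp only [MvPolynomial.pderiv_X, Pi.single_apply]
    split_ifs <;> simp
  have h2 := congrArg (fun D : Derivation ℝ (RPoly q) (RPoly q) => D P) h
  simpa [Derivation.commutator_apply, sub_eq_zero] using h2

lemma lap_pderiv {P : RPoly q} (hP : lap P = 0) (i : Fin (q + 1)) :
    lap (MvPolynomial.pderiv i P) = 0 := by
  have := congrArg (MvPolynomial.pderiv i) hP
  rw [lap, map_sum, map_zero] at this
  rw [lap, ← this]
  refine sum_congr rfl fun j _ => ?_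
  rw [pderiv_pderiv_comm j i, pderiv_pderiv_comm j i]

lemma lap_isHomogeneous {P : RPoly q} {m : ℕ} (hP : P.IsHomogeneous m) :
    (lap P).IsHomogeneous (m - 1 - 1) :=
  MvPolynomial.IsHomogeneous.sum _ _ _ fun _ _ => hP.pderiv.pderiv

lemma pderiv_eq_zero_of_isHomogeneous_zero {P : RPoly q} (hP : P.IsHomogeneous 0)
    (i : Fin (q + 1)) : MvPolynomial.pderiv i P = 0 := by
  rw [← MvPolynomial.totalDegree_zero_iff_isHomogeneous,
    MvPolynomial.totalDegree_eq_zero_iff_eq_C] at hP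
  rw [hP, MvPolynomial.pderiv_C]

variable (μ : Measure (Sph q)) [IsProbabilityMeasure μ]

lemma sphInt_lap (hrot : RotInvariant q μ) {Q : RPoly q} {m : ℕ} (hQ : Q.IsHomogeneous m) :
    sphInt μ (lap Q) = (m : ℝ) * (m + q - 1) * sphInt μ Q := by
  have h0 : sphInt μ (∑ i : Fin (q + 1), ∑ j : Fin (q + 1),
      (MvPolynomial.X i * MvPolynomial.pderiv j (MvPolynomial.X i * MvPolynomial.pderiv j Q)
      - MvPolynomial.X j * MvPolynomial.pderiv i (MvPolynomial.X i * MvPolynomial.pderiv j Q))) =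
      0 := by
    simp only [map_sum, sphInt_angular μ hrot, sum_const_zero]
  have hE := hQ.sum_X_mul_pderiv
  have hE2 : ∀ j : Fin (q + 1), ∑ i, MvPolynomial.X i *
      MvPolynomial.pderiv i (MvPolynomial.pderiv j Q) = (m - 1) • MvPolynomial.pderiv j Q :=
    fun j => hQ.pderiv.sum_X_mul_pderiv
  have h1 : ∑ i : Fin (q + 1), ∑ j : Fin (q + 1),
      MvPolynomial.X i * MvPolynomial.pderiv j (MvPolynomial.X i * MvPolynomial.pderiv j Q) =
      sqForm q * lap Q + m • Q := by
    rw [← hE, sqForm, lap, sum_mul_sum, ← sum_add_distrib]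
    refine sum_congr rfl fun i _ => ?_
    simp only [Derivation.leibniz, MvPolynomial.pderiv_X, smul_eq_mul, mul_add, sum_add_distrib]
    congr 1
    · exact sum_congr rfl fun j _ => by ring
    · rw [sum_eq_single i]
      · simp
      · intro j _ hij
        simp [hij.symm]
      · simp
  have h2 : ∑ i : Fin (q + 1), ∑ j : Fin (q + 1),
      MvPolynomial.X j * MvPolynomial.pderiv i (MvPolynomial.X i * MvPolynomial.pderiv j Q) =
      (m - 1) • m • Q + (q + 1) • m • Q := by
    rw [← hE, sum_comm, smul_sum, smul_sum, ← sum_add_distrib]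
    refine sum_congr rfl fun j _ => ?_
    simp only [Derivation.leibniz, MvPolynomial.pderiv_X_self, smul_eq_mul, mul_add,
      sum_add_distrib, ← mul_sum, hE2]
    simp
    ring
  simp only [sum_sub_distrib, h1, h2] at h0
  rw [map_sub, map_add, map_add, sphInt_sqForm_mul, map_nsmul, map_nsmul, map_nsmul, map_nsmul,
    map_nsmul] at h0
  simp only [nsmul_eq_mul] at h0
  rcases m with _ | m
  · simpa using h0
  · rw [Nat.add_sub_cancel] at h0
    push_cast at h0 ⊢
    linear_combination h0

lemma sphInt_mul_eq_zero (hq : 1 ≤ q) (hrot : RotInvariant q μ) (m : ℕ) :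
    ∀ {U : RPoly q}, U.IsHomogeneous m → ∀ {ℓ : ℕ} {V : RPoly q}, m < ℓ → V.IsHomogeneous ℓ →
      lap V = 0 → sphInt μ (U * V) = 0 := by
  induction m using Nat.strong_induction_on with
  | _ m ih =>
  intro U hU ℓ V hm hV hlV
  have h := sphInt_lap μ hrot (hU.mul hV)
  have hq' : (1 : ℝ) ≤ q := by exact_mod_cast hq
  have hml : (0 : ℝ) < ((m + ℓ : ℕ) : ℝ) := by exact_mod_cast (by omega : 0 < m + ℓ)
  have hz : sphInt μ (lap (U * V)) = 0 := by
    rw [lap_mul, hlV, mul_zero, add_zero]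
    rcases m with _ | m
    · simp only [lap, pderiv_eq_zero_of_isHomogeneous_zero hU]
      simp
    · have e1 : sphInt μ (lap U * V) = 0 :=
        ih (m + 1 - 1 - 1) (by omega) (lap_isHomogeneous hU) (by omega) hV hlV
      have e2 : ∀ i, sphInt μ (MvPolynomial.pderiv i U * MvPolynomial.pderiv i V) = 0 := fun i =>
        ih (m + 1 - 1) (by omega) hU.pderiv (by omega : m + 1 - 1 < ℓ - 1) hV.pderiv
          (lap_pderiv hlV i)
      rw [map_add, e1, two_mul, map_add, map_sum]
      simp [e2]
  rw [hz] at h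
  have hpos : (0 : ℝ) < ((m + ℓ : ℕ) : ℝ) * (((m + ℓ : ℕ) : ℝ) + q - 1) :=
    mul_pos hml (by linarith)
  exact (mul_eq_zero.mp h.symm).resolve_left hpos.ne'

/-- The coefficient of `τ ^ n` in the `n`-th coefficient of `(1 - 2 τ X + s X²)^(-(q+1)/2)`. -/
def leadCoeff (q : ℕ) : ℕ → ℝ
  | 0 => 1
  | (n + 1) => (2 * (n : ℝ) + q + 1) / (n + 1) * leadCoeff q n

lemma sphInt_linForm_pow_mul (hq : 1 ≤ q) (hrot : RotInvariant q μ) (ξ : Sph q) (m : ℕ) :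
    ∀ {V : RPoly q}, V.IsHomogeneous m → lap V = 0 →
      leadCoeff q m * sphInt μ (linForm (fun i => (ξ : Euc q) i) ^ m * V) = sphEval ξ V := by
  induction m with
  | zero =>
    intro V hV _
    rw [← MvPolynomial.totalDegree_zero_iff_isHomogeneous,
      MvPolynomial.totalDegree_eq_zero_iff_eq_C] at hV
    rw [hV, sphInt_apply]
    simp [leadCoeff, sphEval]
  | succ m ih =>
    intro V hV hlV
    set τ := linForm (fun i => (ξ : Euc q) i) with hτ
    have hU : (τ ^ (m + 1)).IsHomogeneous (m + 1) := by
      simpa using (linForm_isHomogeneous fun i => (ξ : Euc q) i).pow (m + 1)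
    have h := sphInt_lap μ hrot (hU.mul hV)
    have e1 : sphInt μ (lap (τ ^ (m + 1)) * V) = 0 :=
      sphInt_mul_eq_zero μ hq hrot (m + 1 - 1 - 1) (lap_isHomogeneous hU) (by omega) hV hlV
    have e2 : ∑ i, MvPolynomial.pderiv i (τ ^ (m + 1)) * MvPolynomial.pderiv i V =
        ∑ i, MvPolynomial.C (((m : ℝ) + 1) * (ξ : Euc q) i) *
          (τ ^ m * MvPolynomial.pderiv i V) := by
      refine sum_congr rfl fun i _ => ?_
      rw [Derivation.leibniz_pow, hτ, pderiv_linForm]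
      simp
      ring
    rw [lap_mul, hlV, mul_zero, add_zero, map_add, e1, zero_add, e2, two_mul, map_add, map_sum] at h
    simp only [sphInt_C_mul] at h
    have e3 : leadCoeff q m * ∑ i, ((m : ℝ) + 1) * (ξ : Euc q) i *
        sphInt μ (τ ^ m * MvPolynomial.pderiv i V) = ((m : ℝ) + 1) ^ 2 * sphEval ξ V := by
      have hE := congrArg (sphEval ξ) hV.sum_X_mul_pderiv
      simp only [map_sum, map_mul, sphEval_X, nsmul_eq_mul, map_natCast] at hE
      push_cast at hE
      rw [sq, mul_assoc, ← hE, mul_sum, mul_sum]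
      refine sum_congr rfl fun i _ => ?_
      have := ih (hV.pderiv (i := i)) (lap_pderiv hlV i)
      rw [← this]
      ring
    have hm : (0 : ℝ) < (m : ℝ) + 1 := by positivity
    rw [leadCoeff]
    push_cast at h
    have h4 : (4 : ℝ) * (m + 1) ^ 2 ≠ 0 := by positivity
    field_simp
    have hmm : (m : ℝ) + 1 ≠ 0 := hm.ne'
    apply mul_left_cancel₀ hmm
    linear_combination (1 / 2) * leadCoeff q m * (-h) + e3

lemma coeff_legS_pow_rec (τ s : RPoly q) (m n : ℕ) :
    ((n : RPoly q) + 2) * PowerSeries.coeff (n + 2) (legS τ s ^ m) =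
      (2 * ((n : RPoly q) + 1) + m) * (τ * PowerSeries.coeff (n + 1) (legS τ s ^ m))
        - ((n : RPoly q) + m) * (s * PowerSeries.coeff n (legS τ s ^ m)) := by
  have h := congrArg (PowerSeries.coeff (n + 1)) (quadS_mul_legS_pow_derivative τ s m)
  set W := legS τ s ^ m
  have e1 : quadS τ s * PowerSeries.derivative (RPoly q) W =
      PowerSeries.derivative (RPoly q) W
        - PowerSeries.C (2 * τ) * (PowerSeries.X * PowerSeries.derivative (RPoly q) W)
        + PowerSeries.C s * (PowerSeries.X * (PowerSeries.X *
          PowerSeries.derivative (RPoly q) W)) := by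
    simp only [quadS, map_mul, map_ofNat]; ring
  have e2 : (m : PowerSeries (RPoly q)) * W * linS τ s =
      PowerSeries.C ((m : RPoly q) * τ) * W
        - PowerSeries.C ((m : RPoly q) * s) * (PowerSeries.X * W) := by
    simp only [linS, map_mul, map_natCast]; ring
  rw [e1, e2] at h
  rcases n with _ | n
  · simp only [PowerSeries.coeff_derivative, PowerSeries.coeff_succ_X_mul,
      PowerSeries.coeff_zero_X_mul, PowerSeries.coeff_C_mul, map_add, map_sub, zero_add] at h ⊢
    push_cast at h ⊢
    linear_combination h
  · simp only [PowerSeries.coeff_derivative, PowerSeries.coeff_succ_X_mul,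
      PowerSeries.coeff_C_mul, map_add, map_sub] at h ⊢
    push_cast at h ⊢
    linear_combination h

lemma coeff_zero_legS_pow (τ s : RPoly q) (m : ℕ) :
    PowerSeries.coeff 0 (legS τ s ^ m) = 1 := by
  simp [legS, legCoeff]

lemma coeff_one_legS_pow (τ s : RPoly q) (m : ℕ) :
    PowerSeries.coeff 1 (legS τ s ^ m) = m * τ := by
  induction m with
  | zero => simp [PowerSeries.coeff_one]
  | succ m ih =>
    rw [pow_succ, PowerSeries.coeff_mul, Nat.antidiagonal_succ]
    simp only [Nat.antidiagonal_zero, sum_cons, map_singleton, sum_singleton]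
    simp only [Function.Embedding.prodMap, Function.Embedding.coeFn_mk, Prod.map, ih,
      coeff_zero_legS_pow]
    simp [legS, legCoeff]
    ring

lemma natCast_eq_C (n : ℕ) : (n : RPoly q) = MvPolynomial.C (n : ℝ) := by simp

lemma sphInt_coeff_legS_pow (hq : 1 ≤ q) (hrot : RotInvariant q μ) (ξ : Sph q) (n : ℕ) :
    ∀ (j : ℕ) {V : RPoly q}, V.IsHomogeneous (n + j) → lap V = 0 →
      sphInt μ (PowerSeries.coeff n (legS (linForm fun i => (ξ : Euc q) i) (sqForm q) ^ (q + 1)) *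
        (linForm (fun i => (ξ : Euc q) i) ^ j * V)) =
      leadCoeff q n * sphInt μ (linForm (fun i => (ξ : Euc q) i) ^ (n + j) * V) := by
  set τ := linForm (fun i => (ξ : Euc q) i) with hτ
  set W := legS τ (sqForm q) ^ (q + 1) with hW
  have hτj : ∀ j : ℕ, (τ ^ j).IsHomogeneous j := fun j => by
    simpa using (linForm_isHomogeneous fun i => (ξ : Euc q) i).pow j
  have hWn : GradedS W := (gradedS_legS _).pow _
  induction n using Nat.twoStepInduction with
  | zero =>
    intro j V _ _
    rw [hW, coeff_zero_legS_pow, leadCoeff, one_mul, one_mul, zero_add]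
  | one =>
    intro j V _ _
    rw [hW, coeff_one_legS_pow, natCast_eq_C, mul_assoc, sphInt_C_mul, ← mul_assoc τ, ← pow_succ',
      add_comm 1 j]
    simp [leadCoeff]
  | more n _ ih =>
    intro j V hV hlV
    have hr := coeff_legS_pow_rec τ (sqForm q) (q + 1) n
    rw [← hW] at hr
    have h1 := ih (j + 1) (V := V) (by rwa [show n + 1 + (j + 1) = n + 2 + j by ring]) hlV
    have h2 : sphInt μ (sqForm q * (PowerSeries.coeff n W * τ ^ j * V)) = 0 := by
      rw [sphInt_sqForm_mul]
      exact sphInt_mul_eq_zero μ hq hrot (n + j) ((hWn n).mul (hτj j)) (by omega) hV hlV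
    have h3 : MvPolynomial.C ((n : ℝ) + 2) * (PowerSeries.coeff (n + 2) W * (τ ^ j * V)) =
        MvPolynomial.C (2 * ((n : ℝ) + 1) + (q + 1)) *
          (PowerSeries.coeff (n + 1) W * (τ ^ (j + 1) * V)) -
        MvPolynomial.C ((n : ℝ) + (q + 1)) *
          (sqForm q * (PowerSeries.coeff n W * τ ^ j * V)) := by
      simp only [map_add, map_mul, map_natCast, map_ofNat, map_one]
      push_cast at hr
      linear_combination (τ ^ j * V) * hr
    have h4 := congrArg (sphInt μ) h3
    rw [map_sub, sphInt_C_mul, sphInt_C_mul, sphInt_C_mul, h1, h2,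
      show n + 1 + (j + 1) = n + 2 + j by ring] at h4
    rw [leadCoeff]
    push_cast
    field_simp
    linear_combination h4

lemma coeff_zonalS_succ_succ (a : Fin (q + 1) → ℝ) (n : ℕ) :
    PowerSeries.coeff (n + 2) (zonalS a) =
      PowerSeries.coeff (n + 2) (legS (linForm a) (sqForm q) ^ (q + 1))
        - sqForm q * PowerSeries.coeff n (legS (linForm a) (sqForm q) ^ (q + 1)) := by
  have : zonalS a = legS (linForm a) (sqForm q) ^ (q + 1) - PowerSeries.C (sqForm q) *
      (PowerSeries.X * (PowerSeries.X * legS (linForm a) (sqForm q) ^ (q + 1))) := by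
    rw [zonalS]; ring
  rw [this, map_sub, PowerSeries.coeff_C_mul, PowerSeries.coeff_succ_X_mul,
    PowerSeries.coeff_succ_X_mul]

lemma coeff_zonalS_of_lt_two (a : Fin (q + 1) → ℝ) {n : ℕ} (hn : n < 2) :
    PowerSeries.coeff n (zonalS a) =
      PowerSeries.coeff n (legS (linForm a) (sqForm q) ^ (q + 1)) := by
  have : zonalS a = legS (linForm a) (sqForm q) ^ (q + 1) - PowerSeries.C (sqForm q) *
      (PowerSeries.X * (PowerSeries.X * legS (linForm a) (sqForm q) ^ (q + 1))) := by
    rw [zonalS]; ring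
  rw [this, map_sub, PowerSeries.coeff_C_mul]
  interval_cases n
  · simp
  · rw [PowerSeries.coeff_succ_X_mul, PowerSeries.coeff_zero_X_mul, mul_zero, sub_zero]

lemma sphInt_coeff_zonalS_mul (hq : 1 ≤ q) (hrot : RotInvariant q μ) (ξ : Sph q) (n : ℕ)
    {V : RPoly q} (hV : V.IsHomogeneous n) (hlV : lap V = 0) :
    sphInt μ (PowerSeries.coeff n (zonalS fun i => (ξ : Euc q) i) * V) = sphEval ξ V := by
  have h := sphInt_coeff_legS_pow μ hq hrot ξ n 0 hV hlV
  rw [pow_zero, one_mul, add_zero, sphInt_linForm_pow_mul μ hq hrot ξ n hV hlV] at h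
  by_cases hn : n < 2
  · rw [coeff_zonalS_of_lt_two _ hn, h]
  · obtain ⟨k, rfl⟩ := Nat.exists_eq_add_of_le' (not_lt.mp hn)
    rw [coeff_zonalS_succ_succ, sub_mul, map_sub, h, mul_assoc, sphInt_sqForm_mul,
      sphInt_mul_eq_zero μ hq hrot k ((gradedS_legS _).pow _ k) (by omega) hV hlV, sub_zero]

/-- The addition formula for spherical harmonics. -/
lemma sum_mul_eq_coeff (hq : 1 ≤ q) (hrot : RotInvariant q μ) {d : ℕ → ℕ}
    {Y : (ℓ : ℕ) → Fin (d ℓ) → Sph q → ℝ} (hY : GoodBasis q μ d Y) (ℓ : ℕ) (x ξ : Sph q) :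
    ∑ k, Y ℓ k x * Y ℓ k ξ =
      PowerSeries.coeff ℓ ((1 - PowerSeries.X ^ 2) * legS (dot x ξ) 1 ^ (q + 1)) := by
  obtain ⟨hY1, hY2, hY3⟩ := hY
  set K := PowerSeries.coeff ℓ (zonalS fun i => (ξ : Euc q) i) with hK
  obtain ⟨a, ha⟩ := hY3 ℓ (fun y => sphEval y K)
    ⟨K, gradedS_zonalS _ ℓ, lap_coeff_zonalS (sum_sq_eq_one ξ) ℓ, fun y => sphEval_eq_eval y K⟩
  have hak : ∀ k, a k = Y ℓ k ξ := by
    intro k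
    obtain ⟨V, hV, hlV, hVe⟩ := hY1 ℓ k
    have hcont : ∀ k', Continuous (Y ℓ k') := by
      intro k'
      obtain ⟨V', _, _, hVe'⟩ := hY1 ℓ k'
      rw [show Y ℓ k' = fun y => sphEval y V' from funext fun y => by
        rw [hVe', sphEval_eq_eval]]
      exact continuous_sphEval V'
    have h := sphInt_coeff_zonalS_mul μ hq hrot ξ ℓ hV hlV
    rw [sphInt_apply, sphEval_eq_eval, ← hVe] at h
    rw [← h]
    have h2 : ∀ y, sphEval y (K * V) = ∑ k', a k' * (Y ℓ k' y * Y ℓ k y) := by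
      intro y
      rw [map_mul, ha, sphEval_eq_eval, ← hVe, sum_mul]
      exact sum_congr rfl fun _ _ => by ring
    simp only [← hK, h2]
    have hint : ∀ k', Integrable (fun y => a k' * (Y ℓ k' y * Y ℓ k y)) μ := fun k' =>
      integrable_of_continuous_sphere μ (((hcont k').mul (hcont k)).const_mul (a k'))
    rw [integral_finsetSum _ fun k' _ => hint k']
    simp only [integral_const_mul, hY2]
    rw [sum_eq_single k]
    · simp
    · intro k' _ hk
      have : (k' : ℕ) ≠ k := fun h => hk (Fin.ext h)
      simp [this]
    · simp
  rw [← sphEval_coeff_zonalS, ← hK, ha]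
  exact sum_congr rfl fun k _ => by rw [hak, mul_comm]

lemma phi_eq_zonalSum (hq : 1 ≤ q) (hrot : RotInvariant q μ) {d : ℕ → ℕ}
    {Y : (ℓ : ℕ) → Fin (d ℓ) → Sph q → ℝ} (hY : GoodBasis q μ d Y) (h : ℝ → ℝ) (n : ℕ)
    (x ξ : Sph q) : Phi d Y h n x ξ = zonalSum q h n (dot x ξ) := by
  simp only [Phi, zonalSum, sum_mul_eq_coeff μ hq hrot hY]

end ReproducingKernel

/-- Localization estimates for the kernel `Φ_n`. -/
theorem statement3 (q S : ℕ) (hq : 1 ≤ q) (hSq : q ≤ S) (h : ℝ → ℝ) (hh : GoodH S h)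
    (μ : Measure (Sph q)) (hμ : IsProbabilityMeasure μ) (hrot : RotInvariant q μ)
    (d : ℕ → ℕ) (Y : (ℓ : ℕ) → Fin (d ℓ) → Sph q → ℝ) (hY : GoodBasis q μ d Y) :
    ∃ c : ℝ, 0 < c ∧ ∀ n : ℕ, 1 ≤ n → ∀ x ξ : Sph q, ξ ≠ x →
      (0 ≤ dot x ξ → dot x ξ < 1 →
        |Phi d Y h n x ξ| ≤
          c * (n : ℝ) ^ q *
            ((n : ℝ) * Real.sqrt (1 - dot x ξ)) ^ ((1 : ℝ) / 2 - (q : ℝ) / 2 - (S : ℝ))) ∧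
      (-1 ≤ dot x ξ → dot x ξ < 0 →
        |Phi d Y h n x ξ| ≤ c * (n : ℝ) ^ ((q : ℝ) - (S : ℝ))) := by
  obtain ⟨c₁, hc₁, h₁⟩ := hh.abs_zonalSum_le_of_nonneg q (hq.trans hSq)
  obtain ⟨c₂, hc₂, h₂⟩ := hh.abs_zonalSum_le_of_neg q
  refine ⟨c₁ + c₂ + 1, by positivity, fun n hn x ξ _ => ⟨fun h0 h1 => ?_, fun h0 h1 => ?_⟩⟩
  · rw [phi_eq_zonalSum μ hq hrot hY]
    refine (h₁ n hn _ h0 h1).trans ?_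
    gcongr
    linarith
  · rw [phi_eq_zonalSum μ hq hrot hY]
    refine (h₂ n hn _ h0 h1).trans ?_
    gcongr
    linarith

end SD
end
end

section
/- Let q ≥ 1, S ≥ q be integers and let h : [0,∞) → ℝ be nonincreasing, with h(x) = 1 for x ∈ [0,1/2], h(x) = 0 for x > 1, and h an S-times iterated integral of a function of bounded variation. Let m ≥ 1 be an integer and let the finite set C ⊂ S^q admit an M–Z quadrature of order m with weights (w_ξ)_{ξ∈C} and M–Z constant c₀. Then there exists a constant c > 0 depending only on q, h, and c₀ such that |w_ξ| ≤ c m^{−q} for every ξ ∈ C. -/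
noncomputable section

open MeasureTheory Finset

namespace SD

/-- The `L²(μ)` bilinear form on continuous functions on a compact space. -/
def l2Form {X : Type*} [TopologicalSpace X] [CompactSpace X] [MeasurableSpace X] [BorelSpace X]
    (μ : Measure X) [IsFiniteMeasure μ] : LinearMap.BilinForm ℝ C(X, ℝ) :=
  have hint : ∀ f g : C(X, ℝ), Integrable (fun x => f x * g x) μ := fun f g =>
    (f * g).continuous.integrable_of_hasCompactSupport (HasCompactSupport.of_compactSpace _)
  LinearMap.mk₂ ℝ (fun f g => ∫ x, f x * g x ∂μ)
    (fun f f' g => by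
      simp only [ContinuousMap.add_apply, add_mul]
      exact integral_add (hint f g) (hint f' g))
    (fun a f g => by
      simp only [ContinuousMap.smul_apply, smul_eq_mul, mul_assoc]
      exact integral_const_mul a _)
    (fun f g g' => by
      simp only [ContinuousMap.add_apply, mul_add]
      exact integral_add (hint f g) (hint f g'))
    (fun a f g => by
      simp only [ContinuousMap.smul_apply, smul_eq_mul, mul_left_comm _ a]
      exact integral_const_mul a _)

lemma l2Form_apply {X : Type*} [TopologicalSpace X] [CompactSpace X] [MeasurableSpace X]
    [BorelSpace X] (μ : Measure X) [IsFiniteMeasure μ] (f g : C(X, ℝ)) :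
    l2Form μ f g = ∫ x, f x * g x ∂μ := rfl

/-- A finite-dimensional space of continuous functions whose point evaluations are bounded by
`β` (squared, in `L²` of a probability measure) has dimension at most `β`. -/
lemma finrank_le_of_sq_eval_le {X : Type*} [TopologicalSpace X] [CompactSpace X]
    [MeasurableSpace X] [BorelSpace X] (μ : Measure X) [IsProbabilityMeasure μ]
    (U : Submodule ℝ C(X, ℝ)) [FiniteDimensional ℝ U] {β : ℝ} (hβ0 : 0 ≤ β)
    (hβ : ∀ f ∈ U, ∀ x, f x ^ 2 ≤ β * ∫ y, f y * f y ∂μ) :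
    (Module.finrank ℝ U : ℝ) ≤ β := by
  have : Invertible (2 : ℝ) := invertibleOfNonzero two_ne_zero
  obtain ⟨v, hv⟩ := LinearMap.BilinForm.exists_orthogonal_basis
    (B := (l2Form μ).restrict U) ⟨fun f g => by
      change ∫ x, (f : C(X, ℝ)) x * (g : C(X, ℝ)) x ∂μ = ∫ x, (g : C(X, ℝ)) x * (f : C(X, ℝ)) x ∂μ
      simp only [mul_comm]⟩
  let b : Fin (Module.finrank ℝ U) → ℝ := fun i => l2Form μ (v i) (v i)
  have hortho : ∀ i j, i ≠ j → l2Form μ (v i : C(X, ℝ)) (v j) = 0 := fun i j hij => hv hij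
  have hbpos : ∀ i, 0 < b i := by
    intro i
    have h0 : 0 ≤ b i := integral_nonneg fun x => mul_self_nonneg _
    refine lt_of_le_of_ne h0 fun h => v.ne_zero i ?_
    ext x
    have h1 := hβ (v i) (v i).2 x
    rw [← l2Form_apply, show l2Form μ (v i : C(X, ℝ)) (v i) = 0 from h.symm, mul_zero] at h1
    simpa using le_antisymm h1 (sq_nonneg _)
  have hK : ∀ x, ∑ i, (b i)⁻¹ * ((v i : C(X, ℝ)) x * (v i : C(X, ℝ)) x) ≤ β := by
    intro x
    set K := ∑ i, (b i)⁻¹ * ((v i : C(X, ℝ)) x * (v i : C(X, ℝ)) x) with hKdef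
    have hKnn : 0 ≤ K :=
      sum_nonneg fun i _ => mul_nonneg (inv_nonneg.2 (hbpos i).le) (mul_self_nonneg _)
    let f : C(X, ℝ) := ∑ i, ((b i)⁻¹ * (v i : C(X, ℝ)) x) • (v i : C(X, ℝ))
    have hf : f ∈ U := Submodule.sum_mem _ fun i _ => U.smul_mem _ (v i).2
    have hfx : f x = K := by
      simp only [f, hKdef, ContinuousMap.sum_apply, ContinuousMap.smul_apply, smul_eq_mul,
        mul_assoc]
    have hff : ∫ y, f y * f y ∂μ = K := by
      rw [← l2Form_apply]
      simp only [f, map_sum, LinearMap.sum_apply, map_smul, LinearMap.smul_apply, smul_eq_mul]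
      refine sum_congr rfl fun i _ => ?_
      rw [sum_eq_single i]
      · have := (hbpos i).ne'
        change _ * (_ * b i) = _
        field_simp
      · intro j _ hji
        simp [hortho _ _ hji]
      · simp
    have h1 := hβ f hf x
    rw [hfx, hff] at h1
    rcases hKnn.eq_or_lt with h0 | h0
    · exact h0 ▸ hβ0
    · nlinarith
  have hint : ∀ i, Integrable
      (fun x => (b i)⁻¹ * ((v i : C(X, ℝ)) x * (v i : C(X, ℝ)) x)) μ := fun i =>
    (((v i : C(X, ℝ)) * (v i : C(X, ℝ))).continuous.integrable_of_hasCompactSupport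
      (HasCompactSupport.of_compactSpace _)).const_mul _
  calc (Module.finrank ℝ U : ℝ)
      = ∑ i, (b i)⁻¹ * ∫ x, (v i : C(X, ℝ)) x * (v i : C(X, ℝ)) x ∂μ := by
        have h1 : ∀ i, (b i)⁻¹ * ∫ x, (v i : C(X, ℝ)) x * (v i : C(X, ℝ)) x ∂μ = 1 := fun i =>
          inv_mul_cancel₀ (hbpos i).ne'
        simp [h1]
    _ = ∫ x, ∑ i, (b i)⁻¹ * ((v i : C(X, ℝ)) x * (v i : C(X, ℝ)) x) ∂μ := by
        rw [integral_finsetSum]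
        · simp only [integral_const_mul]
        · exact fun i _ => hint i
    _ ≤ ∫ _, β ∂μ := by
        refine integral_mono ?_ (integrable_const _) hK
        exact integrable_finsetSum _ fun i _ => hint i
    _ = β := by simp

lemma totalDegree_bind₁_le {σ τ R : Type*} [CommSemiring R] (f : σ → MvPolynomial τ R)
    (hf : ∀ i, (f i).totalDegree ≤ 1) (p : MvPolynomial σ R) :
    (MvPolynomial.bind₁ f p).totalDegree ≤ p.totalDegree := by
  conv_lhs => rw [p.as_sum]
  rw [map_sum]
  refine MvPolynomial.totalDegree_finsetSum_le fun s hs => ?_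
  rw [MvPolynomial.bind₁_monomial]
  refine (MvPolynomial.totalDegree_mul _ _).trans ?_
  rw [MvPolynomial.totalDegree_C, zero_add]
  refine (MvPolynomial.totalDegree_finsetProd _ _).trans
    (le_trans (sum_le_sum fun i _ => ?_) (MvPolynomial.le_totalDegree hs))
  exact (MvPolynomial.totalDegree_pow _ _).trans (by simpa using Nat.mul_le_mul_left (s i) (hf i))

lemma InPi.comp_rotate {q n : ℕ} {f : Sph q → ℝ} (hf : InPi q n f) (R : Euc q ≃ₗᵢ[ℝ] Euc q) :
    InPi q n fun x => f (rotate R x) := by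
  obtain ⟨P, hP, hPf⟩ := hf
  let F : Fin (q + 1) → MvPolynomial (Fin (q + 1)) ℝ := fun i =>
    ∑ j, MvPolynomial.C (R (EuclideanSpace.single j 1) i) * MvPolynomial.X j
  refine ⟨MvPolynomial.bind₁ F P, (totalDegree_bind₁_le F (fun i => ?_) P).trans hP, fun x => ?_⟩
  · refine MvPolynomial.totalDegree_finsetSum_le fun j _ =>
      (MvPolynomial.totalDegree_mul _ _).trans ?_
    simp
  · beta_reduce
    rw [hPf, MvPolynomial.eval, MvPolynomial.eval, MvPolynomial.eval₂Hom_bind₁]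
    congr 2
    funext i
    have hx : (x : Euc q) = ∑ j, (x : Euc q) j • EuclideanSpace.single j (1 : ℝ) := by
      ext i
      simp [Pi.single_apply]
    change R (x : Euc q) i = MvPolynomial.eval _ (F i)
    conv_lhs => rw [hx]
    simp [F, mul_comm]

lemma InPi.continuous {q n : ℕ} {f : Sph q → ℝ} (hf : InPi q n f) : Continuous f := by
  obtain ⟨P, -, hPf⟩ := hf
  rw [funext hPf]
  exact (MvPolynomial.continuous_eval P).comp (by fun_prop)

lemma continuous_rotate {q : ℕ} (R : Euc q ≃ₗᵢ[ℝ] Euc q) : Continuous (rotate (q := q) R) :=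
  (R.continuous.comp continuous_subtype_val).subtype_mk _

lemma exists_rotate_eq {q : ℕ} (x y : Sph q) : ∃ R : Euc q ≃ₗᵢ[ℝ] Euc q, rotate R x = y := by
  have h : ‖(x : Euc q)‖ = ‖(y : Euc q)‖ := by
    rw [mem_sphere_zero_iff_norm.mp x.2, mem_sphere_zero_iff_norm.mp y.2]
  exact ⟨_, Subtype.ext (Submodule.reflection_sub h)⟩

/-- Evaluation on the sphere of polynomials in the first `q` coordinates. -/
def evalInit (q : ℕ) : MvPolynomial (Fin q) ℝ →ₐ[ℝ] C(Sph q, ℝ) :=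
  MvPolynomial.aeval fun i => ⟨fun x => (x : Euc q) i.castSucc, by fun_prop⟩

lemma evalInit_apply {q : ℕ} (p : MvPolynomial (Fin q) ℝ) (x : Sph q) :
    evalInit q p x = MvPolynomial.eval (fun i => (x : Euc q) i.castSucc) p := by
  induction p using MvPolynomial.induction_on with
  | C a => simp [evalInit]
  | add p r hp hr => simp [hp, hr]
  | mul_X p i hp => simp [hp]; simp [evalInit]

lemma inPi_evalInit {q n : ℕ} {p : MvPolynomial (Fin q) ℝ} (hp : p.totalDegree ≤ n) :
    InPi q n (evalInit q p) :=
  ⟨MvPolynomial.rename Fin.castSucc p, (MvPolynomial.totalDegree_rename_le _ _).trans hp,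
    fun x => by rw [evalInit_apply, MvPolynomial.eval_rename]; rfl⟩

lemma evalInit_injective {q : ℕ} (hq : 1 ≤ q) : Function.Injective (evalInit q) := by
  intro p r hpr
  have hq0 : (0 : ℝ) < q := by exact_mod_cast hq
  refine MvPolynomial.funext_set (fun _ => Set.Icc 0 (q : ℝ)⁻¹)
    (fun _ => Set.Icc_infinite (by positivity)) fun y hy => ?_
  have hy' : ∀ i, 0 ≤ y i ∧ y i ≤ (q : ℝ)⁻¹ := fun i => hy i (Set.mem_univ i)
  have hsum : ∑ i, y i ^ 2 ≤ 1 := by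
    have hq1 : (q : ℝ)⁻¹ ≤ 1 := inv_le_one_of_one_le₀ (by exact_mod_cast hq)
    calc ∑ i, y i ^ 2 ≤ ∑ _i : Fin q, (q : ℝ)⁻¹ :=
          sum_le_sum fun i _ => by nlinarith [hy' i]
      _ = 1 := by simp [hq0.ne']
  let z : Euc q := WithLp.toLp 2 (Fin.snoc y (√(1 - ∑ i, y i ^ 2)))
  have hz : z ∈ Metric.sphere (0 : Euc q) 1 := by
    rw [mem_sphere_zero_iff_norm, EuclideanSpace.norm_eq, Real.sqrt_eq_one, Fin.sum_univ_castSucc]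
    simp [z, Real.sq_sqrt (sub_nonneg.2 hsum)]
  have := congrArg (fun f : C(Sph q, ℝ) => f ⟨z, hz⟩) hpr
  simpa [evalInit_apply, z] using this

/-- The monomials in `q` variables of degree less than `k` in each of them. -/
def boxMonomial (q k : ℕ) (a : Fin q → Fin k) : MvPolynomial (Fin q) ℝ :=
  MvPolynomial.monomial (Finsupp.equivFunOnFinite.symm fun i => (a i : ℕ)) 1

lemma linearIndependent_boxMonomial (q k : ℕ) : LinearIndependent ℝ (boxMonomial q k) := by
  have h := (MvPolynomial.basisMonomials (Fin q) ℝ).linearIndependent.comp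
    (fun a : Fin q → Fin k => Finsupp.equivFunOnFinite.symm fun i => (a i : ℕ)) ?_
  · rw [MvPolynomial.coe_basisMonomials] at h
    exact h
  · intro a b hab
    funext i
    exact Fin.ext (congrFun (Finsupp.equivFunOnFinite.symm.injective hab) i)

lemma totalDegree_boxMonomial_le {q k : ℕ} (a : Fin q → Fin k) :
    (boxMonomial q k a).totalDegree ≤ q * (k - 1) := by
  refine (MvPolynomial.totalDegree_monomial_le _ _).trans ?_
  rw [Finsupp.sum_fintype _ _ (fun _ => rfl)]
  calc ∑ i, (a i : ℕ) ≤ ∑ _i : Fin q, (k - 1) := sum_le_sum fun i _ => by omega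
    _ = q * (k - 1) := by simp

/-- There is a space of polynomials of degree at most `n` on the sphere of dimension at least
`(n / q) ^ q`. -/
lemma exists_submodule_inPi {q : ℕ} (hq : 1 ≤ q) (n : ℕ) :
    ∃ U : Submodule ℝ C(Sph q, ℝ), FiniteDimensional ℝ U ∧ (∀ f ∈ U, InPi q n f) ∧
      ((n : ℝ) / q) ^ q ≤ Module.finrank ℝ U := by
  set k := n / q + 1 with hk
  have hli : LinearIndependent ℝ fun a => evalInit q (boxMonomial q k a) :=
    (linearIndependent_boxMonomial q k).map' (evalInit q).toLinearMap
      (LinearMap.ker_eq_bot.2 (evalInit_injective hq))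
  refine ⟨Submodule.span ℝ (Set.range fun a => evalInit q (boxMonomial q k a)),
    FiniteDimensional.span_of_finite ℝ (Set.finite_range _), fun f hf => ?_, ?_⟩
  · have hle : Submodule.span ℝ (Set.range fun a => evalInit q (boxMonomial q k a)) ≤
        (MvPolynomial.restrictTotalDegree (Fin q) ℝ n).map (evalInit q).toLinearMap := by
      rw [Submodule.span_le]
      rintro _ ⟨a, rfl⟩
      refine ⟨boxMonomial q k a, ?_, rfl⟩
      rw [SetLike.mem_coe, MvPolynomial.mem_restrictTotalDegree]
      refine (totalDegree_boxMonomial_le a).trans ?_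
      rw [hk, Nat.add_sub_cancel]
      exact Nat.mul_div_le n q
    obtain ⟨p, hp, rfl⟩ := hle hf
    rw [SetLike.mem_coe, MvPolynomial.mem_restrictTotalDegree] at hp
    exact inPi_evalInit hp
  · rw [finrank_span_eq_card hli]
    simp only [Fintype.card_fun, Fintype.card_fin, Nat.cast_pow]
    have hq0 : (0 : ℝ) < q := by exact_mod_cast hq
    refine pow_le_pow_left₀ (by positivity) ?_ q
    rw [div_le_iff₀ hq0]
    exact_mod_cast (Nat.lt_div_mul_add (a := n) hq).le.trans (by rw [hk]; ring_nf; rfl)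

/-- The `p = 2` Marcinkiewicz–Zygmund inequality, restricted to a single node. -/
lemma MZQuad.abs_weight_mul_sq_le {q m : ℕ} {μ : Measure (Sph q)} {C : Finset (Sph q)}
    {w : Sph q → ℝ} {c₀ : ℝ} (hC : MZQuad q μ m C w c₀) {P : Sph q → ℝ}
    (hP : InPi q (2 * m) P) {ξ : Sph q} (hξ : ξ ∈ C) :
    |w ξ| * P ξ ^ 2 ≤ c₀ ^ 2 * ∫ x, P x * P x ∂μ := by
  have h := hC.2 P hP 2 one_le_two
  simp only [Real.rpow_two, sq_abs, ← Real.sqrt_eq_rpow] at h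
  have hS : 0 ≤ ∑ ξ ∈ C, |w ξ| * P ξ ^ 2 :=
    sum_nonneg fun _ _ => mul_nonneg (abs_nonneg _) (sq_nonneg _)
  have hI : 0 ≤ ∫ x, P x ^ 2 ∂μ := integral_nonneg fun _ => sq_nonneg _
  have h2 := pow_le_pow_left₀ (Real.sqrt_nonneg _) h 2
  rw [mul_pow, Real.sq_sqrt hS, Real.sq_sqrt hI] at h2
  simp only [← sq]
  exact (single_le_sum (f := fun ξ => |w ξ| * P ξ ^ 2)
    (fun _ _ => mul_nonneg (abs_nonneg _) (sq_nonneg _)) hξ).trans h2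

/-- By rotation invariance, an M–Z quadrature with a nonzero weight bounds all point
evaluations of polynomials in terms of their `L²` norms. -/
lemma MZQuad.abs_weight_mul_sq_le_everywhere {q m : ℕ} {μ : Measure (Sph q)}
    (hrot : RotInvariant q μ) {C : Finset (Sph q)} {w : Sph q → ℝ} {c₀ : ℝ}
    (hC : MZQuad q μ m C w c₀) {P : Sph q → ℝ} (hP : InPi q (2 * m) P) {ξ : Sph q} (hξ : ξ ∈ C)
    (x : Sph q) : |w ξ| * P x ^ 2 ≤ c₀ ^ 2 * ∫ x, P x * P x ∂μ := by
  obtain ⟨R, rfl⟩ := exists_rotate_eq ξ x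
  refine (hC.abs_weight_mul_sq_le (hP.comp_rotate R) hξ).trans_eq ?_
  conv_rhs => rw [← hrot R]
  rw [integral_map (f := fun x => P x * P x) (continuous_rotate R).measurable.aemeasurable
    (hP.continuous.mul hP.continuous).aestronglyMeasurable]

/-- Any weights of an M–Z quadrature of order `m` satisfy `|w_ξ| ≤ c m^{-q}`. -/
theorem statement4 (q S : ℕ) (hq : 1 ≤ q) (hSq : q ≤ S) (h : ℝ → ℝ) (hh : GoodH S h)
    (μ : Measure (Sph q)) (hμ : IsProbabilityMeasure μ) (hrot : RotInvariant q μ)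
    (d : ℕ → ℕ) (Y : (ℓ : ℕ) → Fin (d ℓ) → Sph q → ℝ) (hY : GoodBasis q μ d Y) (c₀ : ℝ) (hc₀ : 0 < c₀) :
    ∃ c : ℝ, 0 < c ∧ ∀ m : ℕ, 1 ≤ m → ∀ (C : Finset (Sph q)) (w : Sph q → ℝ),
      MZQuad q μ m C w c₀ → ∀ ξ ∈ C, |w ξ| ≤ c * (m : ℝ) ^ (-(q : ℝ)) := by
  have hq0 : (0 : ℝ) < q := by exact_mod_cast hq
  refine ⟨c₀ ^ 2 * (q : ℝ) ^ q, by positivity, fun m hm C w hC ξ hξ => ?_⟩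
  have hm0 : (0 : ℝ) < m := by exact_mod_cast hm
  rw [Real.rpow_neg hm0.le, Real.rpow_natCast]
  rcases (abs_nonneg (w ξ)).eq_or_lt with h0 | h0
  · rw [← h0]
    positivity
  obtain ⟨U, hU, hUP, hdim⟩ := exists_submodule_inPi hq (2 * m)
  have hfin := finrank_le_of_sq_eval_le μ U (β := c₀ ^ 2 / |w ξ|) (by positivity) fun f hf x => by
    rw [div_mul_eq_mul_div, le_div_iff₀' h0]
    exact hC.abs_weight_mul_sq_le_everywhere hrot (hUP f hf) hξ x
  have hpow : ((m : ℝ) / q) ^ q ≤ c₀ ^ 2 / |w ξ| := by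
    refine (pow_le_pow_left₀ (by positivity) ?_ q).trans (hdim.trans hfin)
    gcongr
    omega
  rw [div_pow, div_le_div_iff₀ (by positivity) h0] at hpow
  rw [← div_eq_mul_inv, le_div_iff₀' (by positivity)]
  exact hpow

end SD
end
end
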